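/- Let d ≥ 1, let R be a d×d expanding integer matrix, and let B, L ⊂ ℤ^d be finite sets with #B = #L = N such that (R,B,L) is a Hadamard triple. Then the self-affine measure μ(R,B) is a spectral measure. -/

import Mathlib

open MeasureTheory Matrix Filter
open scoped BigOperators Classical

noncomputable section

variable {ι : Type*}

/-- Cast an integer matrix to a real matrix. -/
def intMatCast [Fintype ι] [DecidableEq ι] (R : Matrix ι ι ℤ) : Matrix ι ι ℝ :=
  R.map (Int.cast : ℤ → ℝ)

/-- Cast an integer vector to a real vector. -/
def intVecCast (v : ι → ℤ) : ι → ℝ := fun i => (v i : ℝ)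

/-- Standard inner product on `ι → ℝ`. -/
def rdot [Fintype ι] (x y : ι → ℝ) : ℝ := ∑ i, x i * y i

/-- The exponential `e^{2πi⟨x,y⟩}`. -/
def expv [Fintype ι] (x y : ι → ℝ) : ℂ :=
  Complex.exp (2 * (Real.pi : ℂ) * Complex.I * (rdot x y : ℝ))

/-- An integer matrix is expanding if all of its (complex) eigenvalues have modulus
strictly greater than `1`. -/
def IsExpanding [Fintype ι] [DecidableEq ι] (R : Matrix ι ι ℤ) : Prop :=
  ∀ z ∈ spectrum ℂ (R.map (Int.cast : ℤ → ℂ)), 1 < ‖z‖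

/-- `(R,B,L)` is a Hadamard triple: `#B = #L` and the matrix
`(1/√N)(e^{2πi⟨R⁻¹b,ℓ⟩})_{ℓ∈L,b∈B}` is unitary, expressed via orthonormality of columns. -/
def IsHadamardTriple [Fintype ι] [DecidableEq ι] (R : Matrix ι ι ℤ)
    (B L : Finset (ι → ℤ)) : Prop :=
  B.card = L.card ∧
  ∀ b ∈ B, ∀ b' ∈ B,
    (B.card : ℂ)⁻¹ * ∑ l ∈ L,
      expv ((intMatCast R)⁻¹.mulVec (intVecCast b)) (intVecCast l) *
        (starRingEnd ℂ) (expv ((intMatCast R)⁻¹.mulVec (intVecCast b')) (intVecCast l)) =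
    if b = b' then 1 else 0

/-- `μ` is the self-affine measure `μ(R,B)`: a compactly supported Borel probability
measure satisfying `μ(E) = (1/N) ∑_{b∈B} μ(τ_b⁻¹(E))` where `τ_b(x) = R⁻¹(x+b)`. -/
def IsSelfAffineMeasure [Fintype ι] [DecidableEq ι] (R : Matrix ι ι ℤ)
    (B : Finset (ι → ℤ)) (μ : Measure (ι → ℝ)) : Prop :=
  IsProbabilityMeasure μ ∧ (∃ K : Set (ι → ℝ), IsCompact K ∧ μ Kᶜ = 0) ∧
  ∀ E : Set (ι → ℝ), MeasurableSet E →
    μ E = (B.card : ENNReal)⁻¹ *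
      ∑ b ∈ B, μ ((fun x => (intMatCast R)⁻¹.mulVec (x + intVecCast b)) ⁻¹' E)

/-- `Λ` is a spectrum for `μ`: it is countable and the exponentials `e^{2πi⟨λ,·⟩}`, `λ ∈ Λ`,
form an orthonormal basis of `L²(μ)` (orthonormal and total). -/
def IsSpectrum [Fintype ι] [DecidableEq ι] (μ : Measure (ι → ℝ)) (Λ : Set (ι → ℝ)) : Prop :=
  Λ.Countable ∧
  (∀ l ∈ Λ, ∀ l' ∈ Λ,
    ∫ x, expv l x * (starRingEnd ℂ) (expv l' x) ∂μ = if l = l' then 1 else 0) ∧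
  (∀ f : Lp ℂ 2 μ, (∀ l ∈ Λ, ∫ x, (starRingEnd ℂ) (expv l x) * f x ∂μ = 0) → f = 0)

/-- The Fourier transform `μ̂(ξ) = ∫ e^{-2πi⟨ξ,x⟩} dμ(x)`. -/
def ftMeasure [Fintype ι] (μ : Measure (ι → ℝ)) (ξ : ι → ℝ) : ℂ :=
  ∫ x, Complex.exp (-(2 * (Real.pi : ℂ) * Complex.I * (rdot ξ x : ℝ))) ∂μ

/-- `u_B(x) = |(1/N) ∑_{b∈B} e^{2πi⟨b,x⟩}|²`. -/
def uB [Fintype ι] (B : Finset (ι → ℤ)) (x : ι → ℝ) : ℝ :=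
  ‖(B.card : ℂ)⁻¹ * ∑ b ∈ B, expv (intVecCast b) x‖ ^ 2

/-- `𝒵 = {ξ : μ̂(ξ + k) = 0 for all k ∈ ℤ^d}`. -/
def Zset [Fintype ι] (μ : Measure (ι → ℝ)) : Set (ι → ℝ) :=
  {ξ | ∀ k : ι → ℤ, ftMeasure μ (ξ + intVecCast k) = 0}

/-- `ℤ[R,B]`: the smallest `R`-invariant subgroup of `ℤ^d` containing all `R^j b`. -/
def ZRB [Fintype ι] [DecidableEq ι] (R : Matrix ι ι ℤ) (B : Finset (ι → ℤ)) :
    AddSubgroup (ι → ℤ) :=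
  AddSubgroup.closure {v | ∃ (j : ℕ) (b : ι → ℤ), b ∈ B ∧ v = (R ^ j).mulVec b}

/-- `𝓛` is a complete set of representatives modulo `S(ℤ^d)`. -/
def IsCompleteResidueSet [Fintype ι] [DecidableEq ι] (S : Matrix ι ι ℤ)
    (𝓛 : Finset (ι → ℤ)) : Prop :=
  ∀ v : ι → ℤ, ∃! l, l ∈ 𝓛 ∧ ∃ k : ι → ℤ, v - l = S.mulVec k


set_option linter.unusedSectionVars false

namespace HT
open Topology

/-! ### Basic exponentials -/

/-- real functionals on a lattice -/
abbrev Fr (G : Type) [AddCommGroup G] := G →ₗ[ℤ] ℝ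

/-- `e^{2πit}` -/
def eC (t : ℝ) : ℂ := Complex.exp (2 * (Real.pi : ℂ) * Complex.I * (t : ℝ))

lemma eC_add (s t : ℝ) : eC (s + t) = eC s * eC t := by
  unfold eC; rw [← Complex.exp_add]; congr 1; push_cast; ring

@[simp] lemma eC_zero : eC 0 = 1 := by simp [eC]

lemma eC_eq (t : ℝ) : eC t = Complex.exp ((2 * Real.pi * t : ℝ) * Complex.I) := by
  unfold eC; congr 1; push_cast; ring

@[simp] lemma norm_eC (t : ℝ) : ‖eC t‖ = 1 := by
  rw [eC_eq, Complex.norm_exp_ofReal_mul_I]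

lemma eC_ne_zero (t : ℝ) : eC t ≠ 0 := Complex.exp_ne_zero _

lemma eC_neg (t : ℝ) : eC (-t) = (starRingEnd ℂ) (eC t) := by
  unfold eC
  rw [← Complex.exp_conj]
  congr 1
  simp [map_ofNat]

lemma eC_sub (s t : ℝ) : eC (s - t) = eC s * (starRingEnd ℂ) (eC t) := by
  rw [sub_eq_add_neg, eC_add, eC_neg]

lemma eC_mul_conj (t : ℝ) : eC t * (starRingEnd ℂ) (eC t) = 1 := by
  rw [← eC_sub]; simp

lemma eC_eq_one_iff (t : ℝ) : eC t = 1 ↔ ∃ n : ℤ, t = n := by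
  unfold eC
  rw [Complex.exp_eq_one_iff]
  have h : (2 * (Real.pi : ℂ) * Complex.I) ≠ 0 := by
    simp [Real.pi_ne_zero]
  constructor
  · rintro ⟨n, hn⟩
    refine ⟨n, ?_⟩
    have : (2 * (Real.pi : ℂ) * Complex.I) * (t : ℂ) = (2 * (Real.pi : ℂ) * Complex.I) * (n : ℂ) := by
      rw [hn]; ring
    have := mul_left_cancel₀ h this
    exact_mod_cast this
  · rintro ⟨n, rfl⟩
    exact ⟨n, by push_cast; ring⟩

lemma eC_int (n : ℤ) : eC n = 1 := (eC_eq_one_iff _).2 ⟨n, rfl⟩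

lemma eC_sum {ι : Type*} (s : Finset ι) (f : ι → ℝ) : eC (∑ i ∈ s, f i) = ∏ i ∈ s, eC (f i) := by
  induction s using Finset.induction_on with
  | empty => simp
  | insert a s ha ih => rw [Finset.sum_insert ha, Finset.prod_insert ha, eC_add, ih]

lemma continuous_eC : Continuous eC := by
  unfold eC; fun_prop

lemma norm_eC_sub_one (t : ℝ) : ‖eC t - 1‖ ≤ 2 * Real.pi * |t| := by
  rw [eC_eq, mul_comm _ Complex.I]
  refine (Real.norm_exp_I_mul_ofReal_sub_one_le (x := 2 * Real.pi * t)).trans ?_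
  rw [Real.norm_eq_abs, abs_mul, abs_of_pos (by positivity : (0:ℝ) < 2 * Real.pi)]

lemma norm_eC_sub (s t : ℝ) : ‖eC s - eC t‖ ≤ 2 * Real.pi * |s - t| := by
  have : eC s - eC t = eC t * (eC (s - t) - 1) := by
    rw [mul_sub, ← eC_add]; simp
  rw [this, norm_mul, norm_eC, one_mul]
  exact norm_eC_sub_one _

/-! ### Systems -/

/-- integer valued functional -/
def IsInt {G : Type} [AddCommGroup G] (ξ : Fr G) : Prop := ∀ g, ∃ n : ℤ, ξ g = n

section isint
variable {G : Type} [AddCommGroup G]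
lemma IsInt.add {ξ η : Fr G} (h : IsInt ξ) (h' : IsInt η) : IsInt (ξ + η) := fun g => by
  obtain ⟨n, hn⟩ := h g
  obtain ⟨m, hm⟩ := h' g
  exact ⟨n + m, by simp [hn, hm]⟩
lemma IsInt.neg {ξ : Fr G} (h : IsInt ξ) : IsInt (-ξ) := fun g => by
  obtain ⟨n, hn⟩ := h g
  exact ⟨-n, by simp [hn]⟩
lemma IsInt.zero : IsInt (0 : Fr G) := fun g => ⟨0, by simp⟩
lemma IsInt.sub {ξ η : Fr G} (h : IsInt ξ) (h' : IsInt η) : IsInt (ξ - η) := by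
  rw [sub_eq_add_neg]; exact h.add h'.neg
lemma IsInt.comp {H : Type} [AddCommGroup H] {ξ : Fr G} (h : IsInt ξ) (f : H →ₗ[ℤ] G) :
    IsInt (ξ ∘ₗ f) := fun g => h (f g)
lemma IsInt.eC {ξ : Fr G} (h : IsInt ξ) (g : G) : eC (ξ g) = 1 := (eC_eq_one_iff _).2 (h g)
end isint

/-- a lattice with an expanding endomorphism, with `S` the inverse of the dual map -/
structure Ex (G : Type) [AddCommGroup G] where
  R : G →ₗ[ℤ] G
  S : Fr G →ₗ[ℝ] Fr G
  hSR : ∀ ξ g, S ξ (R g) = ξ g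
  hS : ∀ ξ : Fr G, S (ξ ∘ₗ R) = ξ
  lim : ∀ (ξ : Fr G) (g : G), Tendsto (fun n => ((S ^ n) ξ) g) atTop (𝓝 0)

namespace Ex
variable {G : Type} [AddCommGroup G] (e : Ex G)

/-- the dual map -/
def A : Fr G →ₗ[ℝ] Fr G where
  toFun ξ := ξ ∘ₗ e.R
  map_add' _ _ := rfl
  map_smul' _ _ := rfl

lemma A_apply (ξ : Fr G) (g : G) : e.A ξ g = ξ (e.R g) := rfl

@[simp] lemma S_A (ξ : Fr G) : e.S (e.A ξ) = ξ := e.hS ξ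
@[simp] lemma A_S (ξ : Fr G) : e.A (e.S ξ) = ξ := by
  ext g; exact e.hSR ξ g

lemma S_pow_A_pow (n : ℕ) (ξ : Fr G) : (e.S ^ n) ((e.A ^ n) ξ) = ξ := by
  induction n generalizing ξ with
  | zero => simp
  | succ n ih =>
    rw [pow_succ e.S, pow_succ' e.A]
    simp only [Module.End.mul_apply, S_A]
    exact ih ξ

lemma A_pow_S_pow (n : ℕ) (ξ : Fr G) : (e.A ^ n) ((e.S ^ n) ξ) = ξ := by
  induction n generalizing ξ with
  | zero => simp
  | succ n ih =>
    rw [pow_succ e.A, pow_succ' e.S]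
    simp only [Module.End.mul_apply, A_S]
    exact ih ξ

lemma S_pow_R_pow (n : ℕ) (ξ : Fr G) (g : G) : (e.S ^ n) ξ ((e.R ^ n) g) = ξ g := by
  induction n generalizing ξ g with
  | zero => simp
  | succ n ih =>
    rw [pow_succ' e.S, pow_succ' e.R]
    simp only [Module.End.mul_apply, hSR]
    exact ih ξ g

lemma A_pow_apply (n : ℕ) (ξ : Fr G) (g : G) : (e.A ^ n) ξ g = ξ ((e.R ^ n) g) := by
  rw [← e.S_pow_R_pow n ((e.A ^ n) ξ) g, S_pow_A_pow]

lemma isInt_A {ξ : Fr G} (h : IsInt ξ) : IsInt (e.A ξ) := h.comp e.R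

lemma isInt_A_pow {ξ : Fr G} (h : IsInt ξ) (n : ℕ) : IsInt ((e.A ^ n) ξ) := fun g => by
  rw [A_pow_apply]; exact h _

/-- `S^i A^m = A^{m-i}` -/
lemma S_pow_A_pow_of_le {i m : ℕ} (h : i ≤ m) (ξ : Fr G) :
    (e.S ^ i) ((e.A ^ m) ξ) = (e.A ^ (m - i)) ξ := by
  obtain ⟨k, rfl⟩ := Nat.exists_eq_add_of_le h
  rw [pow_add, Module.End.mul_apply, S_pow_A_pow]; simp

lemma S_pow_A_pow_of_ge {i m : ℕ} (h : m ≤ i) (ξ : Fr G) :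
    (e.S ^ i) ((e.A ^ m) ξ) = (e.S ^ (i - m)) ξ := by
  obtain ⟨k, rfl⟩ := Nat.exists_eq_add_of_le h
  rw [add_comm, pow_add, Module.End.mul_apply, S_pow_A_pow]; simp

end Ex

/-- relative system: digits `β : X → G`, over base `C` -/
structure Sys (G X C : Type) [AddCommGroup G] [Fintype X] [Fintype C] extends Ex G where
  π : X → C
  β : X → G
  N : ℕ
  hN : 0 < N
  fib : ∀ c, (Finset.univ.filter (fun x => π x = c)).card = N

namespace Sys
variable {G X C : Type} [AddCommGroup G] [Fintype X] [Fintype C] (σ : Sys G X C)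

/-- unnormalised mask -/
def ms (c : C) (ξ : Fr G) : ℂ := ∑ x with σ.π x = c, eC (ξ (σ.β x))

lemma ms_add_int (c : C) (ξ k : Fr G) (hk : IsInt k) : σ.ms c (ξ + k) = σ.ms c ξ := by
  unfold ms
  refine Finset.sum_congr rfl fun x _ => ?_
  rw [LinearMap.add_apply, eC_add, hk.eC, mul_one]

lemma ms_zero (c : C) : σ.ms c 0 = σ.N := by
  unfold ms
  simp [σ.fib c]

lemma norm_ms_le (c : C) (ξ : Fr G) : ‖σ.ms c ξ‖ ≤ σ.N := by
  unfold ms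
  refine (norm_sum_le _ _).trans ?_
  simp [σ.fib c]

lemma Npos : (0 : ℝ) < σ.N := by exact_mod_cast σ.hN

/-- averaged squared mask -/
def ub (ξ : Fr G) : ℝ := (Fintype.card C : ℝ)⁻¹ * ∑ c, (‖σ.ms c ξ‖ / σ.N) ^ 2

lemma ub_nonneg (ξ : Fr G) : 0 ≤ σ.ub ξ := by unfold ub; positivity

lemma ub_le_one (ξ : Fr G) : σ.ub ξ ≤ 1 := by
  unfold ub
  have : ∑ c, (‖σ.ms c ξ‖ / σ.N) ^ 2 ≤ ∑ c : C, (1:ℝ) := by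
    refine Finset.sum_le_sum fun c _ => ?_
    have h1 : ‖σ.ms c ξ‖ / σ.N ≤ 1 := (div_le_one σ.Npos).2 (σ.norm_ms_le c ξ)
    have h0 : 0 ≤ ‖σ.ms c ξ‖ / σ.N := by positivity
    exact pow_le_one₀ h0 h1
  simp at this
  rcases Nat.eq_zero_or_pos (Fintype.card C) with h | h
  · simp [h]
  · rw [inv_mul_le_iff₀ (by exact_mod_cast h)]; simpa using this

lemma ub_add_int (ξ k : Fr G) (hk : IsInt k) : σ.ub (ξ + k) = σ.ub ξ := by
  unfold ub; simp [σ.ms_add_int _ _ _ hk]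

lemma ub_eq_zero_iff [Nonempty C] (ξ : Fr G) : σ.ub ξ = 0 ↔ ∀ c, σ.ms c ξ = 0 := by
  unfold ub
  have hC : (Fintype.card C : ℝ)⁻¹ ≠ 0 := by simp
  rw [mul_eq_zero, or_iff_right hC, Finset.sum_eq_zero_iff_of_nonneg (fun _ _ => by positivity)]
  have := σ.Npos.ne'
  simp [this]

lemma ub_zero [Nonempty C] : σ.ub 0 = 1 := by
  unfold ub
  simp [ms_zero, σ.Npos.ne']

/-- finite products -/
def Hn (n : ℕ) (ξ : Fr G) : ℝ := ∏ i ∈ Finset.range n, σ.ub ((σ.S ^ (i + 1)) ξ)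

/-- infinite product -/
def H (ξ : Fr G) : ℝ := ⨅ n, σ.Hn n ξ

lemma Hn_nonneg (n : ℕ) (ξ : Fr G) : 0 ≤ σ.Hn n ξ := Finset.prod_nonneg fun _ _ => σ.ub_nonneg _

lemma Hn_anti (ξ : Fr G) : Antitone (fun n => σ.Hn n ξ) := by
  refine antitone_nat_of_succ_le fun n => ?_
  unfold Hn
  rw [Finset.prod_range_succ]
  exact mul_le_of_le_one_right (σ.Hn_nonneg n ξ) (σ.ub_le_one _)

lemma Hn_tendsto (ξ : Fr G) : Tendsto (fun n => σ.Hn n ξ) atTop (𝓝 (σ.H ξ)) :=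
  tendsto_atTop_ciInf (σ.Hn_anti ξ) ⟨0, by rintro _ ⟨n, rfl⟩; exact σ.Hn_nonneg n ξ⟩

lemma H_le_Hn (n : ℕ) (ξ : Fr G) : σ.H ξ ≤ σ.Hn n ξ := (σ.Hn_anti ξ).le_of_tendsto (σ.Hn_tendsto ξ) n

lemma H_nonneg (ξ : Fr G) : 0 ≤ σ.H ξ := ge_of_tendsto' (σ.Hn_tendsto ξ) fun n => σ.Hn_nonneg n ξ

lemma H_le_one (ξ : Fr G) : σ.H ξ ≤ 1 := (σ.H_le_Hn 0 ξ).trans (by simp [Hn])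

lemma Hn_succ' (n : ℕ) (ξ : Fr G) : σ.Hn (n + 1) ξ = σ.ub (σ.S ξ) * σ.Hn n (σ.S ξ) := by
  unfold Hn
  rw [Finset.prod_range_succ', mul_comm]
  simp [pow_succ]

lemma H_succ (ξ : Fr G) : σ.H ξ = σ.ub (σ.S ξ) * σ.H (σ.S ξ) := by
  have h1 : Tendsto (fun n => σ.Hn (n+1) ξ) atTop (𝓝 (σ.H ξ)) :=
    (tendsto_add_atTop_iff_nat 1).2 (σ.Hn_tendsto ξ)
  simp_rw [Hn_succ'] at h1
  exact tendsto_nhds_unique h1 ((σ.Hn_tendsto _).const_mul _)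

lemma H_eq (n : ℕ) (ξ : Fr G) : σ.H ξ = σ.Hn n ξ * σ.H ((σ.S ^ n) ξ) := by
  induction n with
  | zero => simp [Hn]
  | succ n ih =>
    rw [ih, H_succ]
    have : σ.S ((σ.S ^ n) ξ) = (σ.S ^ (n+1)) ξ := by rw [pow_succ']; rfl
    rw [this]
    unfold Hn
    rw [Finset.prod_range_succ]; ring

lemma H_zero [Nonempty C] : σ.H 0 = 1 := by
  have : ∀ n, σ.Hn n 0 = 1 := fun n => by simp [Hn, ub_zero]
  refine tendsto_nhds_unique (σ.Hn_tendsto 0) ?_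
  simp [this]

/-- complete orthogonal set at level `m` -/
def Comp (m : ℕ) (Λ : Finset (Fr G)) : Prop :=
  Λ.card = σ.N ^ m ∧ ∀ l ∈ Λ, ∀ l' ∈ Λ, l ≠ l' →
    ∃ i < m, ∀ c, σ.ms c ((σ.S ^ (i + 1)) (l - l')) = 0

/-- the Hadamard property -/
def Had : Prop := ∃ L : Finset (Fr G), (∀ l ∈ L, IsInt l) ∧ L.card = σ.N ∧
  ∀ l ∈ L, ∀ l' ∈ L, l ≠ l' → ∀ c, σ.ms c (σ.S (l - l')) = 0

lemma Had.zero_mem {σ : Sys G X C} (h : σ.Had) : ∃ L : Finset (Fr G), 0 ∈ L ∧ (∀ l ∈ L, IsInt l) ∧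
    L.card = σ.N ∧ ∀ l ∈ L, ∀ l' ∈ L, l ≠ l' → ∀ c, σ.ms c (σ.S (l - l')) = 0 := by
  obtain ⟨L, h1, h2, h3⟩ := h
  have : L.Nonempty := by rw [← Finset.card_pos, h2]; exact σ.hN
  obtain ⟨a, ha⟩ := this
  refine ⟨L.image (fun l => l - a), ?_, ?_, ?_, ?_⟩
  · exact Finset.mem_image.2 ⟨a, ha, sub_self a⟩
  · intro l hl
    obtain ⟨b, hb, rfl⟩ := Finset.mem_image.1 hl
    exact (h1 b hb).sub (h1 a ha)
  · rw [Finset.card_image_of_injective _ (sub_left_injective), h2]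
  · intro l hl l' hl' hne c
    obtain ⟨b, hb, rfl⟩ := Finset.mem_image.1 hl
    obtain ⟨b', hb', rfl⟩ := Finset.mem_image.1 hl'
    rw [sub_sub_sub_cancel_right]
    exact h3 b hb b' hb' (fun h => hne (by rw [h])) c

lemma ms_zero_ne (c : C) : σ.ms c 0 ≠ 0 := by
  rw [ms_zero]; exact_mod_cast σ.hN.ne'

lemma ms_isInt_ne (c : C) {k : Fr G} (hk : IsInt k) : σ.ms c k ≠ 0 := by
  have := σ.ms_add_int c 0 k hk
  rw [zero_add] at this
  rw [this]; exact σ.ms_zero_ne c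

/-- modification of a complete set -/
lemma Comp.modify [Nonempty C] {σ : Sys G X C} {m : ℕ} {Λ : Finset (Fr G)} (h : σ.Comp m Λ)
    (k : Fr G → Fr G) (hk : ∀ l, IsInt (k l)) :
    σ.Comp m (Λ.image fun l => l + (σ.A ^ m) (k l)) ∧
      Set.InjOn (fun l => l + (σ.A ^ m) (k l)) Λ := by
  have key : ∀ l ∈ Λ, ∀ l' ∈ Λ, l ≠ l' → ∃ i < m, ∀ c, σ.ms c ((σ.S ^ (i + 1))
      ((l + (σ.A ^ m) (k l)) - (l' + (σ.A ^ m) (k l')))) = 0 := by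
    intro l hl l' hl' hne
    obtain ⟨i, hi, h0⟩ := h.2 l hl l' hl' hne
    refine ⟨i, hi, fun c => ?_⟩
    have : (l + (σ.A ^ m) (k l)) - (l' + (σ.A ^ m) (k l')) =
      (l - l') + (σ.A ^ m) (k l - k l') := by rw [map_sub]; abel
    rw [this, map_add, σ.S_pow_A_pow_of_le (by omega), σ.ms_add_int, h0]
    exact σ.isInt_A_pow ((hk _).sub (hk _)) _
  have inj : Set.InjOn (fun l => l + (σ.A ^ m) (k l)) Λ := by
    intro l hl l' hl' heq
    by_contra hne
    obtain ⟨i, hi, h0⟩ := key l hl l' hl' hne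
    have heq' : l + (σ.A ^ m) (k l) = l' + (σ.A ^ m) (k l') := heq
    rw [heq', sub_self, map_zero] at h0
    exact σ.ms_zero_ne _ (h0 (Classical.arbitrary C))
  refine ⟨⟨?_, ?_⟩, inj⟩
  · rw [Finset.card_image_of_injOn inj, h.1]
  · intro a ha b hb hne
    obtain ⟨l, hl, rfl⟩ := Finset.mem_image.1 ha
    obtain ⟨l', hl', rfl⟩ := Finset.mem_image.1 hb
    exact key l hl l' hl' (fun h => hne (by rw [h]))

/-- extension of a complete set -/
lemma Comp.ext [Nonempty C] {σ : Sys G X C} {m : ℕ} {Λ L : Finset (Fr G)} (h : σ.Comp m Λ)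
    (hLi : ∀ l ∈ L, IsInt l) (hLc : L.card = σ.N)
    (hL : ∀ l ∈ L, ∀ l' ∈ L, l ≠ l' → ∀ c, σ.ms c (σ.S (l - l')) = 0) :
    σ.Comp (m + 1) ((Λ ×ˢ L).image fun p => p.1 + (σ.A ^ m) p.2) := by
  have key : ∀ p ∈ Λ ×ˢ L, ∀ q ∈ Λ ×ˢ L, p ≠ q → ∃ i < m + 1, ∀ c, σ.ms c ((σ.S ^ (i + 1))
      ((p.1 + (σ.A ^ m) p.2) - (q.1 + (σ.A ^ m) q.2))) = 0 := by
    rintro ⟨l, a⟩ hp ⟨l', a'⟩ hq hne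
    rw [Finset.mem_product] at hp hq
    have e1 : (l + (σ.A ^ m) a) - (l' + (σ.A ^ m) a') =
      (l - l') + (σ.A ^ m) (a - a') := by rw [map_sub]; abel
    by_cases hll : l = l'
    · subst hll
      have haa : a ≠ a' := fun h => hne (by rw [h])
      refine ⟨m, by omega, fun c => ?_⟩
      simp only [e1]
      rw [sub_self, zero_add, σ.S_pow_A_pow_of_ge (by omega)]
      simpa using hL a hp.2 a' hq.2 haa c
    · obtain ⟨i, hi, h0⟩ := h.2 l hp.1 l' hq.1 hll
      refine ⟨i, by omega, fun c => ?_⟩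
      simp only [e1]
      rw [map_add, σ.S_pow_A_pow_of_le (by omega), σ.ms_add_int, h0]
      exact σ.isInt_A_pow ((hLi _ hp.2).sub (hLi _ hq.2)) _
  have inj : Set.InjOn (fun p : Fr G × Fr G => p.1 + (σ.A ^ m) p.2) (Λ ×ˢ L : Finset _) := by
    intro p hp q hq heq
    by_contra hne
    obtain ⟨i, hi, h0⟩ := key p hp q hq hne
    have heq' : p.1 + (σ.A ^ m) p.2 = q.1 + (σ.A ^ m) q.2 := heq
    rw [heq', sub_self, map_zero] at h0
    exact σ.ms_zero_ne _ (h0 (Classical.arbitrary C))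
  refine ⟨?_, ?_⟩
  · rw [Finset.card_image_of_injOn inj, Finset.card_product, h.1, hLc, pow_succ]
  · intro a ha b hb hne
    obtain ⟨l, hl, rfl⟩ := Finset.mem_image.1 ha
    obtain ⟨l', hl', rfl⟩ := Finset.mem_image.1 hb
    exact key l hl l' hl' (fun h => hne (by rw [h]))

/-- iterated extension -/
lemma Comp.ext_many [Nonempty C] {σ : Sys G X C} (hH : σ.Had) {m : ℕ} {Λ : Finset (Fr G)}
    (h : σ.Comp m Λ) (n : ℕ) : ∃ Λ', Λ ⊆ Λ' ∧ σ.Comp (m + n) Λ' ∧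
      ∀ l ∈ Λ', IsInt l ∨ ∃ l₀ ∈ Λ, IsInt (l - l₀) := by
  induction n with
  | zero => exact ⟨Λ, le_rfl, h, fun l hl => Or.inr ⟨l, hl, by simpa using IsInt.zero⟩⟩
  | succ n ih =>
    obtain ⟨Λ', h1, h2, h3⟩ := ih
    obtain ⟨L, hL0, hLi, hLc, hL⟩ := hH.zero_mem
    refine ⟨_, ?_, h2.ext hLi hLc hL, ?_⟩
    · intro l hl
      exact Finset.mem_image.2 ⟨(l, 0), Finset.mem_product.2 ⟨h1 hl, hL0⟩, by simp⟩
    · intro l hl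
      obtain ⟨⟨a, b⟩, hab, rfl⟩ := Finset.mem_image.1 hl
      rw [Finset.mem_product] at hab
      have hb := σ.isInt_A_pow (hLi b hab.2) (m + n)
      rcases h3 a hab.1 with h | ⟨l₀, hl₀, h⟩
      · exact Or.inl (h.add hb)
      · refine Or.inr ⟨l₀, hl₀, ?_⟩
        have := h.add hb
        convert this using 1
        simp only; abel

lemma comp_zero : σ.Comp 0 {0} := by
  refine ⟨by simp, ?_⟩
  intro l hl l' hl' hne
  simp at hl hl'
  exact absurd (hl.trans hl'.symm) hne

end Sys

/-! ### Finite dimensional orthogonality -/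

lemma col_orth {I J : Type} [Fintype I] [Fintype J] (hc : Fintype.card I = Fintype.card J)
    (u : I → J → ℂ) (K : ℂ) (hK : K ≠ 0)
    (ho : ∀ i i', ∑ j, u i j * (starRingEnd ℂ) (u i' j) = if i = i' then K else 0) (j j' : J) :
    ∑ i, (starRingEnd ℂ) (u i j) * u i j' = if j = j' then K else 0 := by
  let M : Matrix I J ℂ := Matrix.of u
  let M' : Matrix J I ℂ := Matrix.of fun j i => K⁻¹ * (starRingEnd ℂ) (u i j)
  have h1 : M * M' = 1 := by
    ext i i'
    simp only [M, M', Matrix.mul_apply, Matrix.of_apply, Matrix.one_apply]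
    have : ∀ j, u i j * (K⁻¹ * (starRingEnd ℂ) (u i' j)) =
      K⁻¹ * (u i j * (starRingEnd ℂ) (u i' j)) := fun j => by ring
    simp_rw [this]
    rw [← Finset.mul_sum, ho]
    split_ifs
    · exact inv_mul_cancel₀ hK
    · simp
  have h2 := (Matrix.mul_eq_one_comm_of_equiv (Fintype.equivOfCardEq hc)).1 h1
  have h3 := congrFun (congrFun h2 j) j'
  simp only [M, M', Matrix.mul_apply, Matrix.of_apply, Matrix.one_apply, mul_assoc] at h3
  rw [← Finset.mul_sum] at h3
  have := congrArg (K * ·) h3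
  simp only [mul_inv_cancel_left₀ hK] at this
  rw [this]; split_ifs <;> simp

lemma parseval_fin {I J : Type} [Fintype I] [Fintype J] (hc : Fintype.card I = Fintype.card J)
    (u : I → J → ℂ) (K : ℝ) (hK : K ≠ 0)
    (ho : ∀ i i', ∑ j, u i j * (starRingEnd ℂ) (u i' j) = if i = i' then (K : ℂ) else 0)
    (f : J → ℂ) :
    ∑ i, ‖∑ j, f j * (starRingEnd ℂ) (u i j)‖ ^ 2 = K * ∑ j, ‖f j‖ ^ 2 := by
  have hco := col_orth hc u K (by exact_mod_cast hK) ho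
  have : ((∑ i, ‖∑ j, f j * (starRingEnd ℂ) (u i j)‖ ^ 2 : ℝ) : ℂ) = (K * ∑ j, ‖f j‖ ^ 2 : ℝ) := by
    push_cast
    simp_rw [← Complex.mul_conj']
    simp only [map_sum, map_mul, Complex.conj_conj, Finset.sum_mul_sum]
    rw [Finset.sum_comm]
    have : ∀ j, ∑ i, ∑ j', f j * (starRingEnd ℂ) (u i j) * ((starRingEnd ℂ) (f j') * u i j') =
        K * (f j * (starRingEnd ℂ) (f j)) := by
      intro j
      rw [Finset.sum_comm]
      have : ∀ j', ∑ i, f j * (starRingEnd ℂ) (u i j) * ((starRingEnd ℂ) (f j') * u i j') =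
        f j * (starRingEnd ℂ) (f j') * (if j = j' then (K:ℂ) else 0) := by
        intro j'
        rw [← hco j j', Finset.mul_sum]
        exact Finset.sum_congr rfl fun i _ => by ring
      simp_rw [this]
      simp; ring
    simp_rw [this, Finset.mul_sum]
  exact_mod_cast this

lemma bessel_fin {I J : Type} [Fintype J] (F : Finset I)
    (u : I → J → ℂ) (K : ℝ) (hK : K ≠ 0)
    (ho : ∀ i ∈ F, ∀ i' ∈ F, ∑ j, u i j * (starRingEnd ℂ) (u i' j) = if i = i' then (K : ℂ) else 0)
    (f : J → ℂ) :
    ∑ j, ‖f j - ∑ i ∈ F, ((K : ℂ)⁻¹ * ∑ j', f j' * (starRingEnd ℂ) (u i j')) * u i j‖ ^ 2 =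
      ∑ j, ‖f j‖ ^ 2 - K⁻¹ * ∑ i ∈ F, ‖∑ j, f j * (starRingEnd ℂ) (u i j)‖ ^ 2 := by
  obtain ⟨a, ha⟩ : ∃ a : I → ℂ, ∀ i, a i = ∑ j', f j' * (starRingEnd ℂ) (u i j') := ⟨_, fun _ => rfl⟩
  simp_rw [← ha]
  have hK' : (K : ℂ) ≠ 0 := by exact_mod_cast hK
  have : ((∑ j, ‖f j - ∑ i ∈ F, ((K : ℂ)⁻¹ * a i) * u i j‖ ^ 2 : ℝ) : ℂ) =
      (∑ j, ‖f j‖ ^ 2 - K⁻¹ * ∑ i ∈ F, ‖a i‖ ^ 2 : ℝ) := by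
    push_cast
    simp_rw [← Complex.mul_conj']
    simp only [map_sub, map_sum, map_mul, sub_mul, mul_sub, Finset.sum_sub_distrib]
    have e1 : ∑ j, f j * ∑ i ∈ F, (starRingEnd ℂ) (K:ℂ)⁻¹ * (starRingEnd ℂ) (a i) *
        (starRingEnd ℂ) (u i j) = (K:ℂ)⁻¹ * ∑ i ∈ F, a i * (starRingEnd ℂ) (a i) := by
      simp_rw [Finset.mul_sum]
      rw [Finset.sum_comm]
      refine Finset.sum_congr rfl fun i _ => ?_
      nth_rewrite 2 [ha i]
      simp only [Finset.sum_mul, Finset.mul_sum]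
      refine Finset.sum_congr rfl fun j _ => ?_
      simp; ring
    have e2 : ∑ j, (∑ i ∈ F, (K:ℂ)⁻¹ * a i * u i j) * (starRingEnd ℂ) (f j) =
        (K:ℂ)⁻¹ * ∑ i ∈ F, a i * (starRingEnd ℂ) (a i) := by
      simp_rw [Finset.sum_mul, Finset.mul_sum]
      rw [Finset.sum_comm]
      refine Finset.sum_congr rfl fun i _ => ?_
      have : (starRingEnd ℂ) (a i) = ∑ j, (starRingEnd ℂ) (f j) * u i j := by
        simp [ha]
      rw [this]
      simp only [Finset.mul_sum]
      refine Finset.sum_congr rfl fun j _ => ?_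
      ring
    have e3 : ∑ j, (∑ i ∈ F, (K:ℂ)⁻¹ * a i * u i j) * ∑ i ∈ F, (starRingEnd ℂ) (K:ℂ)⁻¹ *
        (starRingEnd ℂ) (a i) * (starRingEnd ℂ) (u i j) =
        (K:ℂ)⁻¹ * ∑ i ∈ F, a i * (starRingEnd ℂ) (a i) := by
      simp_rw [Finset.sum_mul_sum]
      rw [Finset.sum_comm, Finset.mul_sum]
      refine Finset.sum_congr rfl fun i hi => ?_
      rw [Finset.sum_comm]
      have : ∀ i' ∈ F, ∑ j, (K:ℂ)⁻¹ * a i * u i j * ((starRingEnd ℂ) (K:ℂ)⁻¹ *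
        (starRingEnd ℂ) (a i') * (starRingEnd ℂ) (u i' j)) =
        (K:ℂ)⁻¹ * (K:ℂ)⁻¹ * (a i * (starRingEnd ℂ) (a i')) * (if i = i' then (K : ℂ) else 0) := by
        intro i' hi'
        rw [← ho i hi i' hi', Finset.mul_sum]
        refine Finset.sum_congr rfl fun j _ => ?_
        simp; ring
      rw [Finset.sum_congr rfl this]
      simp [hi]
      field_simp
    rw [e1, e2, e3]; ring
  exact_mod_cast this

end HT

namespace HT
open Topology

section coords
variable {G : Type} [AddCommGroup G] [Module.Free ℤ G] [Module.Finite ℤ G]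

variable (G) in
/-- index of a basis -/
abbrev Ix := Module.Free.ChooseBasisIndex ℤ G

variable (G) in
/-- chosen basis -/
def bs : Module.Basis (Ix G) ℤ G := Module.Free.chooseBasis ℤ G

/-- dual basis -/
def co (i : Ix G) : Fr G := (Algebra.linearMap ℤ ℝ) ∘ₗ (bs G).coord i

lemma co_apply (i : Ix G) (g : G) : co i g = ((bs G).repr g i : ℝ) := by
  simp [co]

lemma co_isInt (i : Ix G) : IsInt (co i : Fr G) := fun g => ⟨_, co_apply i g⟩

lemma co_bs (i j : Ix G) : co i (bs G j) = if j = i then 1 else 0 := by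
  rw [co_apply, Module.Basis.repr_self, Finsupp.single_apply]; split_ifs <;> simp

lemma fr_eq (ξ : Fr G) : ξ = ∑ i, ξ (bs G i) • co i := by
  refine (bs G).ext fun j => ?_
  simp [co_bs]

lemma fr_apply (ξ : Fr G) (g : G) : ξ g = ∑ i, ξ (bs G i) * co i g := by
  conv_lhs => rw [fr_eq ξ]
  simp

/-- functionals separate points -/
lemma sep {g g' : G} (h : ∀ k : Fr G, IsInt k → k g = k g') : g = g' := by
  apply (bs G).repr.injective
  ext i
  have := h (co i) (co_isInt i)
  rw [co_apply, co_apply] at this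
  exact_mod_cast this

/-- the norm -/
def q (ξ : Fr G) : ℝ := ∑ i, |ξ (bs G i)|

lemma q_nonneg (ξ : Fr G) : 0 ≤ q ξ := Finset.sum_nonneg fun _ _ => abs_nonneg _

lemma q_add (ξ η : Fr G) : q (ξ + η) ≤ q ξ + q η := by
  unfold q; rw [← Finset.sum_add_distrib]
  exact Finset.sum_le_sum fun i _ => abs_add_le _ _

lemma q_smul (r : ℝ) (η : Fr G) : q (r • η) = |r| * q η := by
  unfold q; rw [Finset.mul_sum]
  exact Finset.sum_congr rfl fun i _ => by simp [abs_mul]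

lemma q_sum {ι : Type*} (s : Finset ι) (f : ι → Fr G) : q (∑ i ∈ s, f i) ≤ ∑ i ∈ s, q (f i) := by
  induction s using Finset.induction_on with
  | empty => simp [q]
  | insert a s ha ih =>
    rw [Finset.sum_insert ha, Finset.sum_insert ha]
    exact (q_add _ _).trans (by gcongr)

lemma abs_le_q (g : G) : ∀ ξ : Fr G, |ξ g| ≤ (∑ i, |co i g|) * q ξ := by
  intro ξ
  rw [fr_apply]
  refine (Finset.abs_sum_le_sum_abs _ _).trans ?_
  rw [Finset.sum_mul]
  refine Finset.sum_le_sum fun i _ => ?_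
  rw [abs_mul, mul_comm]
  gcongr
  exact Finset.single_le_sum (f := fun i => |ξ (bs G i)|) (fun _ _ => abs_nonneg _) (Finset.mem_univ i)

lemma exists_digit_bound {X : Type} [Fintype X] (β : X → G) :
    ∃ K : ℝ, 0 < K ∧ ∀ x (ξ : Fr G), |ξ (β x)| ≤ K * q ξ := by
  refine ⟨1 + ∑ x, ∑ i, |co i (β x)|, by positivity, fun x ξ => ?_⟩
  refine (abs_le_q (β x) ξ).trans ?_
  have := q_nonneg ξ
  gcongr
  have h := Finset.single_le_sum (f := fun x => ∑ i, |co i (β x)|) (fun _ _ => by positivity) (Finset.mem_univ x)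
  linarith

namespace Ex
variable (e : Ex G)

lemma exists_kappa : ∃ κ : ℕ → ℝ, (∀ n, 0 ≤ κ n) ∧ Tendsto κ atTop (𝓝 0) ∧
    ∀ n ξ, q ((e.S ^ n) ξ) ≤ κ n * q ξ := by
  refine ⟨fun n => ∑ i, q ((e.S ^ n) (co i)), fun n => Finset.sum_nonneg fun _ _ => q_nonneg _, ?_, ?_⟩
  · have : ∀ i : Ix G, Tendsto (fun n => q ((e.S ^ n) (co i))) atTop (𝓝 0) := by
      intro i
      unfold q
      have : (0:ℝ) = ∑ j : Ix G, |(0:ℝ)| := by simp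
      rw [this]
      exact tendsto_finsetSum _ fun j _ => (e.lim _ _).abs
    simpa using tendsto_finsetSum Finset.univ fun i _ => this i
  · intro n ξ
    conv_lhs => rw [fr_eq ξ]
    rw [map_sum]
    refine (q_sum _ _).trans ?_
    rw [Finset.sum_mul]
    refine Finset.sum_le_sum fun i _ => ?_
    rw [map_smul, q_smul, mul_comm]
    have := q_nonneg ((e.S ^ n) (co i))
    gcongr
    exact Finset.single_le_sum (f := fun i => |ξ (bs G i)|) (fun _ _ => abs_nonneg _) (Finset.mem_univ i)

lemma q_tendsto (ξ : Fr G) : Tendsto (fun n => q ((e.S ^ n) ξ)) atTop (𝓝 0) := by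
  obtain ⟨κ, h0, h1, h2⟩ := e.exists_kappa
  have : Tendsto (fun n => κ n * q ξ) atTop (𝓝 0) := by simpa using h1.mul_const (q ξ)
  exact squeeze_zero (fun n => q_nonneg _) (fun n => h2 n ξ) this

lemma exists_sum_bound : ∃ K : ℝ, 0 ≤ K ∧ ∀ n ξ, ∑ i ∈ Finset.range n, q ((e.S ^ i) ξ) ≤ K * q ξ := by
  obtain ⟨κ, h0, h1, h2⟩ := e.exists_kappa
  obtain ⟨p, hp1, hp⟩ : ∃ p, 1 ≤ p ∧ κ p ≤ 1/2 := by
    have := (h1.eventually (gt_mem_nhds (by norm_num : (0:ℝ) < 1/2))).and (eventually_ge_atTop 1)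
    obtain ⟨p, hp, hp'⟩ := this.exists
    exact ⟨p, hp', hp.le⟩
  have hK : 0 ≤ ∑ i ∈ Finset.range p, κ i := Finset.sum_nonneg fun i _ => h0 i
  refine ⟨2 * ∑ i ∈ Finset.range p, κ i, by linarith, ?_⟩
  have base : ∀ ξ, ∑ i ∈ Finset.range p, q ((e.S ^ i) ξ) ≤ (∑ i ∈ Finset.range p, κ i) * q ξ := by
    intro ξ
    rw [Finset.sum_mul]
    exact Finset.sum_le_sum fun i _ => h2 i ξ
  intro n
  induction n using Nat.strong_induction_on with
  | _ n ih =>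
    intro ξ
    have hq := q_nonneg ξ
    by_cases hn : n ≤ p
    · have : ∑ i ∈ Finset.range n, q ((e.S ^ i) ξ) ≤ ∑ i ∈ Finset.range p, q ((e.S ^ i) ξ) :=
        Finset.sum_le_sum_of_subset_of_nonneg (Finset.range_mono hn) fun _ _ _ => q_nonneg _
      have := base ξ
      nlinarith [mul_nonneg hK hq]
    · obtain ⟨m, rfl⟩ := Nat.exists_eq_add_of_le (not_le.1 hn).le
      rw [Finset.sum_range_add]
      have h3 := ih m (by omega) ((e.S ^ p) ξ)
      have h4 : ∀ i, (e.S ^ (p + i)) ξ = (e.S ^ i) ((e.S ^ p) ξ) := fun i => by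
        rw [add_comm, pow_add]; rfl
      simp_rw [h4]
      have h5 := base ξ
      have h6 : q ((e.S ^ p) ξ) ≤ 1/2 * q ξ := (h2 p ξ).trans (by gcongr)
      have h7 : (2 * ∑ i ∈ Finset.range p, κ i) * q ((e.S ^ p) ξ) ≤
        (2 * ∑ i ∈ Finset.range p, κ i) * (1/2 * q ξ) := by gcongr
      nlinarith

lemma summable_q (ξ : Fr G) : Summable fun i => q ((e.S ^ i) ξ) := by
  obtain ⟨K, hK, h⟩ := e.exists_sum_bound
  exact summable_of_sum_range_le (fun _ => q_nonneg _) (fun n => h n ξ)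

end Ex

lemma exists_int_near (ξ : Fr G) : ∃ k : Fr G, IsInt k ∧ ∃ t : Ix G → ℝ, (∀ i, t i ∈ Set.Icc (0:ℝ) 1) ∧
    ξ + k = ∑ i, t i • co i := by
  refine ⟨-∑ i, (⌊ξ (bs G i)⌋ : ℝ) • co i, ?_, fun i => Int.fract (ξ (bs G i)), ?_, ?_⟩
  · apply IsInt.neg
    intro g
    refine ⟨∑ i, ⌊ξ (bs G i)⌋ * (bs G).repr g i, ?_⟩
    simp [co_apply]
  · intro i; exact ⟨Int.fract_nonneg _, (Int.fract_lt_one _).le⟩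
  · rw [← sub_eq_add_neg, sub_eq_iff_eq_add, ← Finset.sum_add_distrib]
    refine (fr_eq ξ).trans ?_
    refine Finset.sum_congr rfl fun i _ => ?_
    rw [← add_smul, Int.fract_add_floor]

lemma q_box {t : Ix G → ℝ} (ht : ∀ i, t i ∈ Set.Icc (0:ℝ) 1) :
    q (∑ i, t i • co i : Fr G) ≤ Fintype.card (Ix G) := by
  have : ∀ j, (∑ i, t i • co i : Fr G) (bs G j) = t j := by
    intro j; simp [co_bs]
  unfold q
  simp_rw [this]
  calc ∑ i, |t i| ≤ ∑ i : Ix G, (1:ℝ) := Finset.sum_le_sum fun i _ => by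
        rw [abs_of_nonneg (ht i).1]; exact (ht i).2
    _ = _ := by simp

namespace Sys
variable {X C : Type} [Fintype X] [Fintype C] [Nonempty C] (σ : Sys G X C)

lemma exists_ub_bound : ∃ K : ℝ, 0 < K ∧ ∀ ξ, 1 - K * q ξ ≤ σ.ub ξ := by
  obtain ⟨K, hK, hb⟩ := exists_digit_bound σ.β
  refine ⟨2 * (2 * Real.pi * K), by positivity, fun ξ => ?_⟩
  have hN := σ.Npos
  have h1 : ∀ c, 1 - 2 * Real.pi * K * q ξ ≤ ‖σ.ms c ξ‖ / σ.N := by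
    intro c
    rw [le_div_iff₀ hN]
    have h2 : ‖(σ.N : ℂ) - σ.ms c ξ‖ ≤ σ.N * (2 * Real.pi * K * q ξ) := by
      rw [← σ.ms_zero c]
      unfold ms
      rw [← Finset.sum_sub_distrib]
      refine (norm_sum_le _ _).trans ?_
      have : ∀ x ∈ Finset.univ.filter (fun x => σ.π x = c), ‖eC ((0 : Fr G) (σ.β x)) - eC (ξ (σ.β x))‖ ≤
          2 * Real.pi * K * q ξ := by
        intro x _
        rw [norm_sub_rev]
        simp only [LinearMap.zero_apply, eC_zero]
        refine (norm_eC_sub_one _).trans ?_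
        have := hb x ξ
        have hp := Real.pi_pos
        calc 2 * Real.pi * |ξ (σ.β x)| ≤ 2 * Real.pi * (K * q ξ) := by gcongr
          _ = _ := by ring
      refine (Finset.sum_le_sum this).trans ?_
      simp [σ.fib c]
    have h3 : (σ.N : ℝ) - ‖σ.ms c ξ‖ ≤ ‖(σ.N : ℂ) - σ.ms c ξ‖ := by
      have := norm_sub_norm_le (σ.N : ℂ) (σ.ms c ξ)
      simpa using this
    nlinarith
  unfold ub
  have h4 : ∀ c, 1 - 2 * (2 * Real.pi * K) * q ξ ≤ (‖σ.ms c ξ‖ / σ.N) ^ 2 := by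
    intro c
    have := h1 c
    nlinarith [sq_nonneg (‖σ.ms c ξ‖ / σ.N - 1)]
  have h5 : ∑ c : C, (1 - 2 * (2 * Real.pi * K) * q ξ) ≤ ∑ c, (‖σ.ms c ξ‖ / σ.N) ^ 2 :=
    Finset.sum_le_sum fun c _ => h4 c
  have hC : (0:ℝ) < Fintype.card C := by exact_mod_cast Fintype.card_pos
  rw [Finset.sum_const, Finset.card_univ, nsmul_eq_mul] at h5
  rw [← div_eq_inv_mul, le_div_iff₀ hC, mul_comm]
  exact h5

lemma exists_H_bound : ∃ K : ℝ, 0 < K ∧ ∀ ξ, 1 - K * q ξ ≤ σ.H ξ := by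
  obtain ⟨K, hK, h⟩ := σ.exists_ub_bound
  obtain ⟨K', hK', h'⟩ := σ.toEx.exists_sum_bound
  refine ⟨K * K' + 1, by positivity, fun ξ => ?_⟩
  have hq := q_nonneg ξ
  refine ge_of_tendsto' (σ.Hn_tendsto ξ) fun n => ?_
  have h1 : ∀ n, 1 - ∑ i ∈ Finset.range n, K * q ((σ.S ^ (i+1)) ξ) ≤ σ.Hn n ξ := by
    intro n
    induction n with
    | zero => simp [Hn]
    | succ n ih =>
      have e1 : σ.Hn (n+1) ξ = σ.Hn n ξ * σ.ub ((σ.S ^ (n+1)) ξ) := by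
        unfold Hn; rw [Finset.prod_range_succ]
      rw [e1, Finset.sum_range_succ]
      have h2 := h ((σ.S ^ (n+1)) ξ)
      have h3 := σ.Hn_nonneg n ξ
      have h4 : σ.Hn n ξ ≤ 1 := by simpa [Hn] using σ.Hn_anti ξ (Nat.zero_le n)
      have h5 := σ.ub_le_one ((σ.S ^ (n+1)) ξ)
      nlinarith
  refine le_trans ?_ (h1 n)
  have h2 : ∑ i ∈ Finset.range n, q ((σ.S ^ (i+1)) ξ) ≤ K' * q ξ := by
    refine le_trans ?_ (h' (n+1) ξ)
    rw [Finset.sum_range_succ']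
    have := q_nonneg ((σ.S ^ 0) ξ)
    linarith
  rw [← Finset.mul_sum]
  nlinarith

lemma H_tendsto_one (ξ : Fr G) : ∀ᶠ n in atTop, 1/2 ≤ σ.H ((σ.S ^ n) ξ) := by
  obtain ⟨K, hK, h⟩ := σ.exists_H_bound
  have : Tendsto (fun n => 1 - K * q ((σ.S ^ n) ξ)) atTop (𝓝 (1 - K * 0)) :=
    ((σ.toEx.q_tendsto ξ).const_mul K).const_sub 1
  rw [mul_zero, sub_zero] at this
  filter_upwards [this.eventually (lt_mem_nhds (by norm_num : (1/2:ℝ) < 1))] with n hn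
  exact hn.le.trans (h _)

/-- on bounded sets -/
lemma H_unif (M : ℝ) : ∃ n₀, ∀ n ≥ n₀, ∀ ξ : Fr G, q ξ ≤ M → 1/2 ≤ σ.H ((σ.S ^ n) ξ) := by
  obtain ⟨K, hK, h⟩ := σ.exists_H_bound
  obtain ⟨κ, h0, h1, h2⟩ := σ.toEx.exists_kappa
  have : Tendsto (fun n => 1 - K * (κ n * (|M|))) atTop (𝓝 (1 - K * (0 * |M|))) :=
    ((h1.mul_const _).const_mul K).const_sub 1
  rw [zero_mul, mul_zero, sub_zero] at this
  obtain ⟨n₀, hn⟩ := eventually_atTop.1 (this.eventually (lt_mem_nhds (by norm_num : (1/2:ℝ) < 1)))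
  refine ⟨n₀, fun n hnn ξ hξ => (hn n hnn).le.trans (le_trans ?_ (h _))⟩
  have h3 := h2 n ξ
  have h4 := h0 n
  have : q ((σ.S ^ n) ξ) ≤ κ n * |M| := h3.trans (by gcongr; exact hξ.trans (le_abs_self M))
  gcongr

lemma continuous_Hn (n : ℕ) (k : Fr G) :
    Continuous fun t : Ix G → ℝ => σ.Hn n ((∑ i, t i • co i) + k) := by
  unfold Hn ub ms
  simp only [map_add, map_sum, map_smul, LinearMap.add_apply, LinearMap.sum_apply, LinearMap.smul_apply]
  have := continuous_eC
  fun_prop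

/-- zero set -/
def Z : Set (Fr G) := {ξ | ∀ k, IsInt k → σ.H (ξ + k) = 0}

lemma unif_of_Z_empty (hZ : σ.Z = ∅) : ∃ c : ℝ, 0 < c ∧ ∀ ξ, ∃ k, IsInt k ∧ c ≤ σ.H (ξ + k) := by
  have hbox : IsCompact (Set.pi Set.univ fun _ : Ix G => Set.Icc (0:ℝ) 1) :=
    isCompact_univ_pi fun _ => isCompact_Icc
  have : ∃ c : ℝ, 0 < c ∧ ∀ t ∈ (Set.pi Set.univ fun _ : Ix G => Set.Icc (0:ℝ) 1), ∃ k, IsInt k ∧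
      c ≤ σ.H ((∑ i, t i • co i) + k) := by
    refine hbox.induction_on (p := fun s => ∃ c : ℝ, 0 < c ∧ ∀ t ∈ s, ∃ k, IsInt k ∧
      c ≤ σ.H ((∑ i, t i • co i) + k)) ?_ ?_ ?_ ?_
    · exact ⟨1, one_pos, fun t ht => absurd ht (Set.notMem_empty t)⟩
    · rintro s t hst ⟨c, hc, h⟩
      exact ⟨c, hc, fun x hx => h x (hst hx)⟩
    · rintro s t ⟨c, hc, h⟩ ⟨c', hc', h'⟩
      refine ⟨min c c', lt_min hc hc', fun x hx => ?_⟩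
      rcases hx with hx | hx
      · obtain ⟨k, hk, hk'⟩ := h x hx
        exact ⟨k, hk, (min_le_left _ _).trans hk'⟩
      · obtain ⟨k, hk, hk'⟩ := h' x hx
        exact ⟨k, hk, (min_le_right _ _).trans hk'⟩
    · intro t ht
      have h1 : (∑ i, t i • co i : Fr G) ∉ σ.Z := by rw [hZ]; exact Set.notMem_empty _
      simp only [Z, Set.mem_ofPred_eq, not_forall] at h1
      obtain ⟨k, hk, hne⟩ := h1
      have hpos : 0 < σ.H ((∑ i, t i • co i) + k) := lt_of_le_of_ne (σ.H_nonneg _) (Ne.symm hne)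
      set a := σ.H ((∑ i, t i • co i) + k) with ha
      obtain ⟨n, hn⟩ := σ.H_unif (Fintype.card (Ix G) + q k)
      have hn := hn n le_rfl
      have hopen : ∀ᶠ t' in 𝓝 t, a / 2 < σ.Hn n ((∑ i, t' i • co i) + k) := by
        refine (σ.continuous_Hn n k).continuousAt.eventually (lt_mem_nhds ?_)
        have := σ.H_le_Hn n ((∑ i, t i • co i) + k)
        linarith
      refine ⟨{t' | a / 2 < σ.Hn n ((∑ i, t' i • co i) + k)} ∩
        (Set.pi Set.univ fun _ : Ix G => Set.Icc (0:ℝ) 1), ?_, a / 2 * (1/2), by positivity, ?_⟩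
      · exact inter_mem (mem_nhdsWithin_of_mem_nhds hopen) self_mem_nhdsWithin
      · rintro t' ⟨h2, h3⟩
        refine ⟨k, hk, ?_⟩
        rw [σ.H_eq n]
        have h4 : q (∑ i, t' i • co i + k : Fr G) ≤ Fintype.card (Ix G) + q k :=
          (q_add _ _).trans (by gcongr; exact q_box fun i => h3 i (Set.mem_univ i))
        have h5 := hn _ h4
        have h2' : a / 2 < σ.Hn n ((∑ i, t' i • co i) + k) := h2
        have := σ.Hn_nonneg n ((∑ i, t' i • co i) + k)
        gcongr
  obtain ⟨c, hc, h⟩ := this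
  refine ⟨c, hc, fun ξ => ?_⟩
  obtain ⟨k, hk, t, ht, e⟩ := exists_int_near ξ
  obtain ⟨k', hk', h'⟩ := h t (fun i _ => ht i)
  exact ⟨k + k', hk.add hk', by rw [← add_assoc, e]; exact h'⟩

/-- the tower of good complete sets -/
lemma exists_tower (hH : σ.Had) (hZ : σ.Z = ∅) : ∃ c : ℝ, 0 < c ∧ ∃ (Λ : ℕ → Finset (Fr G)) (m : ℕ → ℕ),
    StrictMono m ∧ Monotone Λ ∧ (∀ j, σ.Comp (m j) (Λ j)) ∧
    (∀ j, ∀ l ∈ Λ j, c ≤ σ.H ((σ.S ^ (m j)) l)) := by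
  obtain ⟨c₀, hc₀, hk⟩ := σ.unif_of_Z_empty hZ
  set c := min c₀ (1/2) with hc
  have hcpos : 0 < c := lt_min hc₀ (by norm_num)
  refine ⟨c, hcpos, ?_⟩
  let T := {p : Finset (Fr G) × ℕ // σ.Comp p.2 p.1 ∧ ∀ l ∈ p.1, c ≤ σ.H ((σ.S ^ p.2) l)}
  have step : ∀ p : T, ∃ p' : T, p.1.1 ⊆ p'.1.1 ∧ p.1.2 < p'.1.2 := by
    rintro ⟨⟨Λ, m⟩, h1, h2⟩
    simp only at h1 h2
    have ev : ∀ᶠ n in atTop, ∀ l ∈ Λ, 1/2 ≤ σ.H ((σ.S ^ n) l) := by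
      rw [Finset.eventually_all]
      exact fun l _ => σ.H_tendsto_one l
    obtain ⟨M, hM, hmM⟩ := (ev.and (eventually_ge_atTop (m+1))).exists
    obtain ⟨n, rfl⟩ := Nat.exists_eq_add_of_le (show m ≤ M by omega)
    obtain ⟨Λ', hs, hc', -⟩ := h1.ext_many hH n
    choose k hkI hkH using fun l : Fr G => hk ((σ.S ^ (m + n)) l)
    let k' : Fr G → Fr G := fun l => if l ∈ Λ then 0 else k l
    have hk' : ∀ l, IsInt (k' l) := fun l => by
      simp only [k']; split_ifs
      · exact IsInt.zero
      · exact hkI l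
    refine ⟨⟨⟨Λ'.image fun l => l + (σ.A ^ (m + n)) (k' l), m + n⟩, (hc'.modify k' hk').1, ?_⟩, ?_, ?_⟩
    · intro l hl
      obtain ⟨a, ha, rfl⟩ := Finset.mem_image.1 hl
      simp only
      rw [map_add, σ.S_pow_A_pow]
      by_cases haΛ : a ∈ Λ
      · simp only [k', haΛ, if_true, add_zero]
        exact (min_le_right _ _).trans (hM a haΛ)
      · simp only [k', haΛ, if_false]
        exact (min_le_left _ _).trans (hkH a)
    · intro a ha
      exact Finset.mem_image.2 ⟨a, hs ha, by simp [k', show a ∈ Λ from ha]⟩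
    · simp only; omega
  choose nx hn1 hn2 using step
  let p0 : T := ⟨({0}, 0), σ.comp_zero, by
    intro l hl
    simp at hl
    subst hl
    simp [H_zero, hc]
    right; norm_num⟩
  let s : ℕ → T := fun j => Nat.rec p0 (fun _ p => nx p) j
  have hs : ∀ j, s (j+1) = nx (s j) := fun j => rfl
  refine ⟨fun j => (s j).1.1, fun j => (s j).1.2, ?_, ?_, fun j => (s j).2.1, fun j => (s j).2.2⟩
  · exact strictMono_nat_of_lt_succ fun j => by rw [hs]; exact hn2 _
  · exact monotone_nat_of_le_succ fun j => by rw [hs]; exact hn1 _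

end Sys
end coords
end HT

namespace HT
open Topology

namespace Sys
variable {G X C : Type} [AddCommGroup G] [Fintype X] [Fintype C] (σ : Sys G X C)

/-- finite level exponentials -/
def ew (M : ℕ) (l : Fr G) (w : Fin M → X) : ℂ := eC (∑ i : Fin M, ((σ.S ^ (i.1 + 1)) l) (σ.β (w i)))

/-- words over a base word -/
def cw {M : ℕ} (c : Fin M → C) : Finset (Fin M → X) :=
  Fintype.piFinset fun i => Finset.univ.filter fun x => σ.π x = c i

lemma mem_cw {M : ℕ} (c : Fin M → C) (w : Fin M → X) : w ∈ σ.cw c ↔ ∀ i, σ.π (w i) = c i := by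
  simp [cw]

lemma card_cw {M : ℕ} (c : Fin M → C) : (σ.cw c).card = σ.N ^ M := by
  simp [cw, Fintype.card_piFinset, σ.fib]

lemma sum_words {M : ℕ} {V : Type*} [AddCommMonoid V] (F : (Fin M → X) → V) :
    ∑ c, ∑ w ∈ σ.cw c, F w = ∑ w, F w := by
  rw [← Finset.sum_fiberwise Finset.univ (fun w : Fin M → X => fun i => σ.π (w i)) F]
  refine Finset.sum_congr rfl fun c _ => Finset.sum_congr ?_ fun _ _ => rfl
  ext w
  simp [mem_cw, funext_iff]

lemma ew_mul_conj (M : ℕ) (l l' : Fr G) (w : Fin M → X) :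
    σ.ew M l w * (starRingEnd ℂ) (σ.ew M l' w) = σ.ew M (l - l') w := by
  unfold ew
  rw [← eC_sub, ← Finset.sum_sub_distrib]
  simp [map_sub]

lemma sum_ew {M : ℕ} (c : Fin M → C) (l : Fr G) :
    ∑ w ∈ σ.cw c, σ.ew M l w = ∏ i : Fin M, σ.ms (c i) ((σ.S ^ (i.1 + 1)) l) := by
  unfold ew cw ms
  rw [Finset.prod_univ_sum]
  simp_rw [eC_sum]

/-- Orthogonality at level `M` -/
lemma ew_orth {M : ℕ} (F : Finset (Fr G)) (hF : ∀ l ∈ F, ∀ l' ∈ F, l ≠ l' →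
    ∃ i < M, ∀ c, σ.ms c ((σ.S ^ (i + 1)) (l - l')) = 0) (c : Fin M → C) :
    ∀ l ∈ F, ∀ l' ∈ F, ∑ w ∈ σ.cw c, σ.ew M l w * (starRingEnd ℂ) (σ.ew M l' w) =
      if l = l' then (((σ.N : ℝ) ^ M : ℝ) : ℂ) else (0 : ℂ) := by
  intro l hl l' hl'
  simp_rw [ew_mul_conj]
  split_ifs with h
  · subst h
    rw [sum_ew]
    simp [ms_zero]
  · obtain ⟨i, hi, h0⟩ := hF l hl l' hl' h
    rw [sum_ew]
    exact Finset.prod_eq_zero (Finset.mem_univ (⟨i, hi⟩ : Fin M)) (h0 _)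

/-- conditional Fourier coefficient -/
def fh (M : ℕ) (f : (Fin M → X) → ℂ) (l : Fr G) (c : Fin M → C) : ℂ :=
  (((σ.N : ℝ) ^ M : ℝ) : ℂ)⁻¹ * ∑ w ∈ σ.cw c, f w * (starRingEnd ℂ) (σ.ew M l w)

/-- mean square of conditional coefficients -/
def am (M : ℕ) (f : (Fin M → X) → ℂ) (l : Fr G) : ℝ :=
  ((Fintype.card C : ℝ) ^ M)⁻¹ * ∑ c, ‖σ.fh M f l c‖ ^ 2

lemma am_nonneg (M : ℕ) (f : (Fin M → X) → ℂ) (l : Fr G) : 0 ≤ σ.am M f l := by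
  unfold am; positivity

lemma card_X : Fintype.card X = Fintype.card C * σ.N := by
  rw [← Finset.card_univ, Finset.card_eq_sum_card_fiberwise (f := σ.π) (t := Finset.univ)
    (fun _ _ => Finset.mem_coe.2 (Finset.mem_univ _))]
  simp [σ.fib]

lemma card_X_pow (M : ℕ) : (Fintype.card X : ℝ) ^ M = (Fintype.card C : ℝ) ^ M * (σ.N : ℝ) ^ M := by
  rw [← mul_pow, σ.card_X]; push_cast; rfl

lemma parseval_level [Nonempty C] {M : ℕ} {Λ : Finset (Fr G)} (h : σ.Comp M Λ) (f : (Fin M → X) → ℂ) :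
    ∑ l ∈ Λ, σ.am M f l = ((Fintype.card X : ℝ) ^ M)⁻¹ * ∑ w, ‖f w‖ ^ 2 := by
  have hN : ((σ.N : ℝ) ^ M) ≠ 0 := pow_ne_zero _ σ.Npos.ne'
  have key : ∀ c : Fin M → C, ∑ l ∈ Λ, ‖σ.fh M f l c‖ ^ 2 =
      ((σ.N : ℝ) ^ M)⁻¹ * ∑ w ∈ σ.cw c, ‖f w‖ ^ 2 := by
    intro c
    have ho := σ.ew_orth Λ h.2 c
    have := parseval_fin (I := Λ) (J := σ.cw c) (by simp [h.1, card_cw])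
      (fun l w => σ.ew M l w) ((σ.N : ℝ) ^ M) hN (by
        intro i i'
        rw [Finset.sum_coe_sort (σ.cw c) (fun w => σ.ew M i w * (starRingEnd ℂ) (σ.ew M i' w)),
          ho i i.2 i' i'.2]
        simp only [Subtype.ext_iff]) (fun w => f w)
    rw [Finset.sum_coe_sort (σ.cw c) (fun w => ‖f w‖ ^ 2),
      Finset.sum_coe_sort Λ (fun l => ‖∑ j : σ.cw c, f j * (starRingEnd ℂ) (σ.ew M l j)‖ ^ 2)] at this
    have e : ∀ l, ‖σ.fh M f l c‖ ^ 2 = (((σ.N : ℝ) ^ M)⁻¹) ^ 2 *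
        ‖∑ j : σ.cw c, f j * (starRingEnd ℂ) (σ.ew M l j)‖ ^ 2 := by
      intro l
      rw [Finset.sum_coe_sort (σ.cw c) (fun w => f w * (starRingEnd ℂ) (σ.ew M l w))]
      unfold fh
      rw [norm_mul, mul_pow, norm_inv, Complex.norm_real, Real.norm_of_nonneg (by positivity)]
    simp_rw [e]
    rw [← Finset.mul_sum, this]
    field_simp
  unfold am
  rw [← Finset.mul_sum, Finset.sum_comm, Finset.sum_congr rfl fun c _ => key c, ← Finset.mul_sum,
    sum_words, ← mul_assoc, ← mul_inv, σ.card_X_pow]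

lemma bessel_level [Nonempty C] {M : ℕ} {F : Finset (Fr G)} (hF : ∀ l ∈ F, ∀ l' ∈ F, l ≠ l' →
    ∃ i < M, ∀ c, σ.ms c ((σ.S ^ (i + 1)) (l - l')) = 0) (f : (Fin M → X) → ℂ) :
    ((Fintype.card X : ℝ) ^ M)⁻¹ * ∑ w, ‖f w - ∑ l ∈ F, σ.fh M f l (fun i => σ.π (w i)) * σ.ew M l w‖ ^ 2 =
    ((Fintype.card X : ℝ) ^ M)⁻¹ * ∑ w, ‖f w‖ ^ 2 - ∑ l ∈ F, σ.am M f l := by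
  have hN : ((σ.N : ℝ) ^ M) ≠ 0 := pow_ne_zero _ σ.Npos.ne'
  have key : ∀ c : Fin M → C, ∑ w ∈ σ.cw c, ‖f w - ∑ l ∈ F, σ.fh M f l (fun i => σ.π (w i)) *
      σ.ew M l w‖ ^ 2 = ∑ w ∈ σ.cw c, ‖f w‖ ^ 2 - (σ.N : ℝ) ^ M * ∑ l ∈ F, ‖σ.fh M f l c‖ ^ 2 := by
    intro c
    have ho := σ.ew_orth F hF c
    have := bessel_fin (J := σ.cw c) F
      (fun l w => σ.ew M l w) ((σ.N : ℝ) ^ M) hN (by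
        intro i hi i' hi'
        rw [Finset.sum_coe_sort (σ.cw c) (fun w => σ.ew M i w * (starRingEnd ℂ) (σ.ew M i' w)),
          ho i hi i' hi']) (fun w => f w)
    have e0 : ∀ l, ∑ j : σ.cw c, f j * (starRingEnd ℂ) (σ.ew M l j) =
      ∑ w ∈ σ.cw c, f w * (starRingEnd ℂ) (σ.ew M l w) := fun l =>
        Finset.sum_coe_sort (σ.cw c) (fun w => f w * (starRingEnd ℂ) (σ.ew M l w))
    simp_rw [e0] at this
    rw [Finset.sum_coe_sort (σ.cw c) (fun w => ‖f w‖ ^ 2)] at this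
    have e : ∀ l, ‖∑ w ∈ σ.cw c, f w * (starRingEnd ℂ) (σ.ew M l w)‖ ^ 2 =
        ((σ.N : ℝ) ^ M) ^ 2 * ‖σ.fh M f l c‖ ^ 2 := by
      intro l
      unfold fh
      rw [norm_mul, mul_pow, norm_inv, Complex.norm_real, Real.norm_of_nonneg (by positivity)]
      field_simp
    simp_rw [e] at this
    rw [← Finset.mul_sum, ← mul_assoc] at this
    have e2 : ((σ.N : ℝ) ^ M)⁻¹ * ((σ.N : ℝ) ^ M) ^ 2 = (σ.N : ℝ) ^ M := by field_simp
    rw [e2] at this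
    rw [← this, ← Finset.sum_coe_sort]
    refine Finset.sum_congr rfl fun w _ => ?_
    have hw : (fun i => σ.π (w.1 i)) = c := funext ((σ.mem_cw c w.1).1 w.2)
    rw [hw]
    rfl
  rw [← σ.sum_words, Finset.sum_congr rfl fun c _ => key c, Finset.sum_sub_distrib, σ.sum_words, mul_sub]
  congr 1
  unfold am
  rw [← Finset.mul_sum, Finset.sum_comm, ← Finset.mul_sum, ← mul_assoc, σ.card_X_pow]
  congr 1
  field_simp

/-- bound for coefficients -/
lemma fh_le {M : ℕ} (f : (Fin M → X) → ℂ) (l : Fr G) (c : Fin M → C) {K : ℝ} (hK : ∀ w, ‖f w‖ ≤ K) :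
    ‖σ.fh M f l c‖ ≤ K := by
  have hN : 0 < ((σ.N : ℝ) ^ M) := pow_pos σ.Npos _
  unfold fh
  rw [norm_mul, norm_inv, Complex.norm_real, Real.norm_of_nonneg hN.le, inv_mul_le_iff₀ hN]
  refine (norm_sum_le _ _).trans ?_
  have : ∀ w ∈ σ.cw c, ‖f w * (starRingEnd ℂ) (σ.ew M l w)‖ ≤ K := fun w _ => by
    rw [norm_mul, RCLike.norm_conj]; unfold ew; rw [norm_eC, mul_one]; exact hK w
  refine (Finset.sum_le_sum this).trans ?_
  simp [card_cw]

lemma ew_snoc (M : ℕ) (l : Fr G) (w : Fin M → X) (x : X) :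
    σ.ew (M + 1) l (Fin.snoc w x : Fin (M+1) → X) = σ.ew M l w * eC ((σ.S ^ (M + 1)) l (σ.β x)) := by
  unfold ew
  rw [Fin.sum_univ_castSucc, eC_add]
  simp

lemma fh_snoc (M : ℕ) (f : (Fin M → X) → ℂ) (l : Fr G) (c : Fin M → C) (a : C) :
    σ.fh (M + 1) (fun w => f (Fin.init w)) l (Fin.snoc c a : Fin (M+1) → C) =
      σ.fh M f l c * ((σ.N : ℂ)⁻¹ * (starRingEnd ℂ) (σ.ms a ((σ.S ^ (M + 1)) l))) := by
  have : ∑ w ∈ σ.cw (Fin.snoc c a : Fin (M+1) → C), f (Fin.init w) * (starRingEnd ℂ) (σ.ew (M+1) l w) =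
      (∑ w ∈ σ.cw c, f w * (starRingEnd ℂ) (σ.ew M l w)) *
      (starRingEnd ℂ) (σ.ms a ((σ.S ^ (M + 1)) l)) := by
    unfold ms
    rw [map_sum, Finset.sum_mul_sum, ← Finset.sum_product']
    symm
    refine Finset.sum_bij (fun p _ => (Fin.snoc p.1 p.2 : Fin (M+1) → X)) ?_ ?_ ?_ ?_
    · rintro ⟨w, x⟩ hp
      simp only [Finset.mem_product, mem_cw, Finset.mem_filter, Finset.mem_univ, true_and] at hp
      rw [mem_cw, Fin.forall_fin_succ']
      simp only [Fin.snoc_castSucc, Fin.snoc_last]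
      exact hp
    · rintro ⟨w, x⟩ _ ⟨w', x'⟩ _ h
      have h1 : w = w' := by
        have := congrArg (Fin.init (α := fun _ => X)) h
        simpa using this
      have h2 : x = x' := by
        have := congrFun h (Fin.last M)
        simpa using this
      rw [h1, h2]
    · intro w hw
      rw [mem_cw, Fin.forall_fin_succ'] at hw
      simp only [Fin.snoc_castSucc, Fin.snoc_last] at hw
      refine ⟨(Fin.init w, w (Fin.last M)), ?_, Fin.snoc_init_self w⟩
      simp only [Finset.mem_product, mem_cw, Finset.mem_filter, Finset.mem_univ, true_and]
      exact hw
    · rintro ⟨w, x⟩ _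
      rw [ew_snoc, map_mul, Fin.init_snoc]; ring
  unfold fh
  rw [this, pow_succ]
  push_cast
  rw [mul_inv]; ring

lemma am_succ (M : ℕ) (f : (Fin M → X) → ℂ) (l : Fr G) :
    σ.am (M + 1) (fun w => f (Fin.init w)) l = σ.am M f l * σ.ub ((σ.S ^ (M + 1)) l) := by
  unfold am ub
  have : ∑ c, ‖σ.fh (M+1) (fun w => f (Fin.init w)) l c‖ ^ 2 =
      (∑ c, ‖σ.fh M f l c‖ ^ 2) * ∑ a, (‖σ.ms a ((σ.S ^ (M + 1)) l)‖ / σ.N) ^ 2 := by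
    rw [← (Fin.snocEquiv (fun _ : Fin (M+1) => C)).sum_comp, Fintype.sum_prod_type, Finset.sum_mul_sum,
      Finset.sum_comm]
    refine Finset.sum_congr rfl fun c _ => Finset.sum_congr rfl fun a _ => ?_
    have := σ.fh_snoc M f l c a
    have e : (Fin.snocEquiv (fun _ : Fin (M+1) => C)) (a, c) = (Fin.snoc c a : Fin (M+1) → C) := rfl
    rw [e, this, norm_mul, mul_pow, norm_mul, norm_inv, RCLike.norm_conj, Complex.norm_natCast,
      div_eq_inv_mul]
  rw [this, pow_succ, mul_inv]; ring

/-- lift of a cylinder function -/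
def lift {n : ℕ} (f : (Fin n → X) → ℂ) (M : ℕ) (w : Fin M → X) : ℂ :=
  if h : n ≤ M then f (fun i => w (Fin.castLE h i)) else 0

lemma lift_succ {n : ℕ} (f : (Fin n → X) → ℂ) {M : ℕ} (h : n ≤ M) :
    lift f (M + 1) = fun w => lift f M (Fin.init w) := by
  funext w
  have h' : n ≤ M + 1 := by omega
  simp only [lift, h, h', dite_true]
  rfl

lemma am_lift {n : ℕ} (f : (Fin n → X) → ℂ) (l : Fr G) {M : ℕ} (h : n ≤ M) :
    σ.am M (lift f M) l * σ.H ((σ.S ^ M) l) = σ.am n (lift f n) l * σ.H ((σ.S ^ n) l) := by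
  induction M, h using Nat.le_induction with
  | base => rfl
  | succ M hM ih =>
    rw [← ih, lift_succ f hM, am_succ, σ.H_succ ((σ.S ^ M) l), pow_succ']
    simp only [Module.End.mul_apply]; ring

end Sys
end HT

namespace HT
open Topology

/-- realization of the uniform Bernoulli process -/
structure Rz {Ω X : Type} [MeasurableSpace Ω] [Fintype X] (P : Measure Ω) (x : ℕ → Ω → X) : Prop where
  meas : ∀ n a, MeasurableSet {ω | x n ω = a}
  law : ∀ n (w : Fin n → X), P.real {ω | ∀ i : Fin n, x i ω = w i} = ((Fintype.card X : ℝ) ^ n)⁻¹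

namespace Rz
variable {Ω X : Type} [MeasurableSpace Ω] [Fintype X] {P : Measure Ω} {x : ℕ → Ω → X}

lemma meas_cyl (h : Rz P x) (n : ℕ) (w : Fin n → X) : MeasurableSet {ω | ∀ i : Fin n, x i ω = w i} := by
  have : {ω | ∀ i : Fin n, x i ω = w i} = ⋂ i : Fin n, {ω | x i ω = w i} := by ext; simp
  rw [this]
  exact MeasurableSet.iInter fun i => h.meas _ _

lemma eq_sum {V : Type*} [AddCommMonoid V] (x : ℕ → Ω → X) (n : ℕ) (F : (Fin n → X) → V) :
    (fun ω => F (fun i => x i ω)) = fun ω => ∑ w, {ω | ∀ i : Fin n, x i ω = w i}.indicator (fun _ => F w) ω := by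
  funext ω
  rw [Finset.sum_eq_single (fun i : Fin n => x i ω)]
  · rw [Set.indicator_of_mem]; simp
  · intro w _ hw
    rw [Set.indicator_of_notMem]
    intro h
    exact hw (funext fun i => (h i).symm)
  · simp

lemma measurable (h : Rz P x) (n : ℕ) (F : (Fin n → X) → ℂ) : Measurable (fun ω => F (fun i => x i ω)) := by
  rw [eq_sum x n F]
  exact Finset.measurable_sum _ fun w _ => measurable_const.indicator (h.meas_cyl n w)

lemma integral [IsProbabilityMeasure P] (h : Rz P x) (n : ℕ) (F : (Fin n → X) → ℝ) :
    Integrable (fun ω => F (fun i => x i ω)) P ∧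
    ∫ ω, F (fun i => x i ω) ∂P = ((Fintype.card X : ℝ) ^ n)⁻¹ * ∑ w, F w := by
  have hi : ∀ w ∈ (Finset.univ : Finset (Fin n → X)), Integrable
    ({ω | ∀ i : Fin n, x i ω = w i}.indicator (fun _ => F w)) P := fun w _ =>
      (integrable_const _).indicator (h.meas_cyl n w)
  constructor
  · rw [eq_sum x n F]
    exact integrable_finsetSum _ hi
  · rw [eq_sum x n F, integral_finsetSum _ hi, Finset.mul_sum]
    refine Finset.sum_congr rfl fun w _ => ?_
    rw [integral_indicator_const _ (h.meas_cyl n w), h.law, smul_eq_mul]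

lemma integralC [IsProbabilityMeasure P] (h : Rz P x) (n : ℕ) (F : (Fin n → X) → ℂ) :
    ∫ ω, F (fun i => x i ω) ∂P = ((Fintype.card X : ℂ) ^ n)⁻¹ * ∑ w, F w := by
  have hi : ∀ w ∈ (Finset.univ : Finset (Fin n → X)), Integrable
    ({ω | ∀ i : Fin n, x i ω = w i}.indicator (fun _ => F w)) P := fun w _ =>
      (integrable_const _).indicator (h.meas_cyl n w)
  rw [eq_sum x n F, integral_finsetSum _ hi, Finset.mul_sum]
  refine Finset.sum_congr rfl fun w _ => ?_
  rw [integral_indicator_const _ (h.meas_cyl n w), h.law]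
  rw [Complex.real_smul]; push_cast; rfl

end Rz

namespace Sys
variable {G X C : Type} [AddCommGroup G] [Fintype X] [Fintype C] (σ : Sys G X C)

/-- limit exponentials -/
def einf (l : Fr G) (w : ℕ → X) : ℂ := eC (∑' i : ℕ, ((σ.S ^ (i + 1)) l) (σ.β (w i)))

@[simp] lemma norm_einf (l : Fr G) (w : ℕ → X) : ‖σ.einf l w‖ = 1 := norm_eC _

@[simp] lemma norm_ew (M : ℕ) (l : Fr G) (w : Fin M → X) : ‖σ.ew M l w‖ = 1 := norm_eC _

lemma summable_einf [Module.Free ℤ G] [Module.Finite ℤ G] (l : Fr G) (w : ℕ → X) :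
    Summable fun i : ℕ => ((σ.S ^ (i + 1)) l) (σ.β (w i)) := by
  obtain ⟨K, hK, hb⟩ := exists_digit_bound σ.β
  refine Summable.of_norm_bounded (g := fun i => K * q ((σ.S ^ (i+1)) l)) ?_ fun i => hb _ _
  exact ((summable_nat_add_iff 1).2 (σ.summable_q l)).mul_left K

lemma einf_approx [Module.Free ℤ G] [Module.Finite ℤ G] (l : Fr G) :
    ∃ δ : ℕ → ℝ, Tendsto δ atTop (𝓝 0) ∧ ∀ (w : ℕ → X) M,
      ‖σ.ew M l (fun i => w i) - σ.einf l w‖ ≤ δ M := by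
  obtain ⟨K, hK, hb⟩ := exists_digit_bound σ.β
  have hs : Summable (fun i => K * q ((σ.S ^ (i+1)) l)) :=
    ((summable_nat_add_iff 1).2 (σ.summable_q l)).mul_left K
  refine ⟨fun M => 2 * Real.pi * ∑' i, K * q ((σ.S ^ ((i+M)+1)) l), ?_, fun w M => ?_⟩
  · have := (tendsto_sum_nat_add (fun i => K * q ((σ.S ^ (i+1)) l))).const_mul (2 * Real.pi)
    simpa using this
  · unfold ew einf
    refine (norm_eC_sub _ _).trans ?_
    refine mul_le_mul_of_nonneg_left ?_ (by positivity)
    have h1 := (σ.summable_einf l w).sum_add_tsum_nat_add M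
    rw [Fin.sum_univ_eq_sum_range (fun i => ((σ.S ^ (i+1)) l) (σ.β (w i))) M, ← h1, abs_sub_comm,
      add_sub_cancel_left, ← Real.norm_eq_abs]
    have hs' := (summable_nat_add_iff M).2 hs
    exact tsum_of_norm_bounded hs'.hasSum fun i => hb _ _

lemma einf_tendsto [Module.Free ℤ G] [Module.Finite ℤ G] (l : Fr G) (w : ℕ → X) :
    Tendsto (fun M => σ.ew M l (fun i => w i)) atTop (𝓝 (σ.einf l w)) := by
  obtain ⟨δ, hδ, hb⟩ := σ.einf_approx l
  rw [tendsto_iff_norm_sub_tendsto_zero]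
  exact squeeze_zero (fun _ => norm_nonneg _) (fun M => hb w M) hδ

lemma einf_meas [Module.Free ℤ G] [Module.Finite ℤ G] {Ω : Type} [MeasurableSpace Ω] {P : Measure Ω}
    {x : ℕ → Ω → X} (h : Rz P x) (l : Fr G) : Measurable fun ω => σ.einf l (fun i => x i ω) :=
  measurable_of_tendsto_metrizable (f := fun M ω => σ.ew M l (fun i => x i ω))
    (fun M => h.measurable M (σ.ew M l)) (tendsto_pi_nhds.2 fun ω => σ.einf_tendsto l (fun i => x i ω))

/-- totality of exponentials in a given realization -/
def Tot (Λ : Set (Fr G)) {Ω : Type} [MeasurableSpace Ω] (P : Measure Ω) (x : ℕ → Ω → X) : Prop :=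
  ∀ h : Ω → ℂ, MemLp h 2 P →
    (∀ l ∈ Λ, ∀ n (g : (Fin n → C) → ℂ), ∫ ω, h ω * (starRingEnd ℂ) (σ.einf l fun i => x i ω) *
      g (fun i => σ.π (x i ω)) ∂P = 0) →
    ∀ n (f : (Fin n → X) → ℂ), ∫ ω, h ω * f (fun i => x i ω) ∂P = 0

/-- orthogonality -/
def Orth (Λ : Set (Fr G)) : Prop :=
  ∀ l ∈ Λ, ∀ l' ∈ Λ, l ≠ l' → ∃ i, ∀ c, σ.ms c ((σ.S ^ (i + 1)) (l - l')) = 0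

/-- spectral sets of relative systems -/
def SpecSet (Λ : Set (Fr G)) : Prop :=
  Λ.Countable ∧ σ.Orth Λ ∧ ∀ (Ω : Type) [MeasurableSpace Ω] (P : Measure Ω) [IsProbabilityMeasure P]
    (x : ℕ → Ω → X), Rz P x → σ.Tot Λ P x

end Sys

lemma _root_.Measurable.congr_fun' {Ω : Type} [MeasurableSpace Ω] {f g : Ω → ℂ} (hf : Measurable f)
    (h : ∀ ω, g ω = f ω) : Measurable g := by
  rw [funext h]; exact hf

lemma am_gm (a b η : ℝ) (hη : 0 < η) : a * b ≤ η * a ^ 2 + η⁻¹ * b ^ 2 := by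
  have h1 : η * a ^ 2 + η⁻¹ * b ^ 2 - a * b = η⁻¹ * ((η * a - b / 2) ^ 2 + 3 / 4 * b ^ 2) := by
    field_simp; ring
  have : 0 ≤ η⁻¹ * ((η * a - b / 2) ^ 2 + 3 / 4 * b ^ 2) := by positivity
  linarith

lemma integrable_mul_bdd {Ω : Type} [MeasurableSpace Ω] {P : Measure Ω} {h u : Ω → ℂ}
    (hh : Integrable h P) (hu : Measurable u) {K : ℝ} (hK : ∀ ω, ‖u ω‖ ≤ K) :
    Integrable (fun ω => h ω * u ω) P :=
  hh.mul_bdd (c := K) hu.aestronglyMeasurable (Eventually.of_forall hK)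

/-- uniform approximation passes zero integrals to the limit -/
lemma int_zero_of_unif {Ω : Type} [MeasurableSpace Ω] {P : Measure Ω} {h : Ω → ℂ} (hh : Integrable h P)
    {u : Ω → ℂ} (hu : Measurable u) {K : ℝ} (hK : ∀ ω, ‖u ω‖ ≤ K) {v : ℕ → Ω → ℂ}
    (hv : ∀ n, Measurable (v n)) {δ : ℕ → ℝ} (hδ : Tendsto δ atTop (𝓝 0))
    (hvu : ∀ n ω, ‖v n ω - u ω‖ ≤ δ n) (h0 : ∀ n, ∫ ω, h ω * v n ω ∂P = 0) :
    ∫ ω, h ω * u ω ∂P = 0 := by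
  have hb : ∀ n, ‖∫ ω, h ω * u ω ∂P‖ ≤ δ n * ∫ ω, ‖h ω‖ ∂P := by
    intro n
    have hvb : ∀ ω, ‖v n ω‖ ≤ K + δ n := fun ω => by
      have := norm_add_le (v n ω - u ω) (u ω)
      rw [sub_add_cancel] at this
      linarith [hvu n ω, hK ω]
    have e : ∫ ω, h ω * u ω ∂P = ∫ ω, h ω * (u ω - v n ω) ∂P := by
      simp_rw [mul_sub]
      rw [integral_sub (integrable_mul_bdd hh hu hK) (integrable_mul_bdd hh (hv n) hvb), h0, sub_zero]
    rw [e]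
    refine (norm_integral_le_integral_norm _).trans ?_
    rw [← integral_const_mul]
    refine integral_mono_of_nonneg (Eventually.of_forall fun _ => norm_nonneg _) (hh.norm.const_mul _)
      (Eventually.of_forall fun ω => ?_)
    simp only [norm_mul]
    rw [mul_comm, norm_sub_rev]
    exact mul_le_mul_of_nonneg_right (hvu n ω) (norm_nonneg _)
  have := ge_of_tendsto' (hδ.mul_const (∫ ω, ‖h ω‖ ∂P)) hb
  rw [zero_mul] at this
  exact norm_le_zero_iff.1 this

namespace Sys
variable {G X C : Type} [AddCommGroup G] [Fintype X] [Fintype C] (σ : Sys G X C)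

/-- main finite estimate -/
lemma tower_finite [Nonempty C] {c : ℝ} (hc : 0 < c) {Λ : ℕ → Finset (Fr G)} {m : ℕ → ℕ}
    (hm : StrictMono m) (hΛ : Monotone Λ) (hC : ∀ j, σ.Comp (m j) (Λ j))
    (hH : ∀ j, ∀ l ∈ Λ j, c ≤ σ.H ((σ.S ^ (m j)) l)) {n : ℕ} (f : (Fin n → X) → ℂ) {ε : ℝ} (hε : 0 < ε) :
    ∃ k, ∀ j ≥ k, n ≤ m j ∧ ((Fintype.card X : ℝ) ^ (m j))⁻¹ * ∑ w, ‖lift f (m j) w -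
      ∑ l ∈ Λ k, σ.fh (m j) (lift f (m j)) l (fun i => σ.π (w i)) * σ.ew (m j) l w‖ ^ 2 ≤ ε := by
  set b : Fr G → ℝ := fun l => σ.am n (lift f n) l * σ.H ((σ.S ^ n) l) with hb
  have hb0 : ∀ l, 0 ≤ b l := fun l => mul_nonneg (σ.am_nonneg _ _ _) (σ.H_nonneg _)
  have hbM : ∀ l M, n ≤ M → σ.am M (lift f M) l * σ.H ((σ.S ^ M) l) = b l := fun l M h => σ.am_lift f l h
  obtain ⟨K, hK0, hK⟩ : ∃ K : ℝ, 0 ≤ K ∧ ∀ M (w : Fin M → X), ‖lift f M w‖ ≤ K := by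
    refine ⟨∑ w, ‖f w‖, Finset.sum_nonneg fun _ _ => norm_nonneg _, fun M w => ?_⟩
    unfold lift
    split_ifs with h
    · exact Finset.single_le_sum (f := fun w => ‖f w‖) (fun _ _ => norm_nonneg _) (Finset.mem_univ _)
    · rw [norm_zero]; exact Finset.sum_nonneg fun _ _ => norm_nonneg _
  obtain ⟨k0, hk0⟩ : ∃ k0, n ≤ m k0 := ⟨n, hm.le_apply⟩
  have hnm : ∀ j, k0 ≤ j → n ≤ m j := fun j hj => hk0.trans (hm.monotone hj)
  have hsum : ∀ j, k0 ≤ j → ∑ l ∈ Λ j, b l ≤ K ^ 2 := by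
    intro j hj
    have h1 : ∑ l ∈ Λ j, b l ≤ ∑ l ∈ Λ j, σ.am (m j) (lift f (m j)) l := by
      refine Finset.sum_le_sum fun l _ => ?_
      rw [← hbM l (m j) (hnm j hj)]
      exact mul_le_of_le_one_right (σ.am_nonneg _ _ _) (σ.H_le_one _)
    refine h1.trans ?_
    rw [σ.parseval_level (hC j)]
    by_cases hX : (Fintype.card X : ℝ) ^ (m j) = 0
    · rw [hX]; simp; positivity
    rw [inv_mul_le_iff₀ (lt_of_le_of_ne (by positivity) (Ne.symm hX))]
    refine (Finset.sum_le_sum (g := fun _ => K ^ 2) fun w _ =>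
      pow_le_pow_left₀ (norm_nonneg _) (hK _ w) 2).trans ?_
    simp
  have hmono : Monotone fun j => ∑ l ∈ Λ j, b l := fun i j hij =>
    Finset.sum_le_sum_of_subset_of_nonneg (hΛ hij) fun l _ _ => hb0 l
  have hbd : BddAbove (Set.range fun j => ∑ l ∈ Λ j, b l) := by
    refine ⟨K ^ 2, ?_⟩
    rintro _ ⟨j, rfl⟩
    exact (hmono (le_max_left j k0)).trans (hsum _ (le_max_right _ _))
  have hlim := tendsto_atTop_ciSup hmono hbd
  have hev := (hlim.eventually (lt_mem_nhds (sub_lt_self (⨆ j, ∑ l ∈ Λ j, b l) (mul_pos hc hε)))).and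
    (eventually_ge_atTop k0)
  obtain ⟨k, hk, hkk⟩ := hev.exists
  refine ⟨k, fun j hj => ⟨hnm j (hkk.trans hj), ?_⟩⟩
  have hnj := hnm j (hkk.trans hj)
  rw [σ.bessel_level (fun l hl l' hl' => (hC j).2 l (hΛ hj hl) l' (hΛ hj hl')), ← σ.parseval_level (hC j),
    ← Finset.sum_sdiff (hΛ hj), add_sub_cancel_right]
  have h2 : ∑ l ∈ Λ j \ Λ k, σ.am (m j) (lift f (m j)) l ≤ ∑ l ∈ Λ j \ Λ k, c⁻¹ * b l := by
    refine Finset.sum_le_sum fun l hl => ?_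
    rw [← hbM l (m j) hnj, le_inv_mul_iff₀ hc, mul_comm]
    exact mul_le_mul_of_nonneg_left (hH j l (Finset.sdiff_subset hl)) (σ.am_nonneg _ _ _)
  refine h2.trans ?_
  rw [← Finset.mul_sum, inv_mul_le_iff₀ hc]
  have h3 : ∑ l ∈ Λ j, b l ≤ ⨆ j, ∑ l ∈ Λ j, b l := le_ciSup hbd j
  have h4 := Finset.sum_sdiff (f := b) (hΛ hj)
  linarith

/-- the analytic estimate at one level -/
lemma level_est [Module.Free ℤ G] [Module.Finite ℤ G] {Ω : Type} [MeasurableSpace Ω] {P : Measure Ω}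
    [IsProbabilityMeasure P] {x : ℕ → Ω → X} (hx : Rz P x) {h : Ω → ℂ} (hintg : Integrable h P)
    (hsq : Integrable (fun ω => ‖h ω‖ ^ 2) P) (F : Finset (Fr G)) (M : ℕ) (a : Fr G → (Fin M → C) → ℂ)
    {K : ℝ} (haK : ∀ l c, ‖a l c‖ ≤ K) (δ : Fr G → ℝ)
    (hδ : ∀ l (w : ℕ → X), ‖σ.ew M l (fun i => w i) - σ.einf l w‖ ≤ δ l)
    (h0 : ∀ l ∈ F, ∀ (g : (Fin M → C) → ℂ), ∫ ω, h ω * (starRingEnd ℂ) (σ.einf l fun i => x i ω) *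
      g (fun i => σ.π (x i ω)) ∂P = 0) (f : (Fin M → X) → ℂ) {η : ℝ} (hη : 0 < η)
    (hj : ((Fintype.card X : ℝ) ^ M)⁻¹ * ∑ w, ‖(starRingEnd ℂ) (f w) -
      ∑ l ∈ F, a l (fun i => σ.π (w i)) * σ.ew M l w‖ ^ 2 ≤ η ^ 2) :
    ‖∫ ω, h ω * f (fun i => x i ω) ∂P‖ ≤
      η * (∫ ω, ‖h ω‖ ^ 2 ∂P + 1) + ∑ l ∈ F, K * δ l * ∫ ω, ‖h ω‖ ∂P := by
  obtain ⟨u, hu⟩ : ∃ u : (Fin M → X) → ℂ, ∀ w, u w = (starRingEnd ℂ) ((starRingEnd ℂ) (f w) -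
        ∑ l ∈ F, a l (fun i => σ.π (w i)) * σ.ew M l w) := ⟨_, fun _ => rfl⟩
  obtain ⟨e, he⟩ : ∃ e : Fr G → Ω → ℂ, ∀ l ω, e l ω = (starRingEnd ℂ) (σ.einf l fun i => x i ω) :=
    ⟨_, fun _ _ => rfl⟩
  obtain ⟨b, hb⟩ : ∃ b : Fr G → Ω → ℂ, ∀ l ω, b l ω = (starRingEnd ℂ) (a l (fun i => σ.π (x i ω))) :=
    ⟨_, fun _ _ => rfl⟩
  obtain ⟨v, hv⟩ : ∃ v : Fr G → Ω → ℂ, ∀ l ω, v l ω = b l ω *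
        ((starRingEnd ℂ) (σ.ew M l fun i => x i ω) - e l ω) := ⟨_, fun _ _ => rfl⟩
  have ham : ∀ l, Measurable (b l) := fun l => by
    have := hx.measurable M (fun w => (starRingEnd ℂ) (a l (fun i => σ.π (w i))))
    exact this.congr_fun' (hb l)
  have hem : ∀ l, Measurable fun ω => (starRingEnd ℂ) (σ.ew M l fun i => x i ω) := fun l =>
    hx.measurable M (fun w => (starRingEnd ℂ) (σ.ew M l w))
  have hcm : ∀ l, Measurable (e l) := fun l => by
    have := Complex.continuous_conj.measurable.comp (σ.einf_meas hx l)
    exact this.congr_fun' (he l)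
  have hvm : ∀ l, Measurable (v l) := fun l =>
    ((ham l).mul ((hem l).sub (hcm l))).congr_fun' (hv l)
  have hb1 : ∀ l ω, ‖b l ω‖ ≤ K := fun l ω => by rw [hb, RCLike.norm_conj]; exact haK _ _
  have he1 : ∀ l ω, ‖e l ω‖ ≤ 1 := fun l ω => by rw [he, RCLike.norm_conj, norm_einf]
  have hvb : ∀ l ω, ‖v l ω‖ ≤ K * δ l := fun l ω => by
    rw [hv, norm_mul, he, ← map_sub, RCLike.norm_conj]
    exact mul_le_mul (hb1 _ _) (hδ l (fun i => x i ω)) (norm_nonneg _) ((norm_nonneg _).trans (hb1 l ω))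
  have hum : Measurable fun ω => u (fun i => x i ω) := hx.measurable M u
  obtain ⟨Ku, hKu⟩ : ∃ Ku, ∀ w, ‖u w‖ ≤ Ku := ⟨∑ w, ‖u w‖, fun w =>
    Finset.single_le_sum (f := fun w => ‖u w‖) (fun _ _ => norm_nonneg _) (Finset.mem_univ _)⟩
  have hsplit : ∀ ω, h ω * f (fun i => x i ω) = h ω * u (fun i => x i ω) + ∑ l ∈ F,
      (h ω * v l ω + h ω * e l ω * b l ω) := by
    intro ω
    have : ∀ l, (h ω * v l ω + h ω * e l ω * b l ω) = h ω * (b l ω *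
      ((starRingEnd ℂ) (σ.ew M l fun i => x i ω))) := fun l => by rw [hv]; ring
    simp_rw [this]
    rw [hu, map_sub, map_sum, ← Finset.mul_sum, Complex.conj_conj]
    simp_rw [hb, map_mul]
    ring
  have hi1 : Integrable (fun ω => h ω * u (fun i => x i ω)) P := integrable_mul_bdd hintg hum fun ω => hKu _
  have hi2 : ∀ l, Integrable (fun ω => h ω * v l ω) P := fun l => integrable_mul_bdd hintg (hvm l) (hvb l)
  have hi3 : ∀ l, Integrable (fun ω => h ω * e l ω * b l ω) P := fun l =>
    integrable_mul_bdd (integrable_mul_bdd hintg (hcm l) (he1 l)) (ham l) (hb1 l)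
  have hi4 : ∀ l ∈ F, ∫ ω, h ω * e l ω * b l ω ∂P = 0 := fun l hl => by
    have := h0 l hl (fun c => (starRingEnd ℂ) (a l c))
    simp_rw [he, hb]; exact this
  simp_rw [hsplit]
  have hi5 : ∀ l ∈ F, Integrable (fun ω => h ω * v l ω + h ω * e l ω * b l ω) P := fun l _ =>
    (hi2 l).add (hi3 l)
  rw [integral_add hi1 (integrable_finsetSum F hi5), integral_finsetSum F hi5]
  refine (norm_add_le _ _).trans (add_le_add ?_ ?_)
  · refine (norm_integral_le_integral_norm _).trans ?_
    have hI := hx.integral M (fun w => ‖u w‖ ^ 2)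
    have h1 : ∫ ω, ‖h ω * u (fun i => x i ω)‖ ∂P ≤
        ∫ ω, (η * ‖h ω‖ ^ 2 + η⁻¹ * ‖u (fun i => x i ω)‖ ^ 2) ∂P := by
      refine integral_mono hi1.norm ((hsq.const_mul _).add (hI.1.const_mul _)) fun ω => ?_
      simp only [norm_mul]
      exact am_gm _ _ _ hη
    refine h1.trans ?_
    rw [integral_add (hsq.const_mul _) (hI.1.const_mul _), integral_const_mul, integral_const_mul, hI.2]
    have h2 : ((Fintype.card X : ℝ) ^ M)⁻¹ * ∑ w, ‖u w‖ ^ 2 ≤ η ^ 2 := by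
      refine le_trans (le_of_eq ?_) hj
      simp_rw [hu, RCLike.norm_conj]
    have h3 : η⁻¹ * (((Fintype.card X : ℝ) ^ M)⁻¹ * ∑ w, ‖u w‖ ^ 2) ≤ η := by
      rw [inv_mul_le_iff₀ hη, ← sq]; exact h2
    linarith
  · refine (norm_sum_le _ _).trans (Finset.sum_le_sum fun l hl => ?_)
    rw [integral_add (hi2 l) (hi3 l), hi4 l hl, add_zero]
    refine (norm_integral_le_integral_norm _).trans ?_
    rw [← integral_const_mul]
    refine integral_mono (hi2 l).norm (hintg.norm.const_mul _) fun ω => ?_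
    simp only [norm_mul]
    rw [mul_comm ‖h ω‖]
    exact mul_le_mul_of_nonneg_right (hvb l ω) (norm_nonneg _)

theorem specSet_of_Z_empty [Nonempty C] [Module.Free ℤ G] [Module.Finite ℤ G] (hH : σ.Had)
    (hZ : σ.Z = ∅) : ∃ Λ, σ.SpecSet Λ := by
  obtain ⟨c, hc, Λ, m, hm, hΛ, hC, hcH⟩ := σ.exists_tower hH hZ
  refine ⟨⋃ j, (Λ j : Set (Fr G)), ?_, ?_, ?_⟩
  · exact Set.countable_iUnion fun j => (Λ j).countable_toSet
  · intro l hl l' hl' hne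
    obtain ⟨j, hj⟩ := Set.mem_iUnion.1 hl
    obtain ⟨j', hj'⟩ := Set.mem_iUnion.1 hl'
    obtain ⟨i, -, hi⟩ := (hC (max j j')).2 l (hΛ (le_max_left _ _) hj) l' (hΛ (le_max_right _ _) hj') hne
    exact ⟨i, hi⟩
  · intro Ω _ P _ x hx h hh h0 n f
    have hintg : Integrable h P := hh.integrable (by norm_num)
    have hsq : Integrable (fun ω => ‖h ω‖ ^ 2) P := by
      have := hh.integrable_norm_pow (p := 2) (by norm_num)
      simpa using this
    obtain ⟨A, hA⟩ : ∃ A, A = ∫ ω, ‖h ω‖ ^ 2 ∂P := ⟨_, rfl⟩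
    obtain ⟨f', hf'⟩ : ∃ f' : (Fin n → X) → ℂ, ∀ w, f' w = (starRingEnd ℂ) (f w) := ⟨_, fun _ => rfl⟩
    obtain ⟨K, hK⟩ : ∃ K : ℝ, ∀ M (w : Fin M → X), ‖lift f' M w‖ ≤ K := by
      refine ⟨∑ w, ‖f' w‖, fun M w => ?_⟩
      unfold lift
      split_ifs with h
      · exact Finset.single_le_sum (f := fun w => ‖f' w‖) (fun _ _ => norm_nonneg _) (Finset.mem_univ _)
      · rw [norm_zero]; exact Finset.sum_nonneg fun _ _ => norm_nonneg _
    have main : ∀ η > 0, ‖∫ ω, h ω * f (fun i => x i ω) ∂P‖ ≤ η * (A + 1) := by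
      intro η hη
      obtain ⟨k, hk⟩ := σ.tower_finite hc hm hΛ hC hcH f' (ε := η ^ 2) (by positivity)
      choose δ hδ hδb using fun l => σ.einf_approx l
      have hlim : Tendsto (fun j => η * (A + 1) + ∑ l ∈ Λ k, K * δ l (m j) * ∫ ω, ‖h ω‖ ∂P) atTop
          (𝓝 (η * (A + 1))) := by
        have : Tendsto (fun j => ∑ l ∈ Λ k, K * δ l (m j) * ∫ ω, ‖h ω‖ ∂P) atTop (𝓝 (∑ l ∈ Λ k, 0)) := by
          refine tendsto_finsetSum _ fun l _ => ?_
          have := (((hδ l).comp hm.tendsto_atTop).const_mul K).mul_const (∫ ω, ‖h ω‖ ∂P)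
          simpa using this
        simpa using this.const_add (η * (A + 1))
      refine ge_of_tendsto hlim ?_
      filter_upwards [eventually_ge_atTop k] with j hj
      obtain ⟨hnj, hj2⟩ := hk j hj
      have := σ.level_est hx hintg hsq (Λ k) (m j) (fun l => σ.fh (m j) (lift f' (m j)) l)
        (fun l c => σ.fh_le _ _ _ (hK (m j))) (fun l => δ l (m j)) (fun l w => hδb l w (m j))
        (fun l hl g => h0 l (Set.mem_iUnion.2 ⟨k, hl⟩) (m j) g) (lift f (m j)) hη (by
          refine le_trans (le_of_eq ?_) hj2
          congr 1
          refine Finset.sum_congr rfl fun w _ => ?_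
          have : (starRingEnd ℂ) (lift f (m j) w) = lift f' (m j) w := by
            simp [lift, hnj, hf']
          rw [this])
      rw [hA]
      have e : ∀ ω, lift f (m j) (fun i => x i ω) = f (fun i => x i ω) := fun ω => by
        simp only [lift, hnj, dite_true]; rfl
      simp_rw [e] at this
      exact this
    have hl : Tendsto (fun η : ℝ => η * (A + 1)) (𝓝[>] 0) (𝓝 0) := by
      have : Tendsto (fun η : ℝ => η * (A + 1)) (𝓝 0) (𝓝 (0 * (A+1))) := tendsto_id.mul_const _
      rw [zero_mul] at this
      exact this.mono_left nhdsWithin_le_nhds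
    have := ge_of_tendsto hl (eventually_mem_nhdsWithin.mono fun η hη => main η hη)
    exact norm_le_zero_iff.1 this

end Sys
end HT

namespace HT
open Topology

/-! ### Sub and quotient lattices -/

lemma fr_extend {G H : Type} [AddCommGroup G] [AddCommGroup H] (i : H →ₗ[ℤ] G)
    (hi : Function.Injective i) (φ : Fr H) : ∃ ξ : Fr G, ξ ∘ₗ i = φ := by
  have hb : Module.Baer ℤ ℝ := Module.Baer.of_divisible ℝ
  exact hb.extension_property i hi φ

lemma fr_finite (G : Type) [AddCommGroup G] [Module.Free ℤ G] [Module.Finite ℤ G] :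
    Module.Finite ℝ (Fr G) := by
  refine Module.Finite.of_surjective (Fintype.linearCombination ℝ (fun i : Ix G => (co i : Fr G))) ?_
  intro ξ
  refine ⟨fun i => ξ (bs G i), ?_⟩
  rw [Fintype.linearCombination_apply]
  exact (fr_eq ξ).symm

/-- the dual map of a homomorphism -/
def dm {G H : Type} [AddCommGroup G] [AddCommGroup H] (f : H →ₗ[ℤ] G) : Fr G →ₗ[ℝ] Fr H where
  toFun ξ := ξ ∘ₗ f
  map_add' _ _ := rfl
  map_smul' _ _ := rfl

@[simp] lemma dm_apply {G H : Type} [AddCommGroup G] [AddCommGroup H] (f : H →ₗ[ℤ] G) (ξ : Fr G) :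
  dm f ξ = ξ ∘ₗ f := rfl

lemma mkEx {H : Type} [AddCommGroup H] (R : H →ₗ[ℤ] H) (hb : Function.Bijective (dm R))
    (hl : ∀ S : Fr H →ₗ[ℝ] Fr H, (∀ ξ, S ξ ∘ₗ R = ξ) → (∀ ξ, S (ξ ∘ₗ R) = ξ) →
      ∀ (ξ : Fr H) (g : H), Tendsto (fun n => ((S ^ n) ξ) g) atTop (𝓝 0)) :
    ∃ e : Ex H, e.R = R := by
  let E := LinearEquiv.ofBijective (dm R) hb
  have h1 : ∀ ξ, (E.symm ξ) ∘ₗ R = ξ := fun ξ => E.apply_symm_apply ξ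
  have h2 : ∀ ξ, E.symm (ξ ∘ₗ R) = ξ := fun ξ => E.symm_apply_apply ξ
  exact ⟨{ R := R, S := E.symm.toLinearMap, hSR := fun ξ g => LinearMap.congr_fun (h1 ξ) g, hS := h2,
           lim := hl E.symm.toLinearMap h1 h2 }, rfl⟩

lemma Ex.S_eq {G : Type} [AddCommGroup G] (e : Ex G) {ξ η : Fr G} (h : η ∘ₗ e.R = ξ) : e.S ξ = η := by
  rw [← h, e.hS]

lemma Ex.S_pow_succ {G : Type} [AddCommGroup G] (e : Ex G) (n : ℕ) (ξ : Fr G) :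
    (e.S ^ (n + 1)) ξ = e.S ((e.S ^ n) ξ) := by rw [pow_succ']; rfl

theorem Ex.exists_sub {G H : Type} [AddCommGroup G] [AddCommGroup H] [Module.Free ℤ G] [Module.Finite ℤ G]
    (e : Ex G) (i : H →ₗ[ℤ] G) (hi : Function.Injective i) (R' : H →ₗ[ℤ] H)
    (hR : ∀ x, i (R' x) = e.R (i x)) :
    ∃ e' : Ex H, e'.R = R' ∧ ∀ ξ, e'.S (ξ ∘ₗ i) = (e.S ξ) ∘ₗ i := by
  have hsurj : Function.Surjective (dm i) := fun φ => fr_extend i hi φ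
  have hcomm : ∀ ξ : Fr G, (ξ ∘ₗ i) ∘ₗ R' = (e.A ξ) ∘ₗ i := fun ξ => by
    ext x; simp [Ex.A_apply, hR]
  have : Module.Finite ℝ (Fr G) := fr_finite G
  have : Module.Finite ℝ (Fr H) := Module.Finite.of_surjective _ hsurj
  have hs : Function.Surjective (dm R') := fun φ => by
    obtain ⟨ξ, rfl⟩ := hsurj φ
    refine ⟨(e.S ξ) ∘ₗ i, ?_⟩
    rw [dm_apply, hcomm, e.A_S]; rfl
  have hb : Function.Bijective (dm R') := ⟨LinearMap.injective_iff_surjective.2 hs, hs⟩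
  have key : ∀ S : Fr H →ₗ[ℝ] Fr H, (∀ ξ, S (ξ ∘ₗ R') = ξ) → ∀ ξ, S (ξ ∘ₗ i) = (e.S ξ) ∘ₗ i := by
    intro S h ξ
    have := h ((e.S ξ) ∘ₗ i)
    rw [hcomm, e.A_S] at this
    exact this
  obtain ⟨e', he'⟩ := mkEx R' hb (fun S h1 h2 φ x => by
    obtain ⟨ξ, rfl⟩ := hsurj φ
    have : ∀ n, (S ^ n) (ξ ∘ₗ i) = ((e.S ^ n) ξ) ∘ₗ i := by
      intro n
      induction n with
      | zero => rfl
      | succ n ih => rw [pow_succ', Module.End.mul_apply, ih, key S h2, e.S_pow_succ]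
    simp only [dm_apply, this]
    exact e.lim ξ (i x))
  exact ⟨e', he', key e'.S (fun ξ => by rw [← he', e'.hS])⟩

theorem Ex.exists_quot {G H : Type} [AddCommGroup G] [AddCommGroup H] [Module.Free ℤ G] [Module.Finite ℤ G]
    (e : Ex G) (p : G →ₗ[ℤ] H) (hp : Function.Surjective p) (R' : H →ₗ[ℤ] H)
    (hR : ∀ x, R' (p x) = p (e.R x)) :
    ∃ e' : Ex H, e'.R = R' ∧ ∀ ξ, e.S (ξ ∘ₗ p) = (e'.S ξ) ∘ₗ p := by
  have hinj : Function.Injective (dm p) := fun φ ψ h => by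
    ext x
    obtain ⟨g, rfl⟩ := hp x
    exact LinearMap.congr_fun h g
  have hcomm : ∀ ξ : Fr H, (ξ ∘ₗ R') ∘ₗ p = e.A (ξ ∘ₗ p) := fun ξ => by
    ext x; simp [Ex.A_apply, hR]
  have : Module.Finite ℝ (Fr G) := fr_finite G
  have : Module.Finite ℝ (Fr H) := Module.Finite.of_injective _ hinj
  have hi : Function.Injective (dm R') := fun φ ψ h => by
    apply hinj
    have : e.A (φ ∘ₗ p) = e.A (ψ ∘ₗ p) := by
      rw [← hcomm, ← hcomm]; exact congrArg (fun t => t ∘ₗ p) h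
    have := congrArg e.S this
    rwa [e.S_A, e.S_A] at this
  have hb : Function.Bijective (dm R') := ⟨hi, LinearMap.injective_iff_surjective.1 hi⟩
  have key : ∀ S : Fr H →ₗ[ℝ] Fr H, (∀ ξ, S ξ ∘ₗ R' = ξ) → ∀ ξ, e.S (ξ ∘ₗ p) = (S ξ) ∘ₗ p := by
    intro S h ξ
    apply e.S_eq
    have := hcomm (S ξ)
    rw [h] at this
    exact this.symm
  obtain ⟨e', he'⟩ := mkEx R' hb (fun S h1 h2 φ x => by
    obtain ⟨g, rfl⟩ := hp x
    have : ∀ n, ((S ^ n) φ) ∘ₗ p = (e.S ^ n) (φ ∘ₗ p) := by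
      intro n
      induction n with
      | zero => rfl
      | succ n ih => rw [pow_succ', Module.End.mul_apply, ← key S h1, ih, e.S_pow_succ]
    have h3 : ∀ n, ((S ^ n) φ) (p g) = ((e.S ^ n) (φ ∘ₗ p)) g := fun n => by rw [← this n]; rfl
    simp only [h3]
    exact e.lim _ _)
  exact ⟨e', he', key e'.S (fun ξ => by rw [← he']; exact e'.A_S ξ)⟩

lemma Ex.S_pow_sub {G H : Type} [AddCommGroup G] [AddCommGroup H] (e : Ex G) (e' : Ex H) (i : H →ₗ[ℤ] G)
    (h : ∀ ξ, e'.S (ξ ∘ₗ i) = (e.S ξ) ∘ₗ i) (n : ℕ) (ξ : Fr G) :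
    (e'.S ^ n) (ξ ∘ₗ i) = ((e.S ^ n) ξ) ∘ₗ i := by
  induction n with
  | zero => rfl
  | succ n ih => rw [e'.S_pow_succ, ih, h, e.S_pow_succ]

namespace Sys
variable {G H X Y C : Type} [AddCommGroup G] [AddCommGroup H] [Fintype X] [Fintype Y] [Fintype C]

/-- factorization of the mask -/
lemma ms_factor (σ : Sys G X C) (σ1 : Sys G Y C) (σ2 : Sys H X Y) (i : H →ₗ[ℤ] G)
    (hπ : ∀ x, σ1.π (σ2.π x) = σ.π x) (hβ : ∀ x, σ.β x = σ1.β (σ2.π x) + i (σ2.β x)) (c : C) (ξ : Fr G) :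
    σ.ms c ξ = ∑ y with σ1.π y = c, eC (ξ (σ1.β y)) * σ2.ms y (ξ ∘ₗ i) := by
  unfold ms
  rw [← Finset.sum_fiberwise_of_maps_to (s := Finset.univ.filter fun x => σ.π x = c)
    (t := Finset.univ.filter fun y => σ1.π y = c) (g := σ2.π)
    (by intro x hx; simp at hx ⊢; rw [hπ, hx])]
  refine Finset.sum_congr rfl fun y hy => ?_
  rw [Finset.mul_sum, Finset.filter_filter]
  have : (Finset.univ.filter fun x => σ.π x = c ∧ σ2.π x = y) = Finset.univ.filter fun x => σ2.π x = y := by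
    ext x
    simp only [Finset.mem_filter, Finset.mem_univ, true_and] at hy ⊢
    constructor
    · exact fun h => h.2
    · intro h; exact ⟨by rw [← hπ, h, hy], h⟩
  rw [this]
  refine Finset.sum_congr rfl fun x hx => ?_
  simp only [Finset.mem_filter, Finset.mem_univ, true_and] at hx
  rw [hβ, hx, map_add, eC_add]; rfl

lemma Rz_push (σ2 : Sys H X Y) {Ω : Type} [MeasurableSpace Ω] {P : Measure Ω} [IsProbabilityMeasure P]
    {x : ℕ → Ω → X} (hx : Rz P x) : Rz P (fun n ω => σ2.π (x n ω)) := by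
  constructor
  · intro n a
    have : {ω | σ2.π (x n ω) = a} = ⋃ b ∈ {b | σ2.π b = a}, {ω | x n ω = b} := by
      ext ω; simp
    rw [this]
    exact MeasurableSet.biUnion (Set.to_countable _) fun b _ => hx.meas n b
  · intro n y
    have hset : {ω | ∀ i : Fin n, σ2.π (x i ω) = y i} = ⋃ w ∈ σ2.cw y, {ω | ∀ i : Fin n, x i ω = w i} := by
      ext ω
      simp only [Set.mem_ofPred_eq, Set.mem_iUnion, mem_cw, exists_prop]
      constructor
      · intro h; exact ⟨fun i => x i ω, h, fun i => rfl⟩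
      · rintro ⟨w, h1, h2⟩ i; rw [h2, h1]
    rw [hset, measureReal_biUnion_finset]
    · simp_rw [hx.law]
      rw [Finset.sum_const, card_cw, σ2.card_X_pow, nsmul_eq_mul]
      have := pow_ne_zero n σ2.Npos.ne'
      push_cast
      rw [mul_inv, mul_comm, mul_assoc, inv_mul_cancel₀ this, mul_one]
    · intro w _ w' _ hne
      rw [Function.onFun, Set.disjoint_left]
      intro ω h h'
      exact hne (funext fun i => (h i).symm.trans (h' i))
    · intro w _; exact hx.meas_cyl n w

theorem compose [Module.Free ℤ G] [Module.Finite ℤ G] [Module.Free ℤ H] [Module.Finite ℤ H]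
    (σ : Sys G X C) (σ1 : Sys G Y C) (σ2 : Sys H X Y) (i : H →ₗ[ℤ] G) (hi : Function.Injective i)
    (hπ : ∀ x, σ1.π (σ2.π x) = σ.π x) (hβ : ∀ x, σ.β x = σ1.β (σ2.π x) + i (σ2.β x))
    (hS1 : σ1.S = σ.S) (hS2 : ∀ ξ, σ2.S (ξ ∘ₗ i) = (σ.S ξ) ∘ₗ i)
    {Λ1 : Set (Fr G)} {Λ2 : Set (Fr H)} (h1 : σ1.SpecSet Λ1) (h2 : σ2.SpecSet Λ2)
    (hv : ∀ l ∈ Λ1, l ∘ₗ i = 0) : ∃ Λ, σ.SpecSet Λ := by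
  choose ι hι using fr_extend i hi
  have hSp : ∀ n (ξ : Fr G), (σ2.S ^ n) (ξ ∘ₗ i) = ((σ.S ^ n) ξ) ∘ₗ i :=
    Ex.S_pow_sub σ.toEx σ2.toEx i hS2
  have hv' : ∀ l ∈ Λ1, ∀ n, ((σ.S ^ n) l) ∘ₗ i = 0 := fun l hl n => by
    rw [← hSp, hv l hl, map_zero]
  have hι' : ∀ l n, ((σ.S ^ n) (ι l)) ∘ₗ i = (σ2.S ^ n) l := fun l n => by rw [← hSp, hι]
  refine ⟨(fun p : Fr G × Fr H => p.1 + ι p.2) '' (Λ1 ×ˢ Λ2), (h1.1.prod h2.1).image _, ?_, ?_⟩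
  · rintro _ ⟨⟨a, b⟩, ⟨ha, hb⟩, rfl⟩ _ ⟨⟨a', b'⟩, ⟨ha', hb'⟩, rfl⟩ hne
    simp only at ha hb ha' hb' hne ⊢
    by_cases hbb : b = b'
    · subst hbb
      have hne' : a ≠ a' := fun h => hne (by rw [h])
      obtain ⟨n, hn⟩ := h1.2.1 a ha a' ha' hne'
      refine ⟨n, fun c => ?_⟩
      rw [add_sub_add_right_eq_sub, ms_factor σ σ1 σ2 i hπ hβ]
      have : ((σ.S ^ (n+1)) (a - a')) ∘ₗ i = 0 := by
        rw [map_sub, LinearMap.sub_comp, hv' a ha, hv' a' ha', sub_zero]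
      simp_rw [this, ms_zero]
      rw [← Finset.sum_mul]
      have := hn c
      rw [hS1] at this
      unfold ms at this
      rw [this, zero_mul]
    · obtain ⟨n, hn⟩ := h2.2.1 b hb b' hb' hbb
      refine ⟨n, fun c => ?_⟩
      rw [ms_factor σ σ1 σ2 i hπ hβ]
      have : ((σ.S ^ (n+1)) (a + ι b - (a' + ι b'))) ∘ₗ i = (σ2.S ^ (n+1)) (b - b') := by
        rw [map_sub, map_add, map_add, LinearMap.sub_comp, LinearMap.add_comp, LinearMap.add_comp,
          hv' a ha, hv' a' ha', hι', hι', map_sub, zero_add, zero_add]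
      simp_rw [this, hn, mul_zero]
      simp
  · intro Ω _ P _ x hx h hh h0
    have hintg : Integrable h P := hh.integrable (by norm_num)
    have hxy := Rz_push σ2 hx
    -- exponentials
    have e1 : ∀ l ∈ Λ1, ∀ w : ℕ → X, σ1.einf l (fun i => σ2.π (w i)) = σ.einf l w := by
      intro l hl w
      unfold einf
      congr 1
      refine tsum_congr fun n => ?_
      have := LinearMap.congr_fun (hv' l hl (n+1)) (σ2.β (w n))
      simp only [LinearMap.comp_apply, LinearMap.zero_apply] at this
      rw [hβ, map_add, this, add_zero, hS1]
    have e2 : ∀ l (w : ℕ → X), σ2.einf l w = σ.einf (ι l) w *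
        (starRingEnd ℂ) (σ1.einf (ι l) (fun i => σ2.π (w i))) := by
      intro l w
      unfold einf
      rw [← eC_sub, ← (σ.summable_einf (ι l) w).tsum_sub (σ1.summable_einf (ι l) (fun i => σ2.π (w i)))]
      congr 1
      refine tsum_congr fun n => ?_
      have := LinearMap.congr_fun (hι' l (n+1)) (σ2.β (w n))
      rw [hβ, map_add, hS1, add_sub_cancel_left, ← this]; rfl
    have e3 : ∀ (a : Fr G) (b : Fr G) (w : ℕ → X), σ.einf (a + b) w = σ.einf a w * σ.einf b w := by
      intro a b w
      unfold einf
      rw [← eC_add, ← (σ.summable_einf a w).tsum_add (σ.summable_einf b w)]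
      simp [map_add]
    refine h2.2.2 Ω P x hx h hh fun l2 hl2 n g => ?_
    -- apply the lower totality
    have hE : Measurable fun ω => (starRingEnd ℂ) (σ.einf (ι l2) fun i => x i ω) :=
      Complex.continuous_conj.measurable.comp (σ.einf_meas hx _)
    have hh2 : MemLp (fun ω => h ω * (starRingEnd ℂ) (σ.einf (ι l2) fun i => x i ω)) 2 P := by
      refine hh.of_le (hh.1.mul hE.aestronglyMeasurable) (Eventually.of_forall fun ω => ?_)
      rw [norm_mul, RCLike.norm_conj, norm_einf, mul_one]
    have low := h1.2.2 Ω P _ hxy _ hh2 (fun l1 hl1 n g => by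
      have := h0 (l1 + ι l2) ⟨(l1, l2), ⟨hl1, hl2⟩, rfl⟩ n g
      rw [← this]
      refine integral_congr_ae (Eventually.of_forall fun ω => ?_)
      simp only [e3, map_mul, hπ]
      rw [e1 l1 hl1 (fun i => x i ω)]
      ring)
    obtain ⟨δ, hδ, hδb⟩ := σ1.einf_approx (ι l2)
    obtain ⟨Kg, hKg⟩ : ∃ Kg, ∀ w, ‖g w‖ ≤ Kg := ⟨∑ w, ‖g w‖, fun w =>
      Finset.single_le_sum (f := fun w => ‖g w‖) (fun _ _ => norm_nonneg _) (Finset.mem_univ _)⟩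
    have hgm : Measurable fun ω => g (fun i => σ2.π (x i ω)) := hxy.measurable n g
    have goal' : ∫ ω, (h ω * (starRingEnd ℂ) (σ.einf (ι l2) fun i => x i ω)) *
        (σ1.einf (ι l2) (fun i => σ2.π (x i ω)) * g (fun i => σ2.π (x i ω))) ∂P = 0 := by
      refine int_zero_of_unif (K := Kg) (hh2.integrable (by norm_num)) ((σ1.einf_meas hxy _).mul hgm) ?_
        (v := fun j ω => σ1.ew (n + j) (ι l2) (fun i => σ2.π (x i ω)) * g (fun i => σ2.π (x i ω)))
        (δ := fun j => δ (n + j) * Kg) ?_ ?_ ?_ ?_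
      · intro ω
        rw [norm_mul, norm_einf, one_mul]; exact hKg _
      · intro j
        exact (hxy.measurable (n + j) (σ1.ew (n + j) (ι l2))).mul hgm
      · have := (hδ.comp (tendsto_add_atTop_nat n)).mul_const Kg
        rw [zero_mul] at this
        refine this.congr fun j => ?_
        simp [add_comm]
      · intro j ω
        rw [← sub_mul, norm_mul]
        exact mul_le_mul (hδb (fun i => σ2.π (x i ω)) (n + j)) (hKg _) (norm_nonneg _)
          ((norm_nonneg _).trans (hδb (fun i => σ2.π (x i ω)) (n + j)))
      · intro j
        have := low (n + j) (fun w => σ1.ew (n + j) (ι l2) w * g (fun i => w (Fin.castLE (by omega) i)))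
        exact this
    rw [← goal']
    refine integral_congr_ae (Eventually.of_forall fun ω => ?_)
    simp only
    rw [e2 l2 (fun i => x i ω), map_mul, Complex.conj_conj]
    ring

/-- pullback of spectra from a quotient -/
theorem pullback (σ : Sys G X C) (σQ : Sys H X C) (p : G →ₗ[ℤ] H)
    (hπ : σQ.π = σ.π) (hβ : ∀ x, σQ.β x = p (σ.β x)) (hS : ∀ η, σ.S (η ∘ₗ p) = (σQ.S η) ∘ₗ p)
    {Λ : Set (Fr H)} (h : σQ.SpecSet Λ) : σ.SpecSet ((fun η => η ∘ₗ p) '' Λ) := by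
  have hSp : ∀ n (η : Fr H), (σ.S ^ n) (η ∘ₗ p) = ((σQ.S ^ n) η) ∘ₗ p := by
    intro n η
    induction n with
    | zero => rfl
    | succ n ih => rw [σ.toEx.S_pow_succ, ih, hS, σQ.toEx.S_pow_succ]
  have hms : ∀ c (η : Fr H), σ.ms c (η ∘ₗ p) = σQ.ms c η := fun c η => by
    unfold ms; simp [hπ, hβ]
  refine ⟨h.1.image _, ?_, ?_⟩
  · rintro _ ⟨a, ha, rfl⟩ _ ⟨b, hb, rfl⟩ hne
    obtain ⟨n, hn⟩ := h.2.1 a ha b hb (fun hab => hne (by rw [hab]))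
    refine ⟨n, fun c => ?_⟩
    have : a ∘ₗ p - b ∘ₗ p = (a - b) ∘ₗ p := (LinearMap.sub_comp _ _ _).symm
    simp only [this, hSp, hms, hn]
  · intro Ω _ P _ x hx f hf h0
    refine h.2.2 Ω P x hx f hf fun l hl n g => ?_
    rw [← h0 (l ∘ₗ p) ⟨l, hl, rfl⟩ n g, hπ]
    have : ∀ w, σ.einf (l ∘ₗ p) w = σQ.einf l w := fun w => by
      unfold einf; simp [hSp, hβ]
    simp_rw [this]

/-- trivial system -/
lemma spec_trivial (σ : Sys G C C) (hπ : ∀ c, σ.π c = c) : σ.SpecSet {0} := by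
  refine ⟨Set.countable_singleton _, ?_, ?_⟩
  · intro l hl l' hl' hne
    exact absurd (hl.trans hl'.symm) hne
  · intro Ω _ P _ x hx f hf h0 n g
    rw [← h0 0 rfl n g]
    simp [einf, hπ]

/-- normalization: passing to the lattice generated by differences -/
theorem normalize [Nonempty C] [Module.Free ℤ G] [Module.Finite ℤ G] [Module.Free ℤ H] [Module.Finite ℤ H]
    (σ : Sys G X C) (hH : σ.Had) (e' : Ex H) (i : H →ₗ[ℤ] G) (hi : Function.Injective i)
    (hS : ∀ ξ, e'.S (ξ ∘ₗ i) = (σ.S ξ) ∘ₗ i) (s : C → X) (hs : ∀ c, σ.π (s c) = c) (β' : X → H)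
    (hβ : ∀ x, σ.β x = σ.β (s (σ.π x)) + i (β' x)) :
    ∃ σ' : Sys H X C, σ'.toEx = e' ∧ σ'.π = σ.π ∧ σ'.β = β' ∧ σ'.Had ∧
      ((∃ Λ, σ'.SpecSet Λ) → ∃ Λ, σ.SpecSet Λ) := by
  let σ1 : Sys G C C := { toEx := σ.toEx, π := id, β := fun c => σ.β (s c), N := 1, hN := one_pos,
                          fib := fun c => Finset.card_eq_one.2 ⟨c, by ext; simp⟩ }
  let σ' : Sys H X C := { toEx := e', π := σ.π, β := β', N := σ.N, hN := σ.hN, fib := σ.fib }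
  have hf := ms_factor σ σ1 σ' i (fun _ => rfl) hβ
  have hf' : ∀ c ξ, σ.ms c ξ = eC (ξ (σ1.β c)) * σ'.ms c (ξ ∘ₗ i) := by
    intro c ξ
    rw [hf, Finset.sum_filter, Finset.sum_eq_single c]
    · simp [σ1]
    · intro b _ hb; rw [if_neg]; exact hb
    · simp
  have hz : ∀ c ξ, σ.ms c ξ = 0 → σ'.ms c (ξ ∘ₗ i) = 0 := fun c ξ h => by
    rw [hf'] at h
    exact (mul_eq_zero.1 h).resolve_left (eC_ne_zero _)
  refine ⟨σ', rfl, rfl, rfl, ?_, ?_⟩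
  · obtain ⟨L, h1, h2, h3⟩ := hH
    have hz2 : ∀ l ∈ L, ∀ l' ∈ L, l ≠ l' → ∀ c, σ'.ms c (σ'.S (l ∘ₗ i - l' ∘ₗ i)) = 0 := by
      intro l hl l' hl' hne c
      have := hz c _ (h3 l hl l' hl' hne c)
      rw [← hS, LinearMap.sub_comp] at this
      exact this
    refine ⟨L.image (fun l => l ∘ₗ i), ?_, ?_, ?_⟩
    · intro l hl
      obtain ⟨k, hk, rfl⟩ := Finset.mem_image.1 hl
      exact (h1 k hk).comp i
    · rw [Finset.card_image_of_injOn, h2]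
      intro l hl l' hl' heq
      by_contra hne
      have := hz2 l hl l' hl' hne (Classical.arbitrary C)
      simp only at heq
      rw [heq, sub_self, map_zero] at this
      exact σ'.ms_zero_ne _ this
    · intro l hl l' hl' hne c
      obtain ⟨k, hk, rfl⟩ := Finset.mem_image.1 hl
      obtain ⟨k', hk', rfl⟩ := Finset.mem_image.1 hl'
      exact hz2 k hk k' hk' (fun h => hne (by rw [h])) c
  · rintro ⟨Λ, hΛ⟩
    exact compose σ σ1 σ' i hi (fun _ => rfl) hβ rfl hS (σ1.spec_trivial fun _ => rfl) hΛ
      (by intro l hl; rw [hl]; rfl)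

end Sys
end HT

namespace HT
open Topology

/-! ### Powers of systems -/

/-- powers of an expanding endomorphism -/
def Ex.npow {G : Type} [AddCommGroup G] (e : Ex G) (p : ℕ) (hp : 0 < p) : Ex G where
  R := e.R ^ p
  S := e.S ^ p
  hSR := fun ξ g => e.S_pow_R_pow p ξ g
  hS := fun ξ => by
    have : ξ ∘ₗ (e.R ^ p) = (e.A ^ p) ξ := by
      ext g; rw [e.A_pow_apply]; rfl
    rw [this, e.S_pow_A_pow]
  lim := fun ξ g => by
    have := (e.lim ξ g).comp (tendsto_id.nsmul_atTop hp)
    refine this.congr fun n => ?_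
    simp [← pow_mul]

namespace Sys
variable {G X C : Type} [AddCommGroup G] [Fintype X] [Fintype C] (σ : Sys G X C)

/-- the `p`-th power of a system -/
def npow (p : ℕ) (hp : 0 < p) : Sys G (Fin p → X) (Fin p → C) where
  toEx := σ.toEx.npow p hp
  π := fun w i => σ.π (w i)
  β := fun w => ∑ i : Fin p, (σ.R ^ (p - 1 - i.1)) (σ.β (w i))
  N := σ.N ^ p
  hN := pow_pos σ.hN p
  fib := fun c => by
    rw [← σ.card_cw c]
    congr 1
    ext w
    simp [mem_cw, funext_iff]

lemma npow_S (p : ℕ) (hp : 0 < p) : (σ.npow p hp).S = σ.S ^ p := rfl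

lemma npow_eval (p : ℕ) (hp : 0 < p) (ξ : Fr G) (w : Fin p → X) :
    ((σ.S ^ p) ξ) ((σ.npow p hp).β w) = ∑ i : Fin p, ((σ.S ^ (i.1 + 1)) ξ) (σ.β (w i)) := by
  change ((σ.S ^ p) ξ) (∑ i : Fin p, (σ.R ^ (p - 1 - i.1)) (σ.β (w i))) = _
  rw [map_sum]
  refine Finset.sum_congr rfl fun i _ => ?_
  have hi : p = (p - 1 - i.1) + (i.1 + 1) := by have := i.2; omega
  have : (σ.S ^ p) ξ = (σ.S ^ (p - 1 - i.1)) ((σ.S ^ (i.1 + 1)) ξ) := by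
    rw [← Module.End.mul_apply, ← pow_add, ← hi]
  rw [this, σ.S_pow_R_pow]

lemma npow_ms (p : ℕ) (hp : 0 < p) (ξ : Fr G) (c : Fin p → C) :
    (σ.npow p hp).ms c ((σ.S ^ p) ξ) = ∏ i : Fin p, σ.ms (c i) ((σ.S ^ (i.1 + 1)) ξ) := by
  rw [← sum_ew]
  unfold ms ew
  refine Finset.sum_congr (by ext w; simp [mem_cw, npow, funext_iff]) fun w _ => ?_
  rw [npow_eval]

lemma npow_ms_zero [Nonempty C] (p : ℕ) (hp : 0 < p) (ξ : Fr G) :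
    (∀ c, (σ.npow p hp).ms c ((σ.S ^ p) ξ) = 0) ↔ ∃ i < p, ∀ c, σ.ms c ((σ.S ^ (i + 1)) ξ) = 0 := by
  constructor
  · intro h
    by_contra! hcon
    choose c hc using fun i : Fin p => hcon i.1 i.2
    have := h c
    rw [npow_ms, Finset.prod_eq_zero_iff] at this
    obtain ⟨i, _, hi⟩ := this
    exact hc i hi
  · rintro ⟨i, hi, h⟩ c
    rw [npow_ms]
    exact Finset.prod_eq_zero (Finset.mem_univ (⟨i, hi⟩ : Fin p)) (h _)

lemma npow_had [Nonempty C] (p : ℕ) (hp : 0 < p) (hH : σ.Had) : (σ.npow p hp).Had := by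
  obtain ⟨Λ, -, h2, h3⟩ := Comp.ext_many hH σ.comp_zero p
  rw [zero_add] at h2
  refine ⟨Λ, ?_, h2.1, ?_⟩
  · intro l hl
    rcases h3 l hl with h | ⟨l0, h0, h⟩
    · exact h
    · rw [Finset.mem_singleton] at h0
      rwa [h0, sub_zero] at h
  · intro l hl l' hl' hne
    exact (σ.npow_ms_zero p hp _).2 (h2.2 l hl l' hl' hne)

lemma npow_ew (p : ℕ) (hp : 0 < p) (l : Fr G) (M : ℕ) (w : ℕ → X) :
    (σ.npow p hp).ew M l (fun n i => w (i.1 + p * n.1)) = σ.ew (M * p) l (fun i => w i) := by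
  unfold ew
  congr 1
  rw [← finProdFinEquiv.sum_comp, Fintype.sum_prod_type]
  refine Finset.sum_congr rfl fun n _ => ?_
  have : ((σ.npow p hp).S ^ (n.1 + 1)) l = (σ.S ^ p) ((σ.S ^ (p * n.1)) l) := by
    rw [npow_S, pow_succ', Module.End.mul_apply, ← pow_mul]
  rw [this, npow_eval]
  refine Finset.sum_congr rfl fun i _ => ?_
  rw [← Module.End.mul_apply, ← pow_add]
  simp only [finProdFinEquiv_apply_val]
  have e : i.1 + 1 + p * n.1 = i.1 + p * n.1 + 1 := by ring
  rw [e]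

lemma npow_einf [Module.Free ℤ G] [Module.Finite ℤ G] (p : ℕ) (hp : 0 < p) (l : Fr G) (w : ℕ → X) :
    (σ.npow p hp).einf l (fun n i => w (i.1 + p * n)) = σ.einf l w := by
  refine tendsto_nhds_unique ((σ.npow p hp).einf_tendsto l (fun n i => w (i.1 + p * n))) ?_
  have h1 := (σ.einf_tendsto l w).comp (tendsto_id.atTop_mul_const' hp)
  refine h1.congr fun M => ?_
  exact (σ.npow_ew p hp l M w).symm

lemma Rz_block (p : ℕ) (hp : 0 < p) {Ω : Type} [MeasurableSpace Ω] {P : Measure Ω}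
    {x : ℕ → Ω → X} (hx : Rz P x) :
    Rz P (fun n ω => (fun i => x (i.1 + p * n) ω : Fin p → X)) := by
  constructor
  · intro n a
    have : {ω | (fun i => x (i.1 + p * n) ω : Fin p → X) = a} = ⋂ i : Fin p, {ω | x (i.1 + p * n) ω = a i} := by
      ext ω; simp [funext_iff]
    rw [this]
    exact MeasurableSet.iInter fun i => hx.meas _ _
  · intro n w
    have := hx.law (n * p) (fun k => w (finProdFinEquiv.symm k).1 (finProdFinEquiv.symm k).2)
    have hset : {ω | ∀ i : Fin n, (fun j => x (j.1 + p * i.1) ω : Fin p → X) = w i} =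
        {ω | ∀ k : Fin (n * p), x k ω = w (finProdFinEquiv.symm k).1 (finProdFinEquiv.symm k).2} := by
      ext ω
      simp only [Set.mem_ofPred_eq, funext_iff]
      constructor
      · intro h k
        obtain ⟨⟨i, j⟩, rfl⟩ := finProdFinEquiv.surjective k
        rw [Equiv.symm_apply_apply]
        exact h i j
      · intro h i j
        have := h (finProdFinEquiv (i, j))
        rw [Equiv.symm_apply_apply] at this
        exact this
    rw [hset, this]
    simp [← pow_mul, mul_comm]

theorem npow_spec [Nonempty C] [Module.Free ℤ G] [Module.Finite ℤ G] (p : ℕ) (hp : 0 < p) {Λ : Set (Fr G)}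
    (h : (σ.npow p hp).SpecSet Λ) : σ.SpecSet Λ := by
  refine ⟨h.1, ?_, ?_⟩
  · intro l hl l' hl' hne
    obtain ⟨n, hn⟩ := h.2.1 l hl l' hl' hne
    have : ((σ.npow p hp).S ^ (n + 1)) (l - l') = (σ.S ^ p) ((σ.S ^ (p * n)) (l - l')) := by
      rw [npow_S, pow_succ', Module.End.mul_apply, ← pow_mul]
    rw [this] at hn
    obtain ⟨i, _, hi⟩ := (σ.npow_ms_zero p hp _).1 hn
    refine ⟨i + p * n, fun c => ?_⟩
    have := hi c
    rw [← Module.End.mul_apply, ← pow_add] at this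
    have e : i + p * n + 1 = i + 1 + p * n := by ring
    rw [e]; exact this
  · intro Ω _ P _ x hx f hf h0 n g
    have key := h.2.2 Ω P _ (Rz_block p hp hx) f hf (fun l hl m k => by
      rw [← h0 l hl (m * p) (fun c => k (fun i j => c (finProdFinEquiv (i, j))))]
      refine integral_congr_ae (Eventually.of_forall fun ω => ?_)
      simp only
      rw [σ.npow_einf p hp l (fun i => x i ω)]
      rfl)
    have := key n (fun w => g (fun k => w ⟨k.1 / p, lt_of_le_of_lt (Nat.div_le_self _ _) k.2⟩
      ⟨k.1 % p, Nat.mod_lt _ hp⟩))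
    rw [← this]
    refine integral_congr_ae (Eventually.of_forall fun ω => ?_)
    simp only [Nat.mod_add_div]

end Sys
end HT

namespace HT
open Topology

/-! ### The Zariski topology on the space of functionals -/

section Zariski
variable {G : Type} [AddCommGroup G]

/-- the character attached to a functional -/
def chr (ξ : Fr G) : Multiplicative G →* ℂ where
  toFun g := eC (ξ g.toAdd)
  map_one' := by simp
  map_mul' := fun a b => by simp [eC_add]

/-- evaluation of trigonometric polynomials -/
def ev (ξ : Fr G) : AddMonoidAlgebra ℂ G →+* ℂ := (AddMonoidAlgebra.lift ℂ ℂ G (chr ξ)).toRingHom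

lemma ev_single (ξ : Fr G) (g : G) (a : ℂ) : ev ξ (AddMonoidAlgebra.single g a) = a * eC (ξ g) := by
  simp [ev, chr, AddMonoidAlgebra.lift_single]

lemma ev_eq (f : AddMonoidAlgebra ℂ G) :
    ∃ (s : Finset G) (a : G → ℂ), ∀ ξ : Fr G, ev ξ f = ∑ g ∈ s, a g * eC (ξ g) := by
  induction f using AddMonoidAlgebra.induction_linear with
  | zero => exact ⟨∅, 0, by simp⟩
  | add f g hf hg =>
    obtain ⟨s, a, h⟩ := hf
    obtain ⟨t, b, h'⟩ := hg
    refine ⟨s ∪ t, fun x => (if x ∈ s then a x else 0) + (if x ∈ t then b x else 0), fun ξ => ?_⟩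
    rw [map_add, h, h']
    simp only [add_mul, Finset.sum_add_distrib, ite_mul, zero_mul]
    rw [← Finset.sum_filter, ← Finset.sum_filter]
    congr 1 <;> · refine Finset.sum_congr ?_ fun _ _ => rfl
                  ext; simp
  | single g a => exact ⟨{g}, fun _ => a, by simp [ev_single]⟩

/-- the kernel prime -/
def kerP (ξ : Fr G) : PrimeSpectrum (AddMonoidAlgebra ℂ G) := ⟨RingHom.ker (ev ξ), RingHom.ker_isPrime _⟩

/-- Zariski topology -/
@[reducible] def zT (G : Type) [AddCommGroup G] : TopologicalSpace (Fr G) := TopologicalSpace.induced kerP inferInstance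

attribute [local instance] zT

lemma isClosed_tp {ι : Type} (s : Finset ι) (a : ι → ℂ) (g : ι → G) :
    IsClosed {ξ : Fr G | ∑ i ∈ s, a i * eC (ξ (g i)) = 0} := by
  have : IsClosed (kerP ⁻¹' PrimeSpectrum.zeroLocus {∑ i ∈ s, AddMonoidAlgebra.single (g i) (a i)} :
      Set (Fr G)) := (PrimeSpectrum.isClosed_zeroLocus _).preimage continuous_induced_dom
  convert this using 1
  ext ξ
  simp [kerP, PrimeSpectrum.mem_zeroLocus, RingHom.mem_ker, map_sum, ev_single]

lemma sep_closed {V : Set (Fr G)} (hV : IsClosed V) {ξ : Fr G} (h : ξ ∉ V) :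
    ∃ (f : AddMonoidAlgebra ℂ G), (∀ v ∈ V, ev v f = 0) ∧ ev ξ f ≠ 0 := by
  rw [isClosed_induced_iff] at hV
  obtain ⟨t, ht, rfl⟩ := hV
  obtain ⟨I, rfl⟩ := (PrimeSpectrum.isClosed_iff_zeroLocus _).1 ht
  simp only [Set.mem_preimage, PrimeSpectrum.mem_zeroLocus, Set.not_subset] at h
  obtain ⟨f, hf, h⟩ := h
  refine ⟨f, fun v hv => ?_, h⟩
  exact (hv : I ⊆ _) hf

lemma sep_tp {V : Set (Fr G)} (hV : IsClosed V) {ξ : Fr G} (h : ξ ∉ V) :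
    ∃ (s : Finset G) (a : G → ℂ), (∀ v ∈ V, ∑ g ∈ s, a g * eC (v g) = 0) ∧
      ∑ g ∈ s, a g * eC (ξ g) ≠ 0 := by
  obtain ⟨f, h1, h2⟩ := sep_closed hV h
  obtain ⟨s, a, h⟩ := ev_eq f
  exact ⟨s, a, fun v hv => by rw [← h, h1 v hv], by rw [← h]; exact h2⟩

lemma closed_of_sep {V : Set (Fr G)} (h : ∀ ξ ∉ V, ∃ K, IsClosed K ∧ V ⊆ K ∧ ξ ∉ K) : IsClosed V := by
  have : V = closure V := by
    refine subset_closure.antisymm fun ξ hξ => ?_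
    by_contra hn
    obtain ⟨K, h1, h2, h3⟩ := h ξ hn
    exact h3 (closure_minimal h2 h1 hξ)
  rw [this]; exact isClosed_closure

lemma closed_add_int {V : Set (Fr G)} (hV : IsClosed V) {ξ k : Fr G} (h : ξ ∈ V) (hk : IsInt k) :
    ξ + k ∈ V := by
  by_contra hn
  obtain ⟨s, a, h1, h2⟩ := sep_tp hV hn
  apply h2
  rw [← h1 _ h]
  refine Finset.sum_congr rfl fun g _ => ?_
  rw [LinearMap.add_apply, eC_add, hk.eC, mul_one]

lemma isClosed_int : IsClosed {ξ : Fr G | IsInt ξ} := by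
  have : {ξ : Fr G | IsInt ξ} = ⋂ g : G, {ξ | ∑ i : Fin 2, (![1, -1] i : ℂ) * eC (ξ ((![g, 0] : Fin 2 → G) i)) = 0} := by
    ext ξ
    simp only [Set.mem_ofPred_eq, Set.mem_iInter, IsInt]
    refine forall_congr' fun g => ?_
    rw [← eC_eq_one_iff]
    simp [Fin.sum_univ_two, ← sub_eq_add_neg, sub_eq_zero]
  rw [this]
  exact isClosed_iInter fun g => isClosed_tp _ _ _

lemma cont_add (t : Fr G) : Continuous (fun ξ : Fr G => ξ + t) := by
  rw [continuous_iff_isClosed]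
  intro V hV
  refine closed_of_sep fun ξ hξ => ?_
  obtain ⟨s, a, h1, h2⟩ := sep_tp hV (ξ := ξ + t) hξ
  refine ⟨_, isClosed_tp s (fun g => a g * eC (t g)) id, ?_, ?_⟩
  · intro v hv
    rw [← h1 _ hv]
    refine Finset.sum_congr rfl fun g _ => ?_
    rw [LinearMap.add_apply, eC_add, id]; ring
  · intro hv
    apply h2
    rw [← hv]
    refine Finset.sum_congr rfl fun g _ => ?_
    rw [LinearMap.add_apply, eC_add, id]; ring

lemma cont_A (e : Ex G) : Continuous (fun ξ : Fr G => e.A ξ) := by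
  rw [continuous_iff_isClosed]
  intro V hV
  refine closed_of_sep fun ξ hξ => ?_
  obtain ⟨s, a, h1, h2⟩ := sep_tp hV (ξ := e.A ξ) hξ
  refine ⟨_, isClosed_tp s a (fun g => e.R g), fun v hv => ?_, fun hv => ?_⟩
  · have := h1 _ hv
    simp only [Ex.A_apply] at this
    exact this
  · simp only [Ex.A_apply] at h2
    exact h2 hv

lemma indep (K : AddSubgroup (Fr G)) {ι : Type} (s : Finset ι) (a : ι → ℂ) (g : ι → G)
    (h : ∀ t ∈ K, ∑ i ∈ s, a i * eC (t (g i)) = 0) (g0 : G) :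
    ∑ i ∈ s with (∀ t ∈ K, ∃ n : ℤ, t (g i - g0) = n), a i = 0 := by
  let χ : G → (Multiplicative K →* ℂ) := fun x =>
    { toFun := fun t => eC (t.toAdd.1 x)
      map_one' := by simp
      map_mul' := fun t t' => by simp [eC_add] }
  have hχ : ∀ x y, χ x = χ y ↔ ∀ t ∈ K, ∃ n : ℤ, t (x - y) = n := by
    intro x y
    constructor
    · intro hxy t ht
      have := DFunLike.congr_fun hxy (Multiplicative.ofAdd ⟨t, ht⟩)
      simp only [χ, MonoidHom.coe_mk, OneHom.coe_mk, toAdd_ofAdd] at this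
      rw [← eC_eq_one_iff, map_sub, eC_sub, this, eC_mul_conj]
    · intro hxy
      refine MonoidHom.ext fun t => ?_
      have := (eC_eq_one_iff _).2 (hxy _ t.toAdd.2)
      simp only [χ, MonoidHom.coe_mk, OneHom.coe_mk]
      have e : (t.toAdd.1 x) = t.toAdd.1 (x - y) + t.toAdd.1 y := by rw [← map_add]; simp
      rw [e, eC_add, this, one_mul]
  have hli := linearIndependent_iff'.1 (linearIndependent_monoidHom (Multiplicative K) ℂ)
    (s.image fun i => χ (g i)) (fun φ => ∑ i ∈ s with χ (g i) = φ, a i) ?_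
  · by_cases hm : χ g0 ∈ s.image fun i => χ (g i)
    · have := hli _ hm
      simpa only [hχ] using this
    · rw [Finset.filter_false_of_mem, Finset.sum_empty]
      intro i hi hh
      exact hm (Finset.mem_image.2 ⟨i, hi, (hχ _ _).2 hh⟩)
  · funext t
    have := h _ t.toAdd.2
    rw [Finset.sum_apply, Pi.zero_apply, ← this]
    rw [← Finset.sum_fiberwise_of_maps_to (g := fun i => χ (g i)) (fun i hi => Finset.mem_image.2 ⟨i, hi, rfl⟩)]
    refine Finset.sum_congr rfl fun φ _ => ?_
    rw [Pi.smul_apply, smul_eq_mul, Finset.sum_mul]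
    refine Finset.sum_congr rfl fun i hi => ?_
    rw [← (Finset.mem_filter.1 hi).2]
    rfl

variable [Module.Free ℤ G] [Module.Finite ℤ G]

lemma noeth : TopologicalSpace.NoetherianSpace (Fr G) := by
  have : AddMonoid.FG G := AddGroup.fg_iff_addMonoid_fg.1 (Module.Finite.iff_addGroup_fg.1 inferInstance)
  have : IsNoetherianRing (AddMonoidAlgebra ℂ G) :=
    Algebra.FiniteType.isNoetherianRing ℂ _
  exact Topology.IsInducing.noetherianSpace (i := kerP) ⟨rfl⟩

lemma int_all_zero {g : G} (h : ∀ t : Fr G, ∃ n : ℤ, t g = n) : g = 0 := by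
  refine sep fun k _ => ?_
  rw [map_zero]
  by_contra hne
  obtain ⟨n, hn⟩ := h ((1 / (2 * k g)) • k)
  rw [LinearMap.smul_apply, smul_eq_mul] at hn
  have : (1 / (2 * k g)) * k g = 1/2 := by field_simp
  rw [this] at hn
  have h2 : (1:ℝ) = ((2 * n : ℤ) : ℝ) := by push_cast; linarith
  have h3 : (1:ℤ) = 2 * n := by exact_mod_cast h2
  omega

lemma ev_zero {f : AddMonoidAlgebra ℂ G} (h : ∀ ξ, ev ξ f = 0) : f = 0 := by
  have key : ∀ ξ, ev ξ f = ∑ g ∈ f.coeff.support, f.coeff g * eC (ξ g) := by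
    intro ξ
    conv_lhs => rw [← AddMonoidAlgebra.sum_coeff_single f]
    simp only [Finsupp.sum]
    rw [map_sum]
    simp [ev_single]
  ext g0
  have := indep ⊤ f.coeff.support (fun g => f.coeff g) id (fun t _ => by rw [← h t, key]; rfl) g0
  have h2 : ∀ g, (∀ t ∈ (⊤ : AddSubgroup (Fr G)), ∃ n : ℤ, t (id g - g0) = n) ↔ g = g0 := by
    intro g
    constructor
    · intro h; exact sub_eq_zero.1 (int_all_zero fun t => h t trivial)
    · rintro rfl t _; exact ⟨0, by simp⟩
  simp only [h2] at this
  by_contra hne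
  apply hne
  rw [Finset.sum_eq_single_of_mem g0] at this
  · simpa using this
  · simpa using hne
  · intro g hg hgg
    exact absurd (Finset.mem_filter.1 hg).2 hgg

lemma irred_univ : IsIrreducible (Set.univ : Set (Fr G)) := by
  refine ⟨⟨0, trivial⟩, ?_⟩
  rw [isPreirreducible_iff_isClosed_union_isClosed]
  intro Z1 Z2 h1 h2 hu
  by_contra! hcon
  simp only [Set.univ_subset_iff, Set.ne_univ_iff_exists_notMem] at hcon
  obtain ⟨⟨a, ha⟩, ⟨b, hb⟩⟩ := hcon
  obtain ⟨f, hf, hf'⟩ := sep_closed h1 ha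
  obtain ⟨g, hg, hg'⟩ := sep_closed h2 hb
  have : AddMonoid.FG G := AddGroup.fg_iff_addMonoid_fg.1 (Module.Finite.iff_addGroup_fg.1 inferInstance)
  have : IsAddTorsionFree G := Module.isTorsionFree_int_iff_isAddTorsionFree.1 inferInstance
  have h0 : f * g = 0 := by
    refine ev_zero fun ξ => ?_
    rw [map_mul]
    rcases hu (Set.mem_univ ξ) with h | h
    · rw [hf _ h, zero_mul]
    · rw [hg _ h, mul_zero]
  rcases mul_eq_zero.1 h0 with h | h
  · exact hf' (by rw [h, map_zero])
  · exact hg' (by rw [h, map_zero])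

end Zariski
end HT

namespace HT
open Topology

/-! ### Closed maps -/

section Closed
variable {G : Type} [AddCommGroup G]
attribute [local instance] zT

namespace Ex
variable (e : Ex G)

/-- the group `S Γ` -/
def SG : AddSubgroup (Fr G) where
  carrier := {t | IsInt (e.A t)}
  zero_mem' := by show IsInt (e.A 0); rw [map_zero]; exact IsInt.zero
  add_mem' := fun {a b} ha hb => by
    show IsInt (e.A (a + b)); rw [map_add]; exact IsInt.add ha hb
  neg_mem' := fun {a} ha => by
    show IsInt (e.A (-a)); rw [map_neg]; exact IsInt.neg ha

lemma mem_SG {t : Fr G} : t ∈ e.SG ↔ IsInt (e.A t) := Iff.rfl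

lemma SG_of_int {t : Fr G} (h : IsInt t) : t ∈ e.SG := e.isInt_A h

lemma SG_S {k : Fr G} (h : IsInt k) : e.S k ∈ e.SG := by rw [mem_SG, A_S]; exact h

variable [Module.Free ℤ G] [Module.Finite ℤ G]

lemma SG_perp {g : G} (h : ∀ t ∈ e.SG, ∃ n : ℤ, t g = n) : ∃ x, g = e.R x := by
  choose n hn using fun i : Ix G => h (e.S (co i)) (e.SG_S (co_isInt i))
  refine ⟨∑ i, n i • bs G i, sep fun k _ => ?_⟩
  have h1 : k g = e.S (e.A k) g := by rw [S_A]
  rw [h1, ← e.A_apply k]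
  conv_lhs => rw [fr_eq (e.A k)]
  rw [map_sum, map_sum, LinearMap.sum_apply]
  refine Finset.sum_congr rfl fun i _ => ?_
  rw [map_smul, LinearMap.smul_apply, hn, map_zsmul]
  simp [mul_comm]

lemma R_inj : Function.Injective e.R := by
  intro x y h
  refine sep fun k _ => ?_
  rw [← e.hSR k x, ← e.hSR k y, h]

lemma exists_index : ∃ m : ℕ, 0 < m ∧ ∀ g, ∃ x, m • g = e.R x := by
  have : Finite (G ⧸ LinearMap.range e.R) :=
    Submodule.finiteQuotientOfFreeOfRankEq _ (LinearMap.finrank_range_of_inj e.R_inj)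
  refine ⟨Nat.card (G ⧸ LinearMap.range e.R), Nat.card_pos, fun g => ?_⟩
  have h1 : Nat.card (G ⧸ LinearMap.range e.R) • (Submodule.Quotient.mk g : G ⧸ LinearMap.range e.R) = 0 :=
    card_nsmul_eq_zero'
  rw [← Submodule.Quotient.mk_smul, Submodule.Quotient.mk_eq_zero] at h1
  obtain ⟨x, hx⟩ := h1
  exact ⟨x, hx.symm⟩

lemma fin_SG : ∃ F : Finset (Fr G), (∀ f ∈ F, f ∈ e.SG) ∧ ∀ t ∈ e.SG, ∃ f ∈ F, IsInt (t - f) := by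
  obtain ⟨m, hm, h⟩ := e.exists_index
  have hm' : (m : ℝ) ≠ 0 := by positivity
  let F0 : Finset (Fr G) := Finset.univ.image fun u : Ix G → Fin m => ∑ i, ((u i : ℕ) / m : ℝ) • (co i : Fr G)
  refine ⟨F0.filter (· ∈ e.SG), fun f hf => (Finset.mem_filter.1 hf).2, fun t ht => ?_⟩
  have h1 : ∀ g, ∃ n : ℤ, t g = n / m := by
    intro g
    obtain ⟨x, hx⟩ := h g
    obtain ⟨n, hn⟩ := ht x
    refine ⟨n, ?_⟩
    rw [A_apply, ← hx, map_nsmul, nsmul_eq_mul] at hn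
    field_simp
    rw [← hn]; ring
  choose n hn using h1
  have hmod : ∀ i : Ix G, (n (bs G i) % m).toNat < m := by
    intro i
    have := Int.emod_lt_of_pos (n (bs G i)) (by exact_mod_cast hm : (0:ℤ) < m)
    have := Int.emod_nonneg (n (bs G i)) (by positivity : (m:ℤ) ≠ 0)
    omega
  obtain ⟨f, hf⟩ : ∃ f : Fr G, f = ∑ i, ((((n (bs G i) % m).toNat : ℕ) : ℝ) / m) • (co i : Fr G) := ⟨_, rfl⟩
  have hintg : IsInt (t - f) := by
    intro g
    refine ⟨∑ i, (n (bs G i) / m) * (bs G).repr g i, ?_⟩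
    rw [LinearMap.sub_apply, fr_apply t, hf, LinearMap.sum_apply, ← Finset.sum_sub_distrib]
    push_cast
    refine Finset.sum_congr rfl fun i _ => ?_
    rw [LinearMap.smul_apply, smul_eq_mul, ← sub_mul, co_apply, hn]
    congr 1
    have h2 := Int.emod_nonneg (n (bs G i)) (by positivity : (m:ℤ) ≠ 0)
    have h3 : (((n (bs G i) % m).toNat : ℕ) : ℝ) = ((n (bs G i) % m : ℤ) : ℝ) := by
      exact_mod_cast congrArg (Int.cast : ℤ → ℝ) (Int.toNat_of_nonneg h2)
    have h4 := Int.emod_add_mul_ediv (n (bs G i)) m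
    have h5 : ((n (bs G i) : ℤ) : ℝ) = ((n (bs G i) % m : ℤ) : ℝ) + m * ((n (bs G i) / m : ℤ) : ℝ) := by
      exact_mod_cast h4.symm
    rw [h3, h5]
    field_simp
    ring
  refine ⟨f, Finset.mem_filter.2 ⟨Finset.mem_image.2 ⟨fun i => ⟨_, hmod i⟩, Finset.mem_univ _, hf.symm⟩, ?_⟩, hintg⟩
  have : f = t - (t - f) := by abel
  rw [this]
  exact e.SG.sub_mem ht (e.SG_of_int hintg)

lemma closed_map {W : Set (Fr G)} (hW : IsClosed W) (hp : ∀ w ∈ W, ∀ t ∈ e.SG, w + t ∈ W) :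
    IsClosed {ξ | e.S ξ ∈ W} := by
  refine closed_of_sep fun ξ0 h0 => ?_
  obtain ⟨s, a, h1, h2⟩ := sep_tp hW (ξ := e.S ξ0) h0
  have hcl : ∀ g0 : G, ∀ w ∈ W, ∑ g ∈ s with (∀ t ∈ e.SG, ∃ n : ℤ, t (g - g0) = n), a g * eC (w g) = 0 := by
    intro g0 w hw
    refine indep e.SG s (fun g => a g * eC (w g)) (fun g => g) (fun t ht => ?_) g0
    rw [← h1 _ (hp w hw t ht)]
    refine Finset.sum_congr rfl fun g _ => ?_
    rw [LinearMap.add_apply, eC_add]; ring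
  have hex : ∃ g0 : G, ∑ g ∈ s with (∀ t ∈ e.SG, ∃ n : ℤ, t (g - g0) = n), a g * eC (e.S ξ0 g) ≠ 0 := by
    by_contra! hcon
    apply h2
    let ρ : G → Set G := fun g => {g' | ∀ t ∈ e.SG, ∃ n : ℤ, t (g' - g) = n}
    have hρ : ∀ g g', ρ g = ρ g' ↔ ∀ t ∈ e.SG, ∃ n : ℤ, t (g - g') = n := by
      intro g g'
      constructor
      · intro hh
        have : g ∈ ρ g := fun t _ => ⟨0, by simp⟩
        rw [hh] at this
        exact this
      · intro hh
        ext x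
        refine forall₂_congr fun t ht => ?_
        obtain ⟨n, hn⟩ := hh t ht
        have : t (x - g') = t (x - g) + n := by rw [← hn, ← map_add]; congr 1; abel
        rw [this]
        constructor
        · rintro ⟨k, hk⟩; exact ⟨k + n, by rw [hk]; push_cast; ring⟩
        · rintro ⟨k, hk⟩; exact ⟨k - n, by push_cast; linarith⟩
    rw [← Finset.sum_fiberwise_of_maps_to (g := ρ) (t := s.image ρ) (fun i hi => Finset.mem_image_of_mem _ hi)]
    refine Finset.sum_eq_zero fun φ hφ => ?_
    obtain ⟨g0, _, rfl⟩ := Finset.mem_image.1 hφ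
    rw [← hcon g0]
    refine Finset.sum_congr ?_ fun _ _ => rfl
    ext g
    simp only [Finset.mem_filter, hρ]
  obtain ⟨g0, hg0⟩ := hex
  have hx : ∀ g, ∃ x, (∀ t ∈ e.SG, ∃ n : ℤ, t (g - g0) = n) → g - g0 = e.R x := by
    intro g
    by_cases hh : ∀ t ∈ e.SG, ∃ n : ℤ, t (g - g0) = n
    · obtain ⟨x, hx⟩ := e.SG_perp hh
      exact ⟨x, fun _ => hx⟩
    · exact ⟨0, fun h => absurd h hh⟩
  choose x hx using hx
  have key : ∀ ξ : Fr G, ∑ g ∈ s with (∀ t ∈ e.SG, ∃ n : ℤ, t (g - g0) = n), a g * eC (e.S ξ g) =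
      eC (e.S ξ g0) * ∑ g ∈ s with (∀ t ∈ e.SG, ∃ n : ℤ, t (g - g0) = n), a g * eC (ξ (x g)) := by
    intro ξ
    rw [Finset.mul_sum]
    refine Finset.sum_congr rfl fun g hg => ?_
    have h3 := hx g (Finset.mem_filter.1 hg).2
    have : g = g0 + e.R (x g) := by rw [← h3]; abel
    conv_lhs => rw [this]
    rw [map_add, eC_add, e.hSR]; 
    rw [← this]; ring
  refine ⟨_, isClosed_tp (s.filter fun g => ∀ t ∈ e.SG, ∃ n : ℤ, t (g - g0) = n) a x, ?_, ?_⟩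
  · intro ξ hξ
    have := hcl g0 _ hξ
    rw [key] at this
    exact (mul_eq_zero.1 this).resolve_left (eC_ne_zero _)
  · intro hh
    apply hg0
    rw [key, show _ = (0:ℂ) from hh, mul_zero]

/-- the closed image operator -/
def T (V : Set (Fr G)) : Set (Fr G) := {ξ | ∃ v ∈ V, IsInt (ξ - e.A v)}

lemma isClosed_sub {V : Set (Fr G)} (hV : IsClosed V) (t : Fr G) : IsClosed {ξ | ξ - t ∈ V} := by
  have := hV.preimage (cont_add (-t))
  simpa [Set.preimage, ← sub_eq_add_neg] using this

lemma isClosed_T {V : Set (Fr G)} (hV : IsClosed V) : IsClosed (e.T V) := by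
  obtain ⟨F, h1, h2⟩ := e.fin_SG
  have hc : IsClosed (⋃ f ∈ F, {ξ | ξ - f ∈ V}) :=
    F.finite_toSet.isClosed_biUnion fun f _ => isClosed_sub hV f
  have hmem : ∀ ψ, ψ ∈ (⋃ f ∈ F, {ξ | ξ - f ∈ V}) ↔ ∃ v ∈ V, ψ - v ∈ e.SG := by
    intro ψ
    simp only [Set.mem_iUnion, exists_prop]
    constructor
    · rintro ⟨f, hf, h⟩
      exact ⟨_, h, by rw [sub_sub_cancel]; exact h1 f hf⟩
    · rintro ⟨v, hv, h⟩
      obtain ⟨f, hf, h3⟩ := h2 _ h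
      refine ⟨f, hf, ?_⟩
      have := closed_add_int hV hv h3
      have e : v + (ψ - v - f) = ψ - f := by abel
      rwa [e] at this
  have := e.closed_map hc (fun w hw t ht => by
    rw [hmem] at hw ⊢
    obtain ⟨v, hv, h⟩ := hw
    refine ⟨v, hv, ?_⟩
    have e' : w + t - v = (w - v) + t := by abel
    rw [e']; exact e.SG.add_mem h ht)
  convert this using 1
  ext ξ
  rw [Set.mem_ofPred_eq, hmem]
  refine exists_congr fun v => and_congr_right fun _ => ?_
  rw [mem_SG, map_sub, A_S]

lemma T_ne_univ {V : Set (Fr G)} (hV : IsClosed V) (h : V ≠ Set.univ) : e.T V ≠ Set.univ := by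
  intro hT
  obtain ⟨F, h1, h2⟩ := e.fin_SG
  obtain ⟨z, hz, h3⟩ := isIrreducible_iff_sUnion_isClosed.1 (irred_univ (G := G))
    (F.image fun f => {ξ | ξ - f ∈ V}) (by
      intro z hz
      obtain ⟨f, _, rfl⟩ := Finset.mem_image.1 hz
      exact isClosed_sub hV f) (by
      intro ψ _
      have : e.A ψ ∈ e.T V := by rw [hT]; trivial
      obtain ⟨v, hv, h⟩ := this
      rw [← map_sub] at h
      obtain ⟨f, hf, h3⟩ := h2 _ h
      have h4 := closed_add_int hV hv h3
      have e : v + (ψ - v - f) = ψ - f := by abel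
      rw [e] at h4
      exact ⟨_, Finset.mem_coe.2 (Finset.mem_image.2 ⟨f, hf, rfl⟩), h4⟩)
  obtain ⟨f, _, rfl⟩ := Finset.mem_image.1 hz
  apply h
  ext ξ
  have : ξ + f ∈ {ξ | ξ - f ∈ V} := h3 trivial
  rw [Set.mem_ofPred_eq, add_sub_cancel_right] at this
  simpa using this

lemma T_mono {V V' : Set (Fr G)} (h : V ⊆ V') : e.T V ⊆ e.T V' := by
  rintro ξ ⟨v, hv, hh⟩; exact ⟨v, h hv, hh⟩

lemma A_mem_T {V : Set (Fr G)} {v : Fr G} (hv : v ∈ V) : e.A v ∈ e.T V :=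
  ⟨v, hv, by rw [sub_self]; exact IsInt.zero⟩

lemma T_subset {V W : Set (Fr G)} (hW : IsClosed W) (h : ∀ v ∈ V, e.A v ∈ W) : e.T V ⊆ W := by
  rintro ξ ⟨v, hv, hh⟩
  have := closed_add_int hW (h v hv) hh
  rwa [add_sub_cancel] at this

lemma irred_T {V : Set (Fr G)} (hV : IsClosed V) (h : IsIrreducible V) : IsIrreducible (e.T V) := by
  have h1 : IsIrreducible (closure ((fun ξ => e.A ξ) '' V)) := (h.image _ (cont_A e).continuousOn).closure
  have : e.T V = closure ((fun ξ => e.A ξ) '' V) := by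
    apply Set.Subset.antisymm
    · exact e.T_subset isClosed_closure fun v hv => subset_closure ⟨v, hv, rfl⟩
    · refine closure_minimal ?_ (e.isClosed_T hV)
      rintro _ ⟨v, hv, rfl⟩
      exact e.A_mem_T hv
  rw [this]; exact h1

end Ex
end Closed
end HT

namespace HT
open Topology

/-! ### Permutation of components -/

lemma comp_perm {α : Type} [TopologicalSpace α] [TopologicalSpace.NoetherianSpace α] {W : Set α}
    (hW : IsClosed W) (hne : W.Nonempty) (T : Set α → Set α)
    (hm : ∀ V V', V ⊆ V' → T V ⊆ T V') (hc : ∀ V, IsClosed V → IsClosed (T V))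
    (hi : ∀ V, IsClosed V → _root_.IsIrreducible V → _root_.IsIrreducible (T V)) (hTW : T W ⊆ W)
    (hcov : ∀ ξ ∈ W, ∃ v ∈ W, ∀ V : Set α, v ∈ V → ξ ∈ T V) :
    ∃ V, IsClosed V ∧ _root_.IsIrreducible V ∧ V ⊆ W ∧ (∃ p, 0 < p ∧ T^[p] V = V ∧
      ∀ V', IsClosed V' → _root_.IsIrreducible V' → V' ⊆ W → V ⊆ T^[p] V' → V' ⊆ V) ∧
      ∃ W2, IsClosed W2 ∧ W ⊆ V ∪ W2 ∧ ¬ V ⊆ W2 := by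
  obtain ⟨S, hSf, hSc, hSi, hSW⟩ :=
    TopologicalSpace.NoetherianSpace.exists_finite_set_isClosed_irreducible hW
  let M : Set (Set α) := {V | Maximal (fun V => V ∈ S) V}
  have hMS : ∀ V ∈ M, V ∈ S := fun V hV => hV.1
  have hMf : M.Finite := hSf.subset hMS
  have hMW : ∀ V ∈ M, V ⊆ W := fun V hV => by rw [hSW]; exact Set.subset_sUnion_of_mem (hMS V hV)
  have hMc : ∀ V ∈ M, IsClosed V := fun V hV => hSc V (hMS V hV)
  have hMi : ∀ V ∈ M, _root_.IsIrreducible V := fun V hV => hSi V (hMS V hV)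
  have hMeq : ∀ V ∈ M, ∀ V' ∈ M, V ⊆ V' → V = V' := fun V hV V' hV' h =>
    h.antisymm (hV.2 (hMS _ hV') h)
  have hin : ∀ Y, _root_.IsIrreducible Y → Y ⊆ W → ∃ V ∈ M, Y ⊆ V := by
    intro Y hY hYW
    obtain ⟨z, hz, hYz⟩ := isIrreducible_iff_sUnion_isClosed.1 hY hSf.toFinset
      (fun z hz => hSc z (by simpa using hz)) (by rw [hSW] at hYW; simpa using hYW)
    obtain ⟨V, hzV, hV⟩ := hSf.exists_le_maximal (by simpa using hz : z ∈ S)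
    exact ⟨V, hV, hYz.trans hzV⟩
  have hpre : ∀ V' : M, ∃ V : M, T V = V' := by
    rintro ⟨V', hV'⟩
    obtain ⟨z, hz, hYz⟩ := isIrreducible_iff_sUnion_isClosed.1 (hMi V' hV') (hMf.toFinset.image T)
      (by
        intro z hz
        obtain ⟨V, hV, rfl⟩ := Finset.mem_image.1 hz
        exact hc V (hMc V (by simpa using hV)))
      (by
        intro ξ hξ
        obtain ⟨v, hv, h⟩ := hcov ξ (hMW V' hV' hξ)
        obtain ⟨V, hV, hvV⟩ := hin {v} isIrreducible_singleton (by simpa using hv)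
        refine ⟨T V, ?_, h V (hvV rfl)⟩
        simp only [Finset.coe_image, Set.mem_image, Finset.mem_coe, Set.Finite.mem_toFinset]
        exact ⟨V, hV, rfl⟩)
    obtain ⟨V, hV, rfl⟩ := Finset.mem_image.1 hz
    have hV : V ∈ M := by simpa using hV
    obtain ⟨V'', hV'', h2⟩ := hin (T V) (hi V (hMc V hV) (hMi V hV)) ((hm _ _ (hMW V hV)).trans hTW)
    have : V' = V'' := hMeq _ hV' _ hV'' (hYz.trans h2)
    subst this
    exact ⟨⟨V, hV⟩, h2.antisymm hYz⟩
  choose g hg using hpre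
  have hginj : Function.Injective g := fun a b h => Subtype.ext (by rw [← hg a, ← hg b, h])
  have : Finite M := hMf
  obtain ⟨w, hw⟩ := hne
  obtain ⟨V, hV, -⟩ := hin {w} isIrreducible_singleton (by simpa using hw)
  have hiter : ∀ n (U : M), T^[n] (g^[n] U) = U := by
    intro n
    induction n with
    | zero => intro U; rfl
    | succ n ih =>
      intro U
      rw [Function.iterate_succ_apply, Function.iterate_succ_apply', hg, ih]
  obtain ⟨p, hp, hper⟩ := Function.mem_periodicPts.1 (hginj.mem_periodicPts ⟨V, hV⟩)
  refine ⟨V, hMc V hV, hMi V hV, hMW V hV, ⟨p, hp, ?_, ?_⟩, ⋃₀ (M \ {V}), ?_, ?_, ?_⟩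
  · have := hiter p ⟨V, hV⟩
    rwa [hper] at this
  · intro V' h1 h2 h3 h4
    obtain ⟨V'', hV'', h5⟩ := hin V' h2 h3
    obtain ⟨U, hU⟩ := (Finite.surjective_of_injective (hginj.iterate p)) ⟨V'', hV''⟩
    have hmn : ∀ n, ∀ A B, A ⊆ B → T^[n] A ⊆ T^[n] B := by
      intro n
      induction n with
      | zero => intro A B h; exact h
      | succ n ih => intro A B h; rw [Function.iterate_succ_apply, Function.iterate_succ_apply]; exact ih _ _ (hm _ _ h)
    have h6 := hiter p U
    rw [hU] at h6
    have h7 : V = U.1 := hMeq _ hV _ U.2 (by rw [← h6]; exact h4.trans (hmn p _ _ h5))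
    have h8 : U = ⟨V, hV⟩ := Subtype.ext h7.symm
    rw [h8, hper] at hU
    have h9 : V = V'' := congrArg Subtype.val hU
    rw [h9]; exact h5
  · rw [Set.sUnion_eq_biUnion]
    exact Set.Finite.isClosed_biUnion (hMf.subset Set.sdiff_subset) fun z hz => hMc z hz.1
  · intro ξ hξ
    obtain ⟨V1, hV1, h⟩ := hin {ξ} isIrreducible_singleton (by simpa using hξ)
    by_cases hh : V1 = V
    · left; rw [← hh]; exact h rfl
    · right; exact ⟨V1, ⟨hV1, hh⟩, h rfl⟩
  · intro hsub
    obtain ⟨z, hz, hYz⟩ := isIrreducible_iff_sUnion_isClosed.1 (hMi V hV) (hMf.subset Set.sdiff_subset).toFinset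
      (fun z hz => hMc z (by have : z ∈ M \ {V} := by simpa only [Set.Finite.mem_toFinset] using hz
                             exact this.1)) (by rw [Set.Finite.coe_toFinset]; exact hsub)
    have hz : z ∈ M \ {V} := by simpa only [Set.Finite.mem_toFinset] using hz
    exact hz.2 (hMeq _ hV _ hz.1 hYz).symm

namespace Sys
variable {G X C : Type} [AddCommGroup G] [Fintype X] [Fintype C] (σ : Sys G X C)
attribute [local instance] zT

lemma had_orth {L : Finset (Fr G)} 
    (h : ∀ l ∈ L, ∀ l' ∈ L, l ≠ l' → ∀ c, σ.ms c (σ.S (l - l')) = 0) (c : C) (l l' : L) :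
    ∑ x : {x : X // σ.π x = c}, eC (σ.S l.1 (σ.β x.1)) * (starRingEnd ℂ) (eC (σ.S l'.1 (σ.β x.1))) =
      if l = l' then (σ.N : ℂ) else 0 := by
  have e1 : ∑ x : {x : X // σ.π x = c}, eC (σ.S l.1 (σ.β x.1)) * (starRingEnd ℂ) (eC (σ.S l'.1 (σ.β x.1))) =
      σ.ms c (σ.S (l.1 - l'.1)) := by
    unfold ms
    rw [← Finset.sum_subtype_eq_sum_filter]
    rw [Finset.subtype_univ]
    refine Finset.sum_congr rfl fun x _ => ?_
    rw [map_sub, LinearMap.sub_apply, eC_sub]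
  rw [e1]
  split_ifs with hl
  · rw [hl, sub_self, map_zero, ms_zero]
  · exact h _ l.2 _ l'.2 (fun hh => hl (Subtype.ext hh)) c

lemma had_card {L : Finset (Fr G)} (h : L.card = σ.N) (c : C) :
    Fintype.card L = Fintype.card {x : X // σ.π x = c} := by
  rw [Fintype.card_coe, h, Fintype.card_subtype, σ.fib]

lemma exists_ms_ne (hH : σ.Had) (ξ : Fr G) (c : C) : ∃ ψ, IsInt (σ.A ψ - ξ) ∧ σ.ms c ψ ≠ 0 := by
  obtain ⟨L, h1, h2, h3⟩ := hH
  by_contra! hcon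
  have hp := parseval_fin (σ.had_card h2 c) (fun (l : L) (x : {x : X // σ.π x = c}) => eC (σ.S l.1 (σ.β x.1)))
    σ.N σ.Npos.ne' (by intro i i'; rw [had_orth σ h3 c i i']; simp) (fun x => eC (σ.S ξ (σ.β x.1)))
  have hz : ∀ l : L, ∑ x : {x : X // σ.π x = c}, eC (σ.S ξ (σ.β x.1)) *
      (starRingEnd ℂ) (eC (σ.S l.1 (σ.β x.1))) = 0 := by
    intro l
    rw [← hcon (σ.S (ξ - l.1)) (by rw [Ex.A_S, sub_sub_cancel_left]; exact (h1 _ l.2).neg)]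
    unfold ms
    rw [← Finset.sum_subtype_eq_sum_filter, Finset.subtype_univ]
    refine Finset.sum_congr rfl fun x _ => ?_
    rw [map_sub, LinearMap.sub_apply, eC_sub]
  simp only [hz] at hp
  simp [norm_eC] at hp
  rcases hp with h | h
  · exact σ.hN.ne' h
  · have := σ.hN
    rw [← σ.fib c, ← Fintype.card_subtype] at this
    omega

/-- common zeros of the masks -/
def D : Set (Fr G) := {ξ | ∀ c, σ.ms c ξ = 0}

lemma isClosed_D : IsClosed σ.D := by
  have : σ.D = ⋂ c, {ξ | ∑ x ∈ Finset.univ.filter (fun x => σ.π x = c), (1:ℂ) * eC (ξ (σ.β x)) = 0} := by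
    ext ξ
    simp [D, ms]
  rw [this]
  exact isClosed_iInter fun c => isClosed_tp _ _ _

lemma zero_notMem_D [Nonempty C] : (0 : Fr G) ∉ σ.D := fun h => σ.ms_zero_ne (Classical.arbitrary C) (h _)

/-- invariant sets -/
structure Inv (M : Set (Fr G)) : Prop where
  per : ∀ ξ ∈ M, ∀ k, IsInt k → ξ + k ∈ M
  inv : ∀ ψ, σ.A ψ ∈ M → ψ ∉ σ.D → ψ ∈ M

lemma D_per {ξ k : Fr G} (hk : IsInt k) (h : ξ + k ∈ σ.D) : ξ ∈ σ.D := fun c => by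
  rw [← σ.ms_add_int c ξ k hk]; exact h c

variable [Module.Free ℤ G] [Module.Finite ℤ G]

lemma inv_Z [Nonempty C] : σ.Inv σ.Z where
  per := fun ξ h k hk k' hk' => by rw [add_assoc]; exact h _ (hk.add hk')
  inv := fun ψ h hD k hk => by
    have h1 := h _ (σ.isInt_A hk)
    rw [← map_add, H_succ, Ex.S_A, ub_add_int _ _ _ hk] at h1
    refine (mul_eq_zero.1 h1).resolve_left fun h2 => hD ?_
    exact (σ.ub_eq_zero_iff ψ).1 h2

lemma Z_proper [Nonempty C] : ∃ K : Set (Fr G), IsClosed K ∧ K ≠ Set.univ ∧ σ.Z ⊆ K := by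
  obtain ⟨n, hn⟩ := σ.H_unif (Fintype.card (Ix G))
  have hcl : ∀ i : Fin n, IsClosed ((σ.npow (i.1 + 1) i.1.succ_pos).T σ.D) := fun i =>
    Ex.isClosed_T _ σ.isClosed_D
  have hne : ∀ i : Fin n, (σ.npow (i.1 + 1) i.1.succ_pos).T σ.D ≠ Set.univ := fun i =>
    Ex.T_ne_univ _ σ.isClosed_D (fun h => σ.zero_notMem_D (by rw [h]; trivial))
  refine ⟨⋃ i : Fin n, (σ.npow (i.1 + 1) i.1.succ_pos).T σ.D, isClosed_iUnion_of_finite hcl, ?_, ?_⟩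
  · intro hu
    obtain ⟨z, hz, h3⟩ := isIrreducible_iff_sUnion_isClosed.1 (irred_univ (G := G))
      (Finset.univ.image fun i : Fin n => (σ.npow (i.1 + 1) i.1.succ_pos).T σ.D) (by
      intro z hz
      obtain ⟨f, _, rfl⟩ := Finset.mem_image.1 hz
      exact hcl f) (by
      rw [Finset.coe_image, Finset.coe_univ, Set.image_univ, Set.sUnion_range, hu])
    obtain ⟨i, _, rfl⟩ := Finset.mem_image.1 hz
    exact hne i (Set.univ_subset_iff.1 h3)
  · intro ξ hξ
    obtain ⟨k, hk, t, ht, e⟩ := exists_int_near ξ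
    have h1 := hξ k hk
    have h2 := hn n le_rfl (ξ + k) (by rw [e]; exact q_box ht)
    rw [H_eq σ n] at h1
    have h3 := (mul_eq_zero.1 h1).resolve_right (by linarith)
    obtain ⟨i, hi, h4⟩ := Finset.prod_eq_zero_iff.1 h3
    rw [Finset.mem_range] at hi
    rw [Set.mem_iUnion]
    refine ⟨⟨i, hi⟩, (σ.S ^ (i + 1)) (ξ + k), (σ.ub_eq_zero_iff _).1 h4, ?_⟩
    have h5 : (σ.npow (i + 1) i.succ_pos).A ((σ.S ^ (i + 1)) (ξ + k)) = ξ + k :=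
      (σ.npow (i + 1) i.succ_pos).A_S (ξ + k)
    rw [h5, sub_add_cancel_left]
    exact hk.neg

lemma npow_A (p : ℕ) (hp : 0 < p) (ξ : Fr G) : (σ.npow p hp).A ξ = (σ.A ^ p) ξ := by
  ext g
  rw [Ex.A_pow_apply]
  rfl

lemma T_iter (p : ℕ) (hp : 0 < p) (V : Set (Fr G)) (hV : IsClosed V) :
    (σ.T)^[p] V = (σ.npow p hp).T V := by
  have key : ∀ n, (σ.T)^[n] V = {ξ | ∃ v ∈ V, IsInt (ξ - (σ.A ^ n) v)} := by
    intro n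
    induction n with
    | zero =>
      ext ξ
      simp only [Function.iterate_zero, id, pow_zero, Module.End.one_apply, Set.mem_ofPred_eq]
      constructor
      · intro h; exact ⟨ξ, h, by rw [sub_self]; exact IsInt.zero⟩
      · rintro ⟨v, hv, h⟩
        have := closed_add_int hV hv h
        rwa [add_sub_cancel] at this
    | succ n ih =>
      rw [Function.iterate_succ_apply', ih]
      ext ξ
      constructor
      · rintro ⟨v, ⟨w, hw, h1⟩, h2⟩
        refine ⟨w, hw, ?_⟩
        rw [pow_succ', Module.End.mul_apply]
        have := h2.add (σ.isInt_A h1)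
        rwa [map_sub, sub_add_sub_cancel] at this
      · rintro ⟨w, hw, h⟩
        rw [pow_succ', Module.End.mul_apply] at h
        exact ⟨(σ.A ^ n) w, ⟨w, hw, by rw [sub_self]; exact IsInt.zero⟩, h⟩
  rw [key]
  ext ξ
  show _ ↔ ∃ v ∈ V, IsInt (ξ - (σ.npow p hp).A v)
  simp only [npow_A, Set.mem_ofPred_eq]

lemma step5 [Nonempty C] (hH : σ.Had) (hZ : σ.Z.Nonempty) :
    ∃ (p : ℕ) (hp : 0 < p) (V : Set (Fr G)), IsClosed V ∧ _root_.IsIrreducible V ∧ V ≠ Set.univ ∧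
      (∃ v ∈ V, ¬ IsInt v) ∧ (σ.npow p hp).T V = V ∧
      ∀ t ∈ (σ.npow p hp).SG, (∀ v ∈ V, v + t ∈ V) ∨ (∀ v ∈ V, v + t ∈ (σ.npow p hp).D) := by
  have hN : TopologicalSpace.NoetherianSpace (Fr G) := noeth
  -- minimal invariant set
  have hwf : WellFounded ((· < ·) : TopologicalSpace.Closeds (Fr G) → TopologicalSpace.Closeds (Fr G) → Prop) :=
    IsWellFounded.wf
  obtain ⟨Wc, ⟨M, hMi, hMne, hMZ, hMW⟩, hmin⟩ := hwf.has_min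
    {W | ∃ M : Set (Fr G), σ.Inv M ∧ M.Nonempty ∧ M ⊆ σ.Z ∧ (W : Set (Fr G)) = closure M}
    ⟨⟨closure σ.Z, isClosed_closure⟩, σ.Z, σ.inv_Z, hZ, subset_rfl, rfl⟩
  obtain ⟨W, hWdef⟩ : ∃ W, W = closure M := ⟨_, rfl⟩
  have hW : IsClosed W := by rw [hWdef]; exact isClosed_closure
  have hMsub : M ⊆ W := by rw [hWdef]; exact subset_closure
  obtain ⟨Φ, hΦ⟩ : ∃ Φ : Set (Fr G), ∀ ψ, ψ ∈ Φ ↔ ψ ∉ σ.D ∧ σ.A ψ ∈ M := ⟨{ψ | _}, fun _ => Iff.rfl⟩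
  have hΦM : Φ ⊆ M := fun ψ h => hMi.inv ψ ((hΦ ψ).1 h).2 ((hΦ ψ).1 h).1
  have hpre : ∀ ξ ∈ M, ∃ ψ ∈ Φ, IsInt (σ.A ψ - ξ) := by
    intro ξ hξ
    obtain ⟨ψ, h1, h2⟩ := σ.exists_ms_ne hH ξ (Classical.arbitrary C)
    refine ⟨ψ, (hΦ ψ).2 ⟨fun h => h2 (h _), ?_⟩, h1⟩
    have := hMi.per ξ hξ _ h1
    rwa [add_sub_cancel] at this
  have hΦi : σ.Inv Φ := by
    refine ⟨fun ξ h k hk => ?_, fun ψ h hD => (hΦ ψ).2 ⟨hD, hΦM h⟩⟩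
    obtain ⟨h1, h2⟩ := (hΦ ξ).1 h
    refine (hΦ _).2 ⟨fun h => h1 (σ.D_per hk h), ?_⟩
    rw [map_add]
    exact hMi.per _ h2 _ (σ.isInt_A hk)
  have hΦne : Φ.Nonempty := by
    obtain ⟨ξ, hξ⟩ := hMne
    obtain ⟨ψ, h, -⟩ := hpre ξ hξ
    exact ⟨ψ, h⟩
  have hΦW : closure Φ = W := by
    have h1 := hmin ⟨closure Φ, isClosed_closure⟩ ⟨Φ, hΦi, hΦne, hΦM.trans hMZ, rfl⟩
    have h2 : closure Φ ⊆ W := by rw [hWdef]; exact closure_mono hΦM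
    by_contra hne
    apply h1
    refine lt_of_le_of_ne ?_ ?_
    · show closure Φ ⊆ (Wc : Set (Fr G))
      rw [hMW, ← hWdef]; exact h2
    · intro he
      apply hne
      rw [hWdef, ← hMW, ← he]; rfl
  have hAW : ∀ w ∈ W, σ.A w ∈ W := by
    intro w hw
    have hpc : IsClosed {ξ | σ.A ξ ∈ W} := hW.preimage (cont_A σ.toEx)
    rw [← hΦW] at hw
    have hsub : Φ ⊆ {ξ | σ.A ξ ∈ W} := fun ψ h => by
      show σ.A ψ ∈ W
      exact hMsub ((hΦ ψ).1 h).2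
    exact closure_minimal hsub hpc hw
  have hWT : W ⊆ σ.T W := by
    rw [hWdef]
    refine closure_minimal (fun ξ hξ => ?_) (σ.isClosed_T (by rw [← hWdef]; exact hW))
    obtain ⟨ψ, h1, h2⟩ := hpre ξ hξ
    refine ⟨ψ, subset_closure (hΦM h1), ?_⟩
    rw [← neg_sub]; exact h2.neg
  have hback : ∀ ψ, σ.A ψ ∈ W → ψ ∈ W ∨ ψ ∈ σ.D := by
    have hEc : IsClosed (W ∪ σ.D) := hW.union σ.isClosed_D
    obtain ⟨E, hE⟩ : ∃ E : Set (Fr G), ∀ ψ, ψ ∈ E ↔ ∀ t ∈ σ.SG, ψ + t ∈ W ∪ σ.D :=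
      ⟨{ψ | _}, fun _ => Iff.rfl⟩
    have hEcl : IsClosed E := by
      have : E = ⋂ t ∈ σ.SG, {ψ | ψ + t ∈ W ∪ σ.D} := by
        ext ψ; rw [hE]; simp only [Set.mem_iInter]; rfl
      rw [this]
      exact isClosed_biInter fun t _ => hEc.preimage (cont_add t)
    have hcl := σ.closed_map hEcl (fun w hw t ht => by
      rw [hE] at hw ⊢
      intro t' ht'
      rw [add_assoc]; exact hw _ (σ.SG.add_mem ht ht'))
    have hsub : W ⊆ {ξ | σ.S ξ ∈ E} := by
      rw [hWdef]
      refine closure_minimal (fun ξ hξ => ?_) hcl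
      show σ.S ξ ∈ E
      rw [hE]
      intro t ht
      by_cases hD : σ.S ξ + t ∈ σ.D
      · exact Or.inr hD
      · left
        refine hMsub (hMi.inv _ ?_ hD)
        rw [map_add, Ex.A_S]
        exact hMi.per _ hξ _ ht
    intro ψ hψ
    have h1 : σ.S (σ.A ψ) ∈ E := hsub hψ
    rw [Ex.S_A, hE] at h1
    simpa using h1 0 σ.SG.zero_mem
  obtain ⟨V, hVc, hVi, hVW, ⟨p, hp, hTV, hmax⟩, W2, hW2c, hW2, hW2V⟩ := comp_perm hW (hMne.mono hMsub) σ.T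
    (fun _ _ h => σ.T_mono h) (fun _ h => σ.isClosed_T h) (fun _ h h' => σ.irred_T h h')
    (σ.T_subset hW hAW) (fun ξ hξ => by
      obtain ⟨v, hv, h⟩ := hWT hξ
      exact ⟨v, hv, fun V hV => ⟨v, hV, h⟩⟩)
  rw [σ.T_iter p hp V hVc] at hTV
  refine ⟨p, hp, V, hVc, hVi, ?_, ?_, hTV, ?_⟩
  · rintro rfl
    obtain ⟨K, h1, h2, h3⟩ := σ.Z_proper
    apply h2
    rw [← Set.univ_subset_iff]
    refine hVW.trans ?_
    rw [hWdef]
    exact closure_minimal (hMZ.trans h3) h1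
  · by_contra! hcon
    have h0 : ¬ M ⊆ W2 := by
      intro h
      exact hW2V (hVW.trans (by rw [hWdef]; exact closure_minimal h hW2c))
    rw [Set.not_subset] at h0
    obtain ⟨m, hm, hm2⟩ := h0
    have hmV : m ∈ V := (hW2 (hMsub hm)).resolve_right hm2
    have h1 := hMZ hm (-m) (hcon m hmV).neg
    rw [add_neg_cancel, H_zero] at h1
    exact one_ne_zero h1
  · intro t ht
    obtain ⟨V1, hV1⟩ : ∃ V1 : Set (Fr G), ∀ ξ, ξ ∈ V1 ↔ ξ - t ∈ V := ⟨{ξ | _}, fun _ => Iff.rfl⟩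
    have hV1c : IsClosed V1 := by
      have : V1 = {ξ | ξ - t ∈ V} := by ext ξ; exact hV1 ξ
      rw [this]; exact Ex.isClosed_sub hVc t
    have hV1i : _root_.IsIrreducible V1 := by
      have : V1 = (fun ξ => ξ + t) '' V := by
        ext ξ; rw [hV1]
        constructor
        · intro h; exact ⟨_, h, by simp⟩
        · rintro ⟨v, hv, rfl⟩; simpa using hv
      rw [this]; exact hVi.image _ (cont_add t).continuousOn
    have hsub : V1 ⊆ W ∪ (σ.npow p hp).D := by
      intro ψ hψ
      rw [hV1] at hψ
      have h1 : (σ.A ^ p) ψ ∈ W := by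
        have h2 : (σ.npow p hp).A (ψ - t) ∈ V := by
          have := (σ.npow p hp).A_mem_T hψ
          rwa [hTV] at this
        have h3 := closed_add_int hW (hVW h2) ht
        rw [← map_add, sub_add_cancel, npow_A] at h3
        exact h3
      by_contra hcon
      rw [Set.mem_union, not_or] at hcon
      have h4 : ∀ j ≤ p, (σ.A ^ (p - j)) ψ ∈ W := by
        intro j
        induction j with
        | zero => intro _; exact h1
        | succ j ih =>
          intro hj
          have h5 := ih (by omega)
          have e : p - j = (p - (j + 1)) + 1 := by omega
          rw [e, pow_succ', Module.End.mul_apply] at h5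
          refine (hback _ h5).resolve_right fun hD => hcon.2 ?_
          have h6 : ψ = (σ.S ^ p) ((σ.A ^ p) ψ) := (σ.S_pow_A_pow p ψ).symm
          show ∀ c, (σ.npow p hp).ms c ψ = 0
          rw [h6, npow_ms_zero]
          refine ⟨j, by omega, ?_⟩
          rw [σ.S_pow_A_pow_of_le (by omega)]
          exact hD
      have := h4 p le_rfl
      rw [Nat.sub_self] at this
      exact hcon.1 this
    rcases isPreirreducible_iff_isClosed_union_isClosed.1 hV1i.2 _ _ hW (σ.npow p hp).isClosed_D hsub with h | h
    · left
      have h7 := hmax V1 hV1c hV1i h (by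
        rw [σ.T_iter p hp V1 hV1c, ← hTV]
        rintro ξ ⟨v, hv, h8⟩
        refine ⟨v + t, (hV1 _).2 (by simpa using hv), ?_⟩
        rw [map_add, ← sub_sub]
        exact h8.sub ht)
      exact fun v hv => h7 ((hV1 _).2 (by simpa using hv))
    · right
      exact fun v hv => h ((hV1 _).2 (by simpa using hv))

end Sys
end HT

namespace HT
open Topology

/-! ### Splitting off a sublattice -/

section Split
variable {G : Type} [AddCommGroup G]
attribute [local instance] zT

/-- `g` is integral on the group `K` -/
def IntOn (K : AddSubgroup (Fr G)) (g : G) : Prop := ∀ t ∈ K, ∃ n : ℤ, t g = n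

lemma indep' (K : AddSubgroup (Fr G)) {ι : Type} (s : Finset ι) (a : ι → ℂ) (g : ι → G)
    (h : ∀ t ∈ K, ∑ i ∈ s, a i * eC (t (g i)) = 0) (g0 : G) :
    ∑ i ∈ s with IntOn K (g i - g0), a i = 0 := indep K s a g h g0

/-- annihilator of a group of functionals -/
def perp (K : AddSubgroup (Fr G)) : AddSubgroup G where
  carrier := {g | IntOn K g}
  zero_mem' := fun t _ => ⟨0, by simp⟩
  add_mem' := fun {a b} ha hb t ht => by
    obtain ⟨n, hn⟩ := ha t ht
    obtain ⟨m, hm⟩ := hb t ht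
    exact ⟨n + m, by rw [map_add, hn, hm]; push_cast; rfl⟩
  neg_mem' := fun {a} ha t ht => by
    obtain ⟨n, hn⟩ := ha t ht
    exact ⟨-n, by rw [map_neg, hn]; push_cast; rfl⟩

lemma mem_perp {K : AddSubgroup (Fr G)} {g : G} : g ∈ perp K ↔ IntOn K g := Iff.rfl

lemma sum_classes (Q : AddSubgroup G) (s : Finset G) (b : G → ℂ)
    (h : ∀ g0, ∑ g ∈ s with g - g0 ∈ Q, b g = 0) : ∑ g ∈ s, b g = 0 := by
  rw [← Finset.sum_fiberwise_of_maps_to (g := fun g : G => (QuotientAddGroup.mk g : G ⧸ Q))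
    (t := s.image (fun g : G => (QuotientAddGroup.mk g : G ⧸ Q)))
    (fun i hi => Finset.mem_image_of_mem _ hi)]
  refine Finset.sum_eq_zero fun φ hφ => ?_
  obtain ⟨g0, _, rfl⟩ := Finset.mem_image.1 hφ
  rw [← h g0]
  refine Finset.sum_congr ?_ fun _ _ => rfl
  ext g
  simp only [Finset.mem_filter]
  refine and_congr_right fun _ => ?_
  rw [eq_comm, QuotientAddGroup.eq, neg_add_eq_sub]

lemma mem_of_perp {K : AddSubgroup (Fr G)} (hK : IsClosed (K : Set (Fr G))) {t : Fr G}
    (h : ∀ g ∈ perp K, ∃ n : ℤ, t g = n) : t ∈ K := by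
  by_contra hn
  obtain ⟨s, a, h1, h2⟩ := sep_tp hK (ξ := t) hn
  apply h2
  refine sum_classes (perp K) s _ fun g0 => ?_
  have h3 := indep' K s a id (fun t ht => h1 t ht) g0
  have h4 : ∑ g ∈ s with g - g0 ∈ perp K, a g * eC (t g) = 
      eC (t g0) * ∑ g ∈ s with IntOn K (id g - g0), a g := by
    rw [Finset.mul_sum]
    refine Finset.sum_congr rfl fun g hg => ?_
    have := (eC_eq_one_iff _).2 (h _ (Finset.mem_filter.1 hg).2)
    rw [map_sub] at this
    simp only [id] at this
    have e : t g = t g0 + (t g - t g0) := by ring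
    rw [e, eC_add, this]; ring
  rw [h4, h3, mul_zero]

lemma indep2 (K : AddSubgroup (Fr G)) {ι : Type} (s : Finset ι) (a : ι → ℂ) (g g' : ι → G)
    (h : ∀ t ∈ K, ∑ i ∈ s, a i * eC (t (g i)) = ∑ i ∈ s, a i * eC (t (g' i))) (g0 : G) :
    ∑ i ∈ s with IntOn K (g i - g0), a i = ∑ i ∈ s with IntOn K (g' i - g0), a i := by
  have := indep' K (s.disjSum s) (Sum.elim a fun i => - a i) (Sum.elim g g') (fun t ht => by
    rw [Finset.sum_disjSum]
    simp only [Sum.elim_inl, Sum.elim_inr]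
    rw [h t ht, ← Finset.sum_add_distrib]
    exact Finset.sum_eq_zero fun i _ => by ring) g0
  rw [Finset.sum_filter, Finset.sum_disjSum] at this
  have e1 : ∑ i ∈ s with IntOn K (g i - g0), a i =
      ∑ i ∈ s, if IntOn K (Sum.elim g g' (Sum.inl i) - g0) then Sum.elim a (fun i => - a i) (Sum.inl i) else 0 := by
    rw [Finset.sum_filter]
    refine Finset.sum_congr rfl fun i _ => ?_
    by_cases h : IntOn K (g i - g0) <;> simp [h]
  have e2 : - ∑ i ∈ s with IntOn K (g' i - g0), a i =
      ∑ i ∈ s, if IntOn K (Sum.elim g g' (Sum.inr i) - g0) then Sum.elim a (fun i => - a i) (Sum.inr i) else 0 := by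
    rw [Finset.sum_filter, ← Finset.sum_neg_distrib]
    refine Finset.sum_congr rfl fun i _ => ?_
    by_cases h : IntOn K (g' i - g0) <;> simp [h]
  rw [← e1, ← e2] at this
  linear_combination this

/-- stabiliser of a closed set -/
def Stab [Module.Free ℤ G] [Module.Finite ℤ G] (V : Set (Fr G)) (hV : IsClosed V) : AddSubgroup (Fr G) where
  carrier := {t | ∀ v ∈ V, v + t ∈ V}
  zero_mem' := fun v hv => by rwa [add_zero]
  add_mem' := fun {a b} ha hb v hv => by rw [← add_assoc]; exact hb _ (ha _ hv)
  neg_mem' := fun {t} ht => by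
    have hN : TopologicalSpace.NoetherianSpace (Fr G) := noeth
    have hwf : WellFounded ((· < ·) : TopologicalSpace.Closeds (Fr G) → TopologicalSpace.Closeds (Fr G) → Prop) :=
      IsWellFounded.wf
    obtain ⟨_, ⟨n, rfl⟩, hmin⟩ := hwf.has_min
      (Set.range fun n : ℕ => (⟨{ξ | ξ - n • t ∈ V}, Ex.isClosed_sub hV (n • t)⟩ : TopologicalSpace.Closeds (Fr G)))
      ⟨_, 0, rfl⟩
    have h1 := hmin _ ⟨n + 1, rfl⟩
    intro v hv
    have hle : ∀ ξ, ξ - (n + 1) • t ∈ V → ξ - n • t ∈ V := by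
      intro ξ h
      have := ht _ h
      rwa [succ_nsmul, ← sub_sub, sub_add_cancel] at this
    by_contra hcon
    apply h1
    refine lt_of_le_of_ne hle ?_
    intro he
    have h2 : v + n • t ∈ {ξ | ξ - n • t ∈ V} := by
      show v + n • t - n • t ∈ V
      simpa using hv
    have h3 : {ξ | ξ - (n + 1) • t ∈ V} = {ξ | ξ - n • t ∈ V} :=
      congrArg (fun K : TopologicalSpace.Closeds (Fr G) => (K : Set (Fr G))) he
    rw [← h3] at h2
    have h4 : v + n • t - (n + 1) • t ∈ V := h2
    have e5 : v + n • t - (n + 1) • t = v + -t := by rw [succ_nsmul]; abel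
    rw [e5] at h4
    exact hcon h4

variable [Module.Free ℤ G] [Module.Finite ℤ G]

lemma mem_Stab {V : Set (Fr G)} {hV : IsClosed V} {t : Fr G} : t ∈ Stab V hV ↔ ∀ v ∈ V, v + t ∈ V := Iff.rfl

lemma isClosed_Stab (V : Set (Fr G)) (hV : IsClosed V) : IsClosed (Stab V hV : Set (Fr G)) := by
  have : (Stab V hV : Set (Fr G)) = ⋂ v ∈ V, {t | t + v ∈ V} := by
    ext t
    simp only [SetLike.mem_coe, mem_Stab, Set.mem_iInter]
    refine forall₂_congr fun v _ => ?_
    rw [add_comm]; rfl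
  rw [this]
  exact isClosed_biInter fun v _ => hV.preimage (cont_add v)

lemma Ex.Stab_A (e : Ex G) {V : Set (Fr G)} {hV : IsClosed V} (hT : e.T V = V) {t : Fr G}
    (ht : t ∈ Stab V hV) : e.A t ∈ Stab V hV := by
  intro v hv
  rw [← hT] at hv
  obtain ⟨w, hw, h⟩ := hv
  rw [← hT]
  refine ⟨w + t, ht w hw, ?_⟩
  rwa [map_add, add_sub_add_right_eq_sub]

lemma Ex.Stab_S (e : Ex G) {V : Set (Fr G)} {hV : IsClosed V} (hi : _root_.IsIrreducible V) (hT : e.T V = V)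
    {t : Fr G} (ht : t ∈ Stab V hV) : ∃ s ∈ Stab V hV, IsInt (t - e.A s) := by
  obtain ⟨F, hF1, hF2⟩ := e.fin_SG
  obtain ⟨z, hz, h3⟩ := isIrreducible_iff_sUnion_isClosed.1 hi
    (F.image fun f => {ξ | ξ - (f - e.S t) ∈ V}) (by
      intro z hz
      obtain ⟨f, _, rfl⟩ := Finset.mem_image.1 hz
      exact Ex.isClosed_sub hV _) (by
      intro v hv
      have h1 : e.A v + t ∈ V := ht _ (by have := e.A_mem_T hv; rwa [hT] at this)
      rw [← hT] at h1
      obtain ⟨w, hw, h⟩ := h1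
      have h2 : v + e.S t - w ∈ e.SG := by
        rw [Ex.mem_SG, map_sub, map_add, Ex.A_S]; exact h
      obtain ⟨f, hf, h3⟩ := hF2 _ h2
      have h4 := closed_add_int hV hw h3
      have e' : w + (v + e.S t - w - f) = v - (f - e.S t) := by abel
      rw [e'] at h4
      exact ⟨_, Finset.mem_coe.2 (Finset.mem_image.2 ⟨f, hf, rfl⟩), h4⟩)
  obtain ⟨f, hf, rfl⟩ := Finset.mem_image.1 hz
  refine ⟨e.S t - f, fun v hv => ?_, ?_⟩
  · have : v - (f - e.S t) ∈ V := h3 hv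
    rwa [sub_sub_eq_add_sub, add_sub_assoc] at this
  · rw [map_sub, Ex.A_S, sub_sub_cancel]
    exact hF1 f hf

namespace Sys
variable {X C : Type} [Fintype X] [Fintype C] (σ : Sys G X C)

lemma dist (hH : σ.Had) {x x' : X} (hπ : σ.π x = σ.π x') {z : G} (hz : σ.β x - σ.β x' = σ.R z) : x = x' := by
  obtain ⟨L, h1, h2, h3⟩ := hH
  have hco := col_orth (σ.had_card h2 (σ.π x)) (fun (l : L) (x' : {x' : X // σ.π x' = σ.π x}) => eC (σ.S l.1 (σ.β x'.1)))
    σ.N (by exact_mod_cast σ.hN.ne') (fun i i' => by rw [had_orth σ h3 (σ.π x) i i']; congr) ⟨x, rfl⟩ ⟨x', hπ.symm⟩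
  by_contra hne
  rw [if_neg (fun h => hne (congrArg Subtype.val h))] at hco
  have h4 : ∀ l : L, (starRingEnd ℂ) (eC (σ.S l.1 (σ.β x))) * eC (σ.S l.1 (σ.β x')) = 1 := by
    intro l
    have e1 : σ.β x = σ.β x' + σ.R z := by rw [← hz]; abel
    rw [e1, map_add, eC_add, σ.hSR, (h1 _ l.2).eC, mul_one, mul_comm, eC_mul_conj]
  simp only [h4] at hco
  simp [h2] at hco
  exact σ.hN.ne' hco

lemma shift (hH : σ.Had) {V : Set (Fr G)} (hV : IsClosed V) (hne : V.Nonempty)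
    (hd : ∀ t ∈ σ.SG, (∀ v ∈ V, v + t ∈ V) ∨ (∀ v ∈ V, v + t ∈ σ.D)) (x : X) {r : G}
    (hr : r ∈ perp (Stab V hV)) : ∃ x', σ.π x' = σ.π x ∧ (∃ z, σ.β x' - σ.β x - r = σ.R z) ∧
      ∀ y ∈ V, ∃ n : ℤ, y (σ.β x' - σ.β x) = n := by
  have key : ∀ y ∈ V, ∃ x', σ.π x' = σ.π x ∧ (∃ z, σ.β x' - σ.β x - r = σ.R z) ∧
      ∃ n : ℤ, y (σ.β x' - σ.β x) = n := by
    intro y hy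
    have h1 := indep2 σ.SG (Finset.univ.filter fun x' => σ.π x' = σ.π x) (fun x' => eC (y (σ.β x')))
      (fun x' => σ.β x' + r) (fun x' => σ.β x') (fun t ht => by
        have e1 : ∀ x', eC (y (σ.β x')) * eC (t (σ.β x' + r)) = eC (t r) * eC ((y + t) (σ.β x')) := by
          intro x'; rw [map_add, LinearMap.add_apply, eC_add, eC_add]; ring
        have e2 : ∀ x', eC (y (σ.β x')) * eC (t (σ.β x')) = eC ((y + t) (σ.β x')) := by
          intro x'; rw [LinearMap.add_apply, eC_add]
        simp only [e1, e2, ← Finset.mul_sum]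
        rcases hd t ht with h | h
        · rw [(eC_eq_one_iff _).2 (hr t h), one_mul]
        · have h3 : ∑ x' with σ.π x' = σ.π x, eC ((y + t) (σ.β x')) = 0 := h y hy (σ.π x)
          rw [h3, mul_zero]) (σ.β x + r)
    have h2 : ∑ i ∈ Finset.univ.filter (fun x' => σ.π x' = σ.π x) with IntOn σ.SG (σ.β i + r - (σ.β x + r)),
        eC (y (σ.β i)) = eC (y (σ.β x)) := by
      refine Finset.sum_eq_single_of_mem x ?_ ?_
      · simp only [Finset.mem_filter, Finset.mem_univ, true_and]
        intro t _; exact ⟨0, by simp⟩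
      · intro x' hx' hne
        simp only [Finset.mem_filter, Finset.mem_univ, true_and] at hx'
        obtain ⟨z, hz⟩ := σ.SG_perp hx'.2
        rw [add_sub_add_right_eq_sub] at hz
        exact absurd (σ.dist hH hx'.1 hz) hne
    rw [h2] at h1
    have h3 : (Finset.filter (fun i => IntOn σ.SG (σ.β i - (σ.β x + r)))
        (Finset.univ.filter (fun x' => σ.π x' = σ.π x))).Nonempty := by
      by_contra hcon
      rw [Finset.not_nonempty_iff_eq_empty] at hcon
      rw [hcon, Finset.sum_empty] at h1
      exact eC_ne_zero _ h1
    obtain ⟨x', hx'⟩ := h3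
    rw [Finset.sum_eq_single_of_mem x' hx'] at h1
    · simp only [Finset.mem_filter, Finset.mem_univ, true_and] at hx'
      obtain ⟨z, hz⟩ := σ.SG_perp hx'.2
      refine ⟨x', hx'.1, ⟨z, by rw [← hz]; abel⟩, ?_⟩
      rw [← eC_eq_one_iff, map_sub, eC_sub, ← h1, eC_mul_conj]
    · intro x'' hx'' hne
      simp only [Finset.mem_filter, Finset.mem_univ, true_and] at hx' hx''
      obtain ⟨z, hz⟩ := σ.SG_perp hx'.2
      obtain ⟨z', hz'⟩ := σ.SG_perp hx''.2
      refine absurd (σ.dist hH (z := z' - z) (hx''.1.trans hx'.1.symm) ?_) hne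
      rw [map_sub, ← hz, ← hz']; abel
  obtain ⟨y0, hy0⟩ := hne
  obtain ⟨x', h1, ⟨z, hz⟩, -⟩ := key y0 hy0
  refine ⟨x', h1, ⟨z, hz⟩, fun y hy => ?_⟩
  obtain ⟨x'', h1', ⟨z', hz'⟩, h3⟩ := key y hy
  have : x'' = x' := σ.dist hH (z := z' - z) (h1'.trans h1.symm) (by rw [map_sub, ← hz, ← hz']; abel)
  rw [this] at h3
  exact h3

end Sys
end Split
end HT

namespace HT
open Topology

section Split2
variable {G : Type} [AddCommGroup G] 

lemma fin_quot [Module.Finite ℤ G] (Q : AddSubgroup G) : Module.Finite ℤ (G ⧸ Q) :=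
  Module.Finite.of_surjective (QuotientAddGroup.mk' Q).toIntLinearMap (QuotientAddGroup.mk'_surjective Q)

lemma free_quot [Module.Finite ℤ G] (Q : AddSubgroup G)
    (hs : ∀ (n : ℤ) (g : G), n ≠ 0 → n • g ∈ Q → g ∈ Q) : Module.Free ℤ (G ⧸ Q) := by
  have := fin_quot Q
  have : Module.IsTorsionFree ℤ (G ⧸ Q) := by
    refine Module.IsTorsionFree.mk fun r hr a b hab => ?_
    obtain ⟨a, rfl⟩ := QuotientAddGroup.mk'_surjective Q a
    obtain ⟨b, rfl⟩ := QuotientAddGroup.mk'_surjective Q b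
    have hab : r • (QuotientAddGroup.mk' Q) a = r • (QuotientAddGroup.mk' Q) b := hab
    rw [← map_zsmul, ← map_zsmul, QuotientAddGroup.mk'_eq_mk'] at hab
    obtain ⟨z, hz, h⟩ := hab
    rw [QuotientAddGroup.mk'_eq_mk']
    refine ⟨b - a, hs r _ hr.ne_zero ?_, by abel⟩
    have : r • (b - a) = z := by rw [zsmul_sub, ← h]; abel
    rw [this]; exact hz
  exact Module.free_of_finite_type_torsion_free'

lemma free_sub [Module.Finite ℤ G] [Module.Free ℤ G] (Q : AddSubgroup G) : Module.Free ℤ Q ∧ Module.Finite ℤ Q := by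
  have h1 : Function.Injective Q.subtype.toIntLinearMap := Subtype.val_injective
  have hf : Module.Finite ℤ Q := Module.Finite.of_injective Q.subtype.toIntLinearMap h1
  have : Module.IsTorsionFree ℤ Q := by
    refine Module.IsTorsionFree.mk fun r hr a b hab => ?_
    apply Subtype.ext
    have hab : r • a = r • b := hab
    have : r • (a : G) = r • (b : G) := by
      have := congrArg (Subtype.val) hab
      simpa using this
    exact smul_right_injective G hr.ne_zero this
  exact ⟨Module.free_of_finite_type_torsion_free', hf⟩

lemma rank_exact {H K : Type} [AddCommGroup H] [AddCommGroup K] [Module.Finite ℤ G]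
    (i : H →ₗ[ℤ] G) (hi : Function.Injective i) (p : G →ₗ[ℤ] K) (hp : Function.Surjective p)
    (he : LinearMap.ker p = LinearMap.range i) :
    Module.finrank ℤ K + Module.finrank ℤ H = Module.finrank ℤ G := by
  rw [← Submodule.finrank_quotient_add_finrank (LinearMap.ker p)]
  rw [(p.quotKerEquivOfSurjective hp).finrank_eq, he, (LinearEquiv.ofInjective i hi).finrank_eq]

/-- a surjective expanding map only lives on the trivial group -/
lemma Ex.trivial_of_surj [Module.Finite ℤ G] [Module.Free ℤ G] (e : Ex G) (M : AddSubgroup G)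
    (hM : ∀ m ∈ M, ∃ m' ∈ M, m = e.R m') (m : G) (hm : m ∈ M) : m = 0 := by
  have h1 : ∀ n : ℕ, ∀ m ∈ M, ∃ m' ∈ M, m = (e.R ^ n) m' := by
    intro n
    induction n with
    | zero => exact fun m hm => ⟨m, hm, rfl⟩
    | succ n ih =>
      intro m hm
      obtain ⟨m1, h1, rfl⟩ := ih m hm
      obtain ⟨m2, h2, rfl⟩ := hM m1 h1
      exact ⟨m2, h2, by rw [pow_succ]; rfl⟩
  have h2 : ∀ᶠ n in atTop, ∀ i : Ix G, |((e.S ^ n) (co i)) m| < 1 := by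
    rw [eventually_all]
    intro i
    have := (e.lim (co i) m).abs
    rw [abs_zero] at this
    exact this.eventually_lt_const one_pos
  obtain ⟨n, hn⟩ := h2.exists
  obtain ⟨m', -, h⟩ := h1 n m hm
  suffices m' = 0 by rw [h, this, map_zero]
  have h3 : ∀ i : Ix G, (co i) m' = 0 := by
    intro i
    have h4 := hn i
    rw [h, Ex.S_pow_R_pow] at h4
    obtain ⟨z, hz⟩ := co_isInt i m'
    rw [hz] at h4 ⊢
    have : |z| < 1 := by exact_mod_cast h4
    rw [Int.abs_lt_one_iff.1 this, Int.cast_zero]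
  refine sep fun k _ => ?_
  rw [fr_eq k]
  simp [h3]

end Split2

namespace Sys
variable {G : Type} [AddCommGroup G] {X C : Type} [Fintype X] [Fintype C] (σ : Sys G X C)

/-- the differences generate, dually -/
def Gen : Prop := ∀ ξ : Fr G, (∀ (n : ℕ) (x x' : X), σ.π x = σ.π x' → ∃ m : ℤ, ((σ.A ^ n) ξ) (σ.β x - σ.β x') = m) → IsInt ξ

/-- a sublattice splitting the system -/
structure Split (Q : AddSubgroup G) : Prop where
  hR : ∀ g ∈ Q, σ.R g ∈ Q
  sat : ∀ (n : ℤ) (g : G), n ≠ 0 → n • g ∈ Q → g ∈ Q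
  ne_bot : Q ≠ ⊥
  ne_top : Q ≠ ⊤
  shift : ∀ (x : X), ∀ r ∈ Q, ∃ x', σ.π x' = σ.π x ∧ σ.β x' - σ.β x ∈ Q ∧ ∃ z, σ.β x' - σ.β x - r = σ.R z

section
attribute [local instance] zT
variable [Module.Free ℤ G] [Module.Finite ℤ G]

lemma exists_split [Nonempty C] (hH : σ.Had) (hG : σ.Gen) {V : Set (Fr G)} (hV : IsClosed V)
    (hi : _root_.IsIrreducible V) (hVu : V ≠ Set.univ) (hni : ∃ v ∈ V, ¬ IsInt v) (hT : σ.T V = V)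
    (hd : ∀ t ∈ σ.SG, (∀ v ∈ V, v + t ∈ V) ∨ (∀ v ∈ V, v + t ∈ σ.D)) : ∃ Q, σ.Split Q := by
  obtain ⟨Q, hQ⟩ : ∃ Q, Q = perp (Stab V hV) := ⟨_, rfl⟩
  obtain ⟨v0, hv0⟩ := hi.nonempty
  have hX : Nonempty X := by
    have h := σ.hN
    rw [← σ.fib (Classical.arbitrary C), Finset.card_pos] at h
    exact ⟨h.choose⟩
  have hAV : ∀ v ∈ V, σ.A v ∈ V := fun v hv => by have := σ.A_mem_T hv; rwa [hT] at this
  have hR : ∀ g ∈ Q, σ.R g ∈ Q := by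
    intro g hg
    rw [hQ] at hg ⊢
    intro t ht
    obtain ⟨n, hn⟩ := hg _ (σ.Stab_A hT ht)
    exact ⟨n, by rw [← hn, Ex.A_apply]⟩
  have hR' : ∀ g, σ.R g ∈ Q → g ∈ Q := by
    intro g hg
    rw [hQ] at hg ⊢
    intro t ht
    obtain ⟨s, hs, h⟩ := σ.Stab_S hi hT ht
    obtain ⟨n, hn⟩ := hg s hs
    obtain ⟨m, hm⟩ := h g
    refine ⟨m + n, ?_⟩
    rw [LinearMap.sub_apply, Ex.A_apply, hn] at hm
    push_cast; linarith
  have hsh : ∀ (x : X), ∀ r ∈ Q, ∃ x', σ.π x' = σ.π x ∧ (∃ z, σ.β x' - σ.β x - r = σ.R z) ∧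
      ∀ y ∈ V, ∃ n : ℤ, y (σ.β x' - σ.β x) = n :=
    fun x r hr => σ.shift hH hV hi.nonempty hd x (hQ ▸ hr)
  have hQ1 : ∀ g, (∀ y ∈ V, ∃ n : ℤ, y g = n) → g ∈ Q := by
    intro g hg
    rw [hQ]
    intro t ht
    obtain ⟨n, hn⟩ := hg _ hv0
    obtain ⟨m, hm⟩ := hg _ (ht v0 hv0)
    refine ⟨m - n, ?_⟩
    rw [LinearMap.add_apply, hn] at hm
    push_cast; linarith
  have hcl : ∀ x x', σ.π x = σ.π x' → σ.β x - σ.β x' ∈ Q → ∀ y ∈ V, ∃ n : ℤ, y (σ.β x - σ.β x') = n := by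
    intro x x' h1 h2
    obtain ⟨x'', h3, ⟨z, hz⟩, h4⟩ := hsh x' _ h2
    have : x'' = x := σ.dist hH (h3.trans h1.symm) (z := z) (by rw [← hz]; abel)
    rw [← this]; exact h4
  -- the smaller group
  obtain ⟨Q0, hQ0⟩ : ∃ Q0 : AddSubgroup G, ∀ g, g ∈ Q0 ↔ ∀ y ∈ V, ∀ y' ∈ V, ∃ n : ℤ, y g - y' g = n := by
    refine ⟨⟨⟨⟨{g | ∀ y ∈ V, ∀ y' ∈ V, ∃ n : ℤ, y g - y' g = n}, ?_⟩, ?_⟩, ?_⟩, fun g => Iff.rfl⟩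
    · intro a b ha hb y hy y' hy'
      obtain ⟨n, hn⟩ := ha y hy y' hy'
      obtain ⟨m, hm⟩ := hb y hy y' hy'
      exact ⟨n + m, by rw [map_add, map_add]; push_cast; linarith⟩
    · intro y _ y' _; exact ⟨0, by simp⟩
    · intro a ha y hy y' hy'
      obtain ⟨n, hn⟩ := ha y hy y' hy'
      exact ⟨-n, by rw [map_neg, map_neg]; push_cast; linarith⟩
  have hsat : ∀ (n : ℤ) (g : G), n ≠ 0 → n • g ∈ Q0 → g ∈ Q0 := by
    intro n g hn hg
    rw [hQ0] at hg
    have hn' : (n : ℝ) ≠ 0 := by exact_mod_cast hn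
    obtain ⟨z, hz, h3⟩ := isIrreducible_iff_sUnion_isClosed.1 hi
      ((Finset.range n.natAbs).image fun j : ℕ => {ξ : Fr G | ∃ k : ℤ, ξ g - v0 g - j / n = k}) (by
        intro z hz
        obtain ⟨j, _, rfl⟩ := Finset.mem_image.1 hz
        have h := isClosed_tp (Finset.univ : Finset (Fin 2)) ![1, - eC (v0 g + j / n)] ![g, 0]
        have e : {ξ : Fr G | ∃ k : ℤ, ξ g - v0 g - j / n = k} =
          {ξ : Fr G | ∑ i : Fin 2, (![1, - eC (v0 g + j / n)] : Fin 2 → ℂ) i * eC (ξ ((![g, 0] : Fin 2 → G) i)) = 0} := by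
          ext ξ
          simp only [Set.mem_ofPred_eq, Fin.sum_univ_two]
          rw [← eC_eq_one_iff]
          simp only [Matrix.cons_val_zero, Matrix.cons_val_one, map_zero, eC_zero]
          rw [sub_sub, eC_sub]
          constructor
          · intro h
            have h5 := congrArg (fun w => w * eC (v0 g + j / n)) h
            simp only [mul_assoc, one_mul] at h5
            rw [mul_comm ((starRingEnd ℂ) _), eC_mul_conj] at h5
            rw [mul_one] at h5
            rw [h5]; ring
          · intro h
            have h5 : eC (ξ g) = eC (v0 g + j / n) := by linear_combination h
            rw [h5, eC_mul_conj]
        rw [e]; exact h) (by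
        intro v hv
        obtain ⟨k, hk⟩ := hg v hv v0 hv0
        refine ⟨_, Finset.mem_coe.2 (Finset.mem_image.2 ⟨(k % n).toNat, ?_, rfl⟩), ?_⟩
        · rw [Finset.mem_range]
          have h1 := Int.emod_nonneg k hn
          have h2 := Int.emod_lt_abs k hn
          rw [Int.abs_eq_natAbs] at h2
          omega
        · refine ⟨k / n, ?_⟩
          have h1 : (((k % n).toNat : ℕ) : ℝ) = ((k % n : ℤ) : ℝ) := by
            have := Int.toNat_of_nonneg (Int.emod_nonneg k hn)
            exact_mod_cast this
          rw [h1]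
          rw [map_zsmul, map_zsmul, zsmul_eq_mul, zsmul_eq_mul] at hk
          have h2 : ((k % n : ℤ) : ℝ) + n * ((k / n : ℤ) : ℝ) = k := by exact_mod_cast Int.emod_add_mul_ediv k n
          field_simp
          linarith)
    obtain ⟨j, _, rfl⟩ := Finset.mem_image.1 hz
    rw [hQ0]
    intro y hy y' hy'
    obtain ⟨k, hk⟩ := h3 hy
    obtain ⟨k', hk'⟩ := h3 hy'
    exact ⟨k - k', by push_cast; linarith⟩
  have hR0 : ∀ g ∈ Q0, σ.R g ∈ Q0 := by
    intro g hg
    rw [hQ0] at hg ⊢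
    intro y hy y' hy'
    exact hg _ (hAV y hy) _ (hAV y' hy')
  have := fin_quot Q0
  have := free_quot Q0 hsat
  have hQQ0 : Q ≤ Q0 := by
    obtain ⟨e', he1, he2⟩ := σ.toEx.exists_quot (QuotientAddGroup.mk' Q0).toIntLinearMap
      (QuotientAddGroup.mk'_surjective Q0)
      (QuotientAddGroup.map Q0 Q0 σ.R.toAddMonoidHom hR0).toIntLinearMap (fun x => rfl)
    intro g hg
    rw [← QuotientAddGroup.eq_zero_iff]
    refine e'.trivial_of_surj (Q.map (QuotientAddGroup.mk' Q0)) ?_ _ ⟨g, hg, rfl⟩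
    rintro _ ⟨r, hr, rfl⟩
    obtain ⟨x', h1, ⟨z, hz⟩, h2⟩ := hsh (Classical.arbitrary X) r hr
    have h3 := hQ1 _ h2
    have h4 : σ.R (-z) = r - (σ.β x' - σ.β (Classical.arbitrary X)) := by
      rw [map_neg, ← hz]; abel
    refine ⟨_, ⟨-z, hR' _ ?_, rfl⟩, ?_⟩
    · rw [h4]; exact Q.sub_mem hr h3
    · rw [he1]
      show (QuotientAddGroup.mk' Q0) r = QuotientAddGroup.mk' Q0 (σ.R (-z))
      rw [h4, map_sub, eq_comm, sub_eq_self]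
      rw [QuotientAddGroup.mk'_apply, QuotientAddGroup.eq_zero_iff, hQ0]
      intro y hy y' hy'
      obtain ⟨n, hn⟩ := h2 y hy
      obtain ⟨m, hm⟩ := h2 y' hy'
      exact ⟨n - m, by rw [hn, hm]; push_cast; rfl⟩
  have hQ0Q : Q0 ≤ Q := by
    intro g hg
    rw [hQ]
    rw [hQ0] at hg
    intro t ht
    obtain ⟨n, hn⟩ := hg _ (ht v0 hv0) _ hv0
    exact ⟨n, by rw [← hn, LinearMap.add_apply]; ring⟩
  refine ⟨Q, hR, fun n g hn hg => hQ0Q (hsat n g hn (hQQ0 hg)), ?_, ?_, ?_⟩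
  · intro hb
    apply hVu
    rw [Set.eq_univ_iff_forall]
    intro ξ
    have h1 : ξ - v0 ∈ Stab V hV := by
      refine mem_of_perp (isClosed_Stab V hV) ?_
      intro g hg
      rw [← hQ, hb, AddSubgroup.mem_bot] at hg
      exact ⟨0, by simp [hg]⟩
    have := h1 v0 hv0
    rwa [add_sub_cancel] at this
  · intro ht
    obtain ⟨v, hv, hvn⟩ := hni
    apply hvn
    refine hG v fun n x x' hπ => ?_
    have hn : (σ.A ^ n) v ∈ V := by
      clear hvn
      induction n with
      | zero => exact hv
      | succ n ih => rw [pow_succ']; exact hAV _ ih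
    exact hcl x x' hπ (by rw [ht]; trivial) _ hn
  · intro x r hr
    obtain ⟨x', h1, h2, h3⟩ := hsh x r hr
    exact ⟨x', h1, hQ1 _ h3, h2⟩

end
end Sys
end HT

namespace HT
open Topology

/-! ### The two factors of a split system -/

lemma orth_card {I J : Type} [Fintype I] [Fintype J] (u : I → J → ℂ) (K : ℂ) (hK : K ≠ 0)
    (ho : ∀ i i', ∑ j, u i j * (starRingEnd ℂ) (u i' j) = if i = i' then K else 0) :
    Fintype.card I ≤ Fintype.card J := by
  have h : LinearIndependent ℂ u := by
    rw [Fintype.linearIndependent_iff]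
    intro a ha i
    have h1 : ∑ j, (∑ i', a i' • u i') j * (starRingEnd ℂ) (u i j) = 0 := by
      rw [ha]; simp
    have h2 : ∑ j, (∑ i', a i' • u i') j * (starRingEnd ℂ) (u i j) = a i * K := by
      simp only [Finset.sum_apply, Pi.smul_apply, smul_eq_mul, Finset.sum_mul]
      rw [Finset.sum_comm]
      simp only [mul_assoc, ← Finset.mul_sum, ho]
      simp
    rw [h2] at h1
    exact (mul_eq_zero.1 h1).resolve_right hK
  have := h.fintype_card_le_finrank
  rwa [Module.finrank_fintype_fun_eq_card] at this

namespace Sys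
section Fam
variable {G X C : Type} [AddCommGroup G] [Fintype X] [Fintype C] (σ : Sys G X C)

lemma family_orth {I : Type} (η : I → Fr G)
    (ho : ∀ i i', i ≠ i' → ∀ c, σ.ms c (σ.S (η i - η i')) = 0) (c : C) (i i' : I) :
    ∑ x : {x : X // σ.π x = c}, eC (σ.S (η i) (σ.β x.1)) * (starRingEnd ℂ) (eC (σ.S (η i') (σ.β x.1))) =
      if i = i' then (σ.N : ℂ) else 0 := by
  have e1 : ∑ x : {x : X // σ.π x = c}, eC (σ.S (η i) (σ.β x.1)) * (starRingEnd ℂ) (eC (σ.S (η i') (σ.β x.1))) =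
      σ.ms c (σ.S (η i - η i')) := by
    unfold ms
    rw [← Finset.sum_subtype_eq_sum_filter, Finset.subtype_univ]
    refine Finset.sum_congr rfl fun x _ => ?_
    rw [map_sub, LinearMap.sub_apply, eC_sub]
  rw [e1]
  split_ifs with h
  · rw [h, sub_self, map_zero, ms_zero]
  · exact ho i i' h c

lemma family_card {I : Type} [Fintype I] [Nonempty C] (η : I → Fr G)
    (ho : ∀ i i', i ≠ i' → ∀ c, σ.ms c (σ.S (η i - η i')) = 0) : Fintype.card I ≤ σ.N := by
  have c := Classical.arbitrary C
  have := orth_card (fun (i : I) (x : {x : X // σ.π x = c}) => eC (σ.S (η i) (σ.β x.1))) σ.N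
    (by exact_mod_cast σ.hN.ne') (fun i i' => by rw [σ.family_orth η ho c i i'])
  rwa [Fintype.card_subtype, σ.fib] at this

lemma had_of_family {I : Type} [Fintype I] [Nonempty C] (η : I → Fr G) (hη : ∀ i, IsInt (η i))
    (ho : ∀ i i', i ≠ i' → ∀ c, σ.ms c (σ.S (η i - η i')) = 0) (hc : Fintype.card I = σ.N) : σ.Had := by
  have c := Classical.arbitrary C
  have hinj : Function.Injective η := by
    intro i i' h
    by_contra hne
    have := ho i i' hne c
    rw [h, sub_self, map_zero, ms_zero] at this
    exact σ.hN.ne' (by exact_mod_cast this)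
  refine ⟨Finset.univ.image η, ?_, ?_, ?_⟩
  · intro l hl
    obtain ⟨i, _, rfl⟩ := Finset.mem_image.1 hl
    exact hη i
  · rw [Finset.card_image_of_injective _ hinj, Finset.card_univ, hc]
  · intro l hl l' hl' hne
    obtain ⟨i, _, rfl⟩ := Finset.mem_image.1 hl
    obtain ⟨i', _, rfl⟩ := Finset.mem_image.1 hl'
    exact ho i i' fun h => hne (by rw [h])

end Fam

/-- integer functionals as a subgroup -/
def intSub (H : Type) [AddCommGroup H] : AddSubgroup (Fr H) where
  carrier := {ξ | IsInt ξ}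
  zero_mem' := IsInt.zero
  add_mem' := fun ha hb => IsInt.add ha hb
  neg_mem' := fun ha => IsInt.neg ha

section Fac
variable {G H K X C : Type} [AddCommGroup G] [AddCommGroup H] [AddCommGroup K] [Fintype X] [Fintype C]
  [Module.Free ℤ G] [Module.Finite ℤ G] [Module.Free ℤ H] [Module.Finite ℤ H] [Module.Free ℤ K] [Module.Finite ℤ K]

lemma factor [Nonempty C] (σ : Sys G X C) (hH : σ.Had) (i : H →ₗ[ℤ] G) (hi : Function.Injective i)
    (p : G →ₗ[ℤ] K) (hp : Function.Surjective p) (hex : ∀ g, p g = 0 ↔ ∃ h, i h = g)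
    (eH : Ex H) (heH : ∀ ξ : Fr G, eH.S (ξ ∘ₗ i) = (σ.S ξ) ∘ₗ i)
    (eK : Ex K) (heK : ∀ ξ : Fr K, σ.S (ξ ∘ₗ p) = (eK.S ξ) ∘ₗ p)
    (hsh : ∀ (x : X) (r : H), ∃ x', σ.π x' = σ.π x ∧ (∃ h, σ.β x' - σ.β x = i h) ∧ ∃ z, σ.β x' - σ.β x - i r = σ.R z) :
    ∃ (Y : Type) (_ : Fintype Y) (_ : Nonempty Y) (σK : Sys K Y C) (σH : Sys H X Y), σK.Had ∧ σH.Had ∧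
      ((∃ Λ, σK.SpecSet Λ) → (∃ Λ, σH.SpecSet Λ) → ∃ Λ, σ.SpecSet Λ) := by
  have hdist := fun {x x'} => σ.dist hH (x := x) (x' := x')
  obtain ⟨f, hf⟩ : ∃ f : X → C × K, ∀ x, f x = (σ.π x, p (σ.β x)) := ⟨_, fun _ => rfl⟩
  have hpi : ∀ h, p (i h) = 0 := fun h => (hex _).2 ⟨h, rfl⟩
  have hff : ∀ x x', f x = f x' ↔ σ.π x = σ.π x' ∧ ∃ h, σ.β x - σ.β x' = i h := by
    intro x x'
    rw [hf, hf, Prod.mk.injEq, ← sub_eq_zero (a := p _), ← map_sub, hex]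
    simp only [eq_comm]
  choose sh hsh1 hsh2 hsh3 using hsh
  have hshf : ∀ x r, f (sh x r) = f x := fun x r => (hff _ _).2 ⟨hsh1 x r, hsh2 x r⟩
  -- all classes have the same size
  have hcard : ∀ x y, (Finset.univ.filter fun x' => f x' = f x).card ≤ (Finset.univ.filter fun y' => f y' = f y).card := by
    intro x y
    have hd : ∀ x', ∃ h : H, f x' = f x → σ.β x' - σ.β x = i h := by
      intro x'
      by_cases h : f x' = f x
      · obtain ⟨k, hk⟩ := ((hff _ _).1 h).2
        exact ⟨k, fun _ => hk⟩
      · exact ⟨0, fun h' => absurd h' h⟩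
    choose δ hδ using hd
    refine Finset.card_le_card_of_injOn (fun x' => sh y (δ x')) ?_ ?_
    · intro x' _
      simp [hshf]
    · intro x1 h1 x2 h2 h
      simp only [Finset.coe_filter, Finset.mem_univ, true_and, Set.mem_ofPred_eq] at h1 h2
      have h : sh y (δ x1) = sh y (δ x2) := h
      obtain ⟨z1, hz1⟩ := hsh3 y (δ x1)
      obtain ⟨z2, hz2⟩ := hsh3 y (δ x2)
      rw [h] at hz1
      rw [← hδ _ h1] at hz1
      rw [← hδ _ h2] at hz2
      refine hdist (z := z2 - z1) ?_ ?_
      · rw [((hff _ _).1 h1).1, ((hff _ _).1 h2).1]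
      · rw [map_sub, ← hz1, ← hz2]; abel
  have hX : Nonempty X := by
    have h := σ.hN
    rw [← σ.fib (Classical.arbitrary C), Finset.card_pos] at h
    exact ⟨h.choose⟩
  obtain ⟨N2, hN2⟩ : ∃ N2, ∀ x, (Finset.univ.filter fun x' => f x' = f x).card = N2 :=
    ⟨_, fun x => le_antisymm (hcard x (Classical.arbitrary X)) (hcard _ _)⟩
  have hN2pos : 0 < N2 := by
    rw [← hN2 (Classical.arbitrary X), Finset.card_pos]
    exact ⟨Classical.arbitrary X, by simp⟩
  obtain ⟨Y, hY⟩ : ∃ Y : Type, Y = Set.range f := ⟨_, rfl⟩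
  obtain ⟨q, hq, hqs⟩ : ∃ q : X → Set.range f, (∀ x, (q x).1 = f x) ∧ Function.Surjective q :=
    ⟨Set.rangeFactorization f, fun _ => rfl, Set.rangeFactorization_surjective⟩
  have hqe : ∀ x x', q x = q x' ↔ f x = f x' := fun x x' => by rw [← Subtype.val_inj, hq, hq]
  obtain ⟨rep, hrep⟩ := hqs.hasRightInverse
  have hfib2 : ∀ y : Set.range f, (Finset.univ.filter fun x => q x = y).card = N2 := by
    intro y
    obtain ⟨x, rfl⟩ := hqs y
    rw [← hN2 x]
    congr 1
    ext x'
    simp [hqe]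
  have hsum : ∀ (F : Set.range f → ℂ) (c : C),
      ∑ x with σ.π x = c, F (q x) = N2 * ∑ y : Set.range f with y.1.1 = c, F y := by
    intro F c
    rw [← Finset.sum_fiberwise_of_maps_to (s := Finset.univ.filter fun x => σ.π x = c) (g := q)
      (t := Finset.univ.filter fun y : Set.range f => y.1.1 = c) (by
        intro x hx
        simp only [Finset.mem_filter, Finset.mem_univ, true_and] at hx ⊢
        rw [hq, hf, hx]), Finset.mul_sum]
    refine Finset.sum_congr rfl fun y hy => ?_
    simp only [Finset.mem_filter, Finset.mem_univ, true_and] at hy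
    rw [← hfib2 y, ← nsmul_eq_mul, ← Finset.sum_const]
    refine Finset.sum_congr ?_ fun x hx => ?_
    · ext x
      simp only [Finset.mem_filter, Finset.mem_univ, true_and]
      refine ⟨fun h => h.2, fun h => ⟨?_, h⟩⟩
      rw [← hy, ← h, hq, hf]
    · rw [(Finset.mem_filter.1 hx).2]
  have hfib1 : ∀ c, N2 * (Finset.univ.filter fun y : Set.range f => y.1.1 = c).card = σ.N := by
    intro c
    have := hsum (fun _ => 1) c
    simp only [Finset.sum_const, nsmul_eq_mul, mul_one, σ.fib] at this
    exact_mod_cast this.symm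
  obtain ⟨N1, hN1⟩ : ∃ N1, ∀ c, (Finset.univ.filter fun y : Set.range f => y.1.1 = c).card = N1 :=
    ⟨_, fun c => Nat.eq_of_mul_eq_mul_left hN2pos ((hfib1 c).trans (hfib1 (Classical.arbitrary C)).symm)⟩
  have hN12 : N2 * N1 = σ.N := by rw [← hN1 (Classical.arbitrary C), hfib1]
  have hN1pos : 0 < N1 := by
    rcases Nat.eq_zero_or_pos N1 with h | h
    · rw [h, mul_zero] at hN12; exact absurd hN12.symm σ.hN.ne'
    · exact h
  have hδ : ∀ x, ∃ h, σ.β x = σ.β (rep (q x)) + i h := by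
    intro x
    obtain ⟨_, h, hh⟩ := (hff x (rep (q x))).1 ((hqe _ _).1 (hrep (q x)).symm)
    exact ⟨h, by rw [← hh]; abel⟩
  choose δ hδ using hδ
  let σK : Sys K (Set.range f) C := ⟨eK, fun y => y.1.1, fun y => y.1.2, N1, hN1pos, fun c => by
    convert hN1 c⟩
  let σH : Sys H X (Set.range f) := ⟨eH, q, δ, N2, hN2pos, fun y => by convert hfib2 y⟩
  let σ1 : Sys G (Set.range f) C := ⟨σ.toEx, fun y => y.1.1, fun y => σ.β (rep y), N1, hN1pos, fun c => by
    convert hN1 c⟩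
  have hYne : Nonempty (Set.range f) := ⟨q (Classical.arbitrary X)⟩
  have hβp : ∀ y : Set.range f, y.1.2 = p (σ.β (rep y)) := by
    intro y
    have := hq (rep y)
    rw [hrep y, hf] at this
    rw [this]
  obtain ⟨L, hL1, hL2, hL3⟩ := hH
  obtain ⟨s, hs⟩ := Module.projective_lifting_property p LinearMap.id hp
  have hs' : ∀ k, p (s k) = k := fun k => LinearMap.congr_fun hs k
  have hsi : ∀ g, ∃ h, i h = g - s (p g) := fun g => by
    rw [← hex, map_sub, hs', sub_self]
  let cl : Fr G → Fr H ⧸ intSub H := fun l => QuotientAddGroup.mk ((σ.S l) ∘ₗ i)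
  have hcl : ∀ l l', cl l = cl l' ↔ IsInt ((σ.S (l' - l)) ∘ₗ i) := by
    intro l l'
    show (QuotientAddGroup.mk _ : Fr H ⧸ intSub H) = QuotientAddGroup.mk _ ↔ _
    rw [QuotientAddGroup.eq, neg_add_eq_sub]
    rw [map_sub, LinearMap.sub_comp]
    rfl
  -- a family for the quotient
  have hfam1 : ∀ l0, ∃ η : Fr G → Fr K, (∀ l ∈ L, l0 ∈ L → cl l0 = cl l → IsInt (η l)) ∧
      ∀ l ∈ L, ∀ l' ∈ L, cl l = cl l' → l ≠ l' → ∀ c, σK.ms c (σK.S (η l - η l')) = 0 := by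
    intro l0
    refine ⟨fun l => eK.A ((σ.S (l - l0)) ∘ₗ s), ?_, ?_⟩
    · intro l hl hl0 hc
      rw [hcl] at hc
      have e1 : ∀ g, (eK.A ((σ.S (l - l0)) ∘ₗ s)) (p g) = (l - l0) g - σ.S (l - l0) (σ.R g - s (p (σ.R g))) := by
        intro g
        have h2 := heK (eK.A ((σ.S (l - l0)) ∘ₗ s))
        rw [Ex.S_A] at h2
        have h3 := LinearMap.congr_fun h2 (σ.R g)
        rw [σ.hSR] at h3
        rw [map_sub (σ.S (l - l0)), σ.hSR]
        simp only [LinearMap.comp_apply] at h3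
        rw [h3]; ring
      intro k
      obtain ⟨g, rfl⟩ := hp k
      show ∃ n : ℤ, (eK.A ((σ.S (l - l0)) ∘ₗ s)) (p g) = n
      rw [e1]
      obtain ⟨h, hh⟩ := hsi (σ.R g)
      rw [← hh]
      obtain ⟨n, hn⟩ := hc h
      obtain ⟨m, hm⟩ := (hL1 l hl).sub (hL1 l0 hl0) g
      rw [LinearMap.comp_apply] at hn
      exact ⟨m - n, by rw [hn, hm]; push_cast; rfl⟩
    · intro l hl l' hl' hc hne c
      have hc := (hcl _ _).1 hc.symm
      have e1 : σK.S (eK.A ((σ.S (l - l0)) ∘ₗ s) - eK.A ((σ.S (l' - l0)) ∘ₗ s)) = (σ.S (l - l')) ∘ₗ s := by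
        show eK.S _ = _
        rw [map_sub, Ex.S_A, Ex.S_A, ← LinearMap.sub_comp, ← map_sub, sub_sub_sub_cancel_right]
      show σK.ms c (σK.S (eK.A ((σ.S (l - l0)) ∘ₗ s) - eK.A ((σ.S (l' - l0)) ∘ₗ s))) = 0
      rw [e1]
      have h1 := hsum (fun y => eC (((σ.S (l - l')) ∘ₗ s) y.1.2)) c
      have h2 : ∑ x with σ.π x = c, eC (((σ.S (l - l')) ∘ₗ s) (q x).1.2) = 0 := by
        rw [← hL3 l hl l' hl' hne c]
        refine Finset.sum_congr rfl fun x _ => ?_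
        rw [hq, hf]
        obtain ⟨h, hh⟩ := hsi (σ.β x)
        have h5 : σ.β x = s (p (σ.β x)) + i h := by rw [hh]; abel
        show eC (σ.S (l - l') (s (p (σ.β x)))) = _
        conv_rhs => rw [h5, map_add, eC_add]
        have h6 : eC (σ.S (l - l') (i h)) = 1 := (eC_eq_one_iff _).2 (hc h)
        rw [h6, mul_one]
      rw [h2, eq_comm, mul_eq_zero] at h1
      have h7 := h1.resolve_left (by exact_mod_cast hN2pos.ne')
      convert h7 using 1
      unfold ms
      refine Finset.sum_congr ?_ fun y _ => rfl
      ext y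
      simp [σK]
  have hcl1 : ∀ a, (L.filter fun l => cl l = a).card ≤ N1 := by
    intro a
    rcases (L.filter fun l => cl l = a).eq_empty_or_nonempty with h | ⟨l0, h0⟩
    · rw [h]; simp
    obtain ⟨η, -, hη⟩ := hfam1 l0
    have := σK.family_card (I := (L.filter fun l => cl l = a)) (fun l => η l.1) (by
      intro l l' hne c
      have h1 := Finset.mem_filter.1 l.2
      have h2 := Finset.mem_filter.1 l'.2
      exact hη _ h1.1 _ h2.1 (h1.2.trans h2.2.symm) (fun h => hne (Subtype.ext h)) c)
    rwa [Fintype.card_coe] at this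
  -- a family for the subgroup
  have hfam2 : ∀ l l', l ∈ L → l' ∈ L → cl l ≠ cl l' → ∀ y, σH.ms y (σH.S ((l ∘ₗ i) - (l' ∘ₗ i))) = 0 := by
    intro l l' hl hl' hne y
    have e1 : σH.S ((l ∘ₗ i) - (l' ∘ₗ i)) = (σ.S (l - l')) ∘ₗ i := by
      rw [← LinearMap.sub_comp]
      exact heH _
    rw [e1]
    have h1 : ¬ IsInt ((σ.S (l - l')) ∘ₗ i) := fun h => hne ((hcl _ _).2 h).symm
    unfold IsInt at h1
    push Not at h1
    obtain ⟨r, hr⟩ := h1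
    have hinj : Function.Injective (fun x => sh x r) := by
      intro x x' h
      have h : sh x r = sh x' r := h
      obtain ⟨z1, hz1⟩ := hsh3 x r
      obtain ⟨z2, hz2⟩ := hsh3 x' r
      rw [h] at hz1
      refine hdist (z := z2 - z1) ?_ ?_
      · rw [← hsh1 x r, ← hsh1 x' r, h]
      · rw [map_sub, ← hz1, ← hz2]; abel
    obtain ⟨E, hE⟩ : ∃ E : X ≃ X, ∀ x, E x = sh x r :=
      ⟨Equiv.ofBijective _ (Finite.injective_iff_bijective.1 hinj), fun _ => rfl⟩
    have hqE : ∀ x, q (E x) = q x := fun x => by rw [hqe, hE, hshf]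
    have h2 : ∀ x, eC ((σ.S (l - l')) (i (δ (E x)))) = eC (σ.S (l - l') (i r)) * eC ((σ.S (l - l')) (i (δ x))) := by
      intro x
      obtain ⟨z, hz⟩ := hsh3 x r
      rw [← hE] at hz
      have h3 : i (δ (E x)) = i r + i (δ x) + σ.R z := by
        have h4 := hδ (E x)
        have h5 := hδ x
        rw [hqE] at h4
        rw [h4] at hz
        rw [← hz]
        have h6 : i (δ x) = σ.β x - σ.β (rep (q x)) := by
          rw [eq_sub_iff_add_eq', ← h5]
        rw [h6]
        abel
      rw [h3, map_add, map_add, eC_add, eC_add, σ.hSR, ((hL1 l hl).sub (hL1 l' hl')).eC, mul_one]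
    have h3 : σH.ms y ((σ.S (l - l')) ∘ₗ i) = eC (σ.S (l - l') (i r)) * σH.ms y ((σ.S (l - l')) ∘ₗ i) := by
      have e2 : σH.ms y ((σ.S (l - l')) ∘ₗ i) = ∑ x, if q x = y then eC ((σ.S (l - l')) (i (δ x))) else 0 := by
        unfold ms
        rw [Finset.sum_filter]
        refine Finset.sum_congr rfl fun x _ => ?_
        have e3 : σH.π x = q x := rfl
        by_cases h : q x = y
        · rw [if_pos h, if_pos (e3.trans h)]; rfl
        · rw [if_neg h, if_neg h]
      rw [e2]
      conv_lhs => rw [← Equiv.sum_comp E]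
      rw [Finset.mul_sum]
      refine Finset.sum_congr rfl fun x _ => ?_
      rw [hqE, h2, mul_ite, mul_zero]
    have h4 : eC (σ.S (l - l') (i r)) ≠ 1 := by
      intro h
      obtain ⟨n, hn⟩ := (eC_eq_one_iff _).1 h
      exact hr n hn
    have h5 : (eC (σ.S (l - l') (i r)) - 1) * σH.ms y ((σ.S (l - l')) ∘ₗ i) = 0 := by linear_combination -h3
    exact (mul_eq_zero.1 h5).resolve_left (sub_ne_zero.2 h4)
  have hrp : ∀ a : L.image cl, ∃ l ∈ L, cl l = a := fun a => Finset.mem_image.1 a.2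
  choose rp hrp1 hrp2 using hrp
  have hfam2' : ∀ a b : L.image cl, a ≠ b → ∀ y, σH.ms y (σH.S (((rp a) ∘ₗ i) - ((rp b) ∘ₗ i))) = 0 :=
    fun a b hab => hfam2 _ _ (hrp1 a) (hrp1 b) (fun h => hab (Subtype.ext (by rw [← hrp2, ← hrp2, h])))
  have hcl2 : (L.image cl).card ≤ N2 := by
    have := σH.family_card (fun a : L.image cl => (rp a) ∘ₗ i) hfam2'
    rwa [Fintype.card_coe] at this
  have hcl3 : N2 ≤ (L.image cl).card := by
    have h1 := Finset.card_le_mul_card_image (f := cl) L N1 (fun a _ => hcl1 a)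
    rw [hL2, ← hN12, mul_comm] at h1
    exact Nat.le_of_mul_le_mul_left h1 hN1pos
  obtain ⟨a, ha⟩ : ∃ a, N1 ≤ (L.filter fun l => cl l = a).card := by
    by_contra! hcon
    have h1 := Finset.card_le_mul_card_image (f := cl) L (N1 - 1) (fun a _ => Nat.le_sub_one_of_lt (hcon a))
    rw [hL2, ← hN12, le_antisymm hcl2 hcl3, mul_comm] at h1
    have := Nat.le_of_mul_le_mul_right h1 hN2pos
    omega
  have hσH : σH.Had := σH.had_of_family (fun a : L.image cl => (rp a) ∘ₗ i) (fun a => (hL1 _ (hrp1 a)).comp i)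
    hfam2' (by rw [Fintype.card_coe]; exact le_antisymm hcl2 hcl3)
  have hσK : σK.Had := by
    have hcN : (L.filter fun l => cl l = a).card = N1 := le_antisymm (hcl1 a) ha
    obtain ⟨l0, h0⟩ : (L.filter fun l => cl l = a).Nonempty := Finset.card_pos.1 (by rw [hcN]; exact hN1pos)
    obtain ⟨h0, h0'⟩ := Finset.mem_filter.1 h0
    obtain ⟨η, hη1, hη⟩ := hfam1 l0
    refine σK.had_of_family (I := (L.filter fun l => cl l = a)) (fun l => η l.1) ?_ ?_ ?_
    · intro l
      have h1 := Finset.mem_filter.1 l.2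
      exact hη1 _ h1.1 h0 (h0'.trans h1.2.symm)
    · intro l l' hne c
      have h1 := Finset.mem_filter.1 l.2
      have h2 := Finset.mem_filter.1 l'.2
      exact hη _ h1.1 _ h2.1 (h1.2.trans h2.2.symm) (fun h => hne (Subtype.ext h)) c
    · rw [Fintype.card_coe]; exact hcN
  refine ⟨Set.range f, inferInstance, hYne, σK, σH, hσK, hσH, ?_⟩
  rintro ⟨Λ1, h1⟩ ⟨Λ2, h2⟩
  have h3 := σ1.pullback σK p rfl (fun y => hβp y) heK h1
  refine σ.compose σ1 σH i hi (fun x => ?_) (fun x => hδ x) rfl heH h3 h2 ?_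
  · show (q x).1.1 = _
    rw [hq, hf]
  · rintro _ ⟨η, _, rfl⟩
    ext h
    show η (p (i h)) = 0
    rw [hpi, map_zero]

end Fac
end Sys
end HT

namespace HT
open Topology

/-! ### The induction -/

lemma exists_restr {G : Type} [AddCommGroup G] (R : G →ₗ[ℤ] G) (Q : AddSubgroup G) (h : ∀ g ∈ Q, R g ∈ Q) :
    ∃ R' : Q →ₗ[ℤ] Q, ∀ g : Q, ((R' g : Q) : G) = R g :=
  ⟨(AddMonoidHom.mk' (fun g : Q => (⟨R g, h _ g.2⟩ : Q)) (fun a b => Subtype.ext (by simp))).toIntLinearMap,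
    fun _ => rfl⟩

namespace Sys
variable {G X C : Type} [AddCommGroup G] [Fintype X] [Fintype C]

lemma npow_gen (σ : Sys G X C) [Nonempty C] (p : ℕ) (hp : 0 < p) (hG : σ.Gen) : (σ.npow p hp).Gen := by
  have hX : Nonempty X := by
    have h := σ.hN
    rw [← σ.fib (Classical.arbitrary C), Finset.card_pos] at h
    exact ⟨h.choose⟩
  intro ξ hξ
  refine hG ξ fun n x x' hx => ?_
  have hlt : n % p < p := Nat.mod_lt _ hp
  let j : Fin p := ⟨p - 1 - n % p, by omega⟩
  let w : X → Fin p → X := fun x => Function.update (fun _ => Classical.arbitrary X) j x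
  obtain ⟨m, hm⟩ := hξ (n / p) (w x) (w x') (by
    funext i
    show σ.π (w x i) = σ.π (w x' i)
    by_cases h : i = j
    · subst h; simp [w, hx]
    · simp [w, h])
  refine ⟨m, ?_⟩
  rw [← hm]
  have e1 : (σ.npow p hp).β (w x) - (σ.npow p hp).β (w x') = (σ.R ^ (n % p)) (σ.β x - σ.β x') := by
    show ∑ i : Fin p, (σ.R ^ (p - 1 - (i : ℕ))) (σ.β (w x i)) - ∑ i : Fin p, (σ.R ^ (p - 1 - (i : ℕ))) (σ.β (w x' i)) = _
    rw [← Finset.sum_sub_distrib, Finset.sum_eq_single j]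
    · have e : p - 1 - (j : ℕ) = n % p := by simp only [j]; omega
      rw [e]; simp [w]
    · intro i _ h
      simp [w, h]
    · simp
  have e2 : ∀ g, (((σ.npow p hp).A ^ (n / p)) ξ) g = ((σ.A ^ (p * (n / p))) ξ) g := by
    intro g
    rw [Ex.A_pow_apply, Ex.A_pow_apply]
    have : (σ.npow p hp).R = σ.R ^ p := rfl
    rw [this, ← pow_mul]
  rw [e1, e2, Ex.A_pow_apply, Ex.A_pow_apply, ← Module.End.mul_apply, ← pow_add, Nat.div_add_mod]

lemma exists_gen (σ : Sys G X C) [Module.Free ℤ G] [Module.Finite ℤ G] [Nonempty C] (hH : σ.Had) :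
    ∃ (H : Type) (_ : AddCommGroup H) (_ : Module.Free ℤ H) (_ : Module.Finite ℤ H) (σ' : Sys H X C),
      Module.finrank ℤ H ≤ Module.finrank ℤ G ∧ σ'.Had ∧ σ'.Gen ∧ ((∃ Λ, σ'.SpecSet Λ) → ∃ Λ, σ.SpecSet Λ) := by
  have hs : ∀ c, ∃ x, σ.π x = c := by
    intro c
    have h := σ.hN
    rw [← σ.fib c, Finset.card_pos] at h
    obtain ⟨x, hx⟩ := h
    exact ⟨x, (Finset.mem_filter.1 hx).2⟩
  choose s hs using hs
  let Q : AddSubgroup G := AddSubgroup.closure {g | ∃ (n : ℕ) (x x' : X), σ.π x = σ.π x' ∧ g = (σ.R ^ n) (σ.β x - σ.β x')}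
  have hRQ : ∀ g ∈ Q, σ.R g ∈ Q := by
    have : Q ≤ Q.comap σ.R.toAddMonoidHom := by
      rw [AddSubgroup.closure_le]
      rintro _ ⟨n, x, x', h, rfl⟩
      refine AddSubgroup.subset_closure ⟨n + 1, x, x', h, ?_⟩
      rw [pow_succ']; rfl
    exact fun g hg => this hg
  obtain ⟨R', hR'⟩ := exists_restr σ.R Q hRQ
  obtain ⟨hfree, hfin⟩ := free_sub Q
  have hi : Function.Injective Q.subtype.toIntLinearMap := Subtype.val_injective
  obtain ⟨e', he1, he2⟩ := σ.toEx.exists_sub Q.subtype.toIntLinearMap hi R' hR'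
  have hβ : ∀ x, σ.β x - σ.β (s (σ.π x)) ∈ Q := fun x =>
    AddSubgroup.subset_closure ⟨0, x, s (σ.π x), (hs _).symm, rfl⟩
  obtain ⟨σ', h1, h2, h3, h4, h5⟩ := σ.normalize hH e' Q.subtype.toIntLinearMap hi he2 s hs
    (fun x => ⟨_, hβ x⟩) (fun x => by
      show σ.β x = σ.β (s (σ.π x)) + (σ.β x - σ.β (s (σ.π x)))
      abel)
  refine ⟨Q, inferInstance, hfree, hfin, σ', ?_, h4, ?_, h5⟩
  · exact LinearMap.finrank_le_finrank_of_injective hi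
  · intro ξ hξ
    have hRn : ∀ (n : ℕ) (g : Q), (((R' ^ n) g : Q) : G) = (σ.R ^ n) g := by
      intro n
      induction n with
      | zero => intro g; rfl
      | succ n ih =>
        intro g
        rw [pow_succ', pow_succ', Module.End.mul_apply, Module.End.mul_apply, hR', ih]
    let P : AddSubgroup Q :=
      { carrier := {g | ∃ m : ℤ, ξ g = m}
        zero_mem' := ⟨0, by simp⟩
        add_mem' := by
          rintro a b ⟨n, hn⟩ ⟨m, hm⟩
          exact ⟨n + m, by rw [map_add, hn, hm]; push_cast; rfl⟩
        neg_mem' := by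
          rintro a ⟨n, hn⟩
          exact ⟨-n, by rw [map_neg, hn]; push_cast; rfl⟩ }
    have hQP : Q ≤ P.map Q.subtype := by
      conv_lhs => simp only [Q]
      rw [AddSubgroup.closure_le]
      rintro _ ⟨n, x, x', h, rfl⟩
      obtain ⟨m, hm⟩ := hξ n x x' (by rw [h2]; exact h)
      rw [Ex.A_pow_apply, h1, he1, h3] at hm
      refine ⟨_, ⟨m, hm⟩, ?_⟩
      show (((R' ^ n) _ : Q) : G) = _
      rw [hRn]
      congr 1
      show (σ.β x - σ.β (s (σ.π x))) - (σ.β x' - σ.β (s (σ.π x'))) = _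
      rw [h]; abel
    intro g
    obtain ⟨g', hg', h⟩ := hQP g.2
    have : g' = g := Subtype.ext h
    rw [← this]; exact hg'

theorem main (n : ℕ) : ∀ (G X C : Type) [AddCommGroup G] [Module.Free ℤ G] [Module.Finite ℤ G] [Fintype X] [Fintype C]
    [Nonempty C] (σ : Sys G X C), σ.Had → Module.finrank ℤ G = n → ∃ Λ, σ.SpecSet Λ := by
  induction n using Nat.strong_induction_on with
  | _ n ih =>
  intro G0 X0 C0 _ _ _ _ _ _ σ0 hH0 hn
  obtain ⟨G, _, _, _, σ1, hrk, hH1, hG1, hσ1⟩ := σ0.exists_gen hH0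
  apply hσ1
  by_cases hZ : σ1.Z = ∅
  · exact σ1.specSet_of_Z_empty hH1 hZ
  obtain ⟨p, hp, V, hV, hi, hVu, hni, hT, hd⟩ := σ1.step5 hH1 (Set.nonempty_iff_ne_empty.2 hZ)
  have hH := σ1.npow_had p hp hH1
  have hG := σ1.npow_gen p hp hG1
  suffices h : ∃ Λ, (σ1.npow p hp).SpecSet Λ by
    obtain ⟨Λ, h⟩ := h
    exact ⟨Λ, σ1.npow_spec p hp h⟩
  obtain ⟨Q, hQ⟩ := (σ1.npow p hp).exists_split hH hG hV hi hVu hni hT hd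
  obtain ⟨σ, hσ⟩ : ∃ σ, σ = σ1.npow p hp := ⟨_, rfl⟩
  rw [← hσ] at hH hQ ⊢
  have hfinq := fin_quot Q
  have hfreeq := free_quot Q hQ.sat
  obtain ⟨hfree, hfin⟩ := free_sub Q
  obtain ⟨R', hR'⟩ := exists_restr σ.R Q hQ.hR
  have hinj : Function.Injective Q.subtype.toIntLinearMap := Subtype.val_injective
  have hsurj : Function.Surjective (QuotientAddGroup.mk' Q).toIntLinearMap := QuotientAddGroup.mk'_surjective Q
  obtain ⟨eH, -, heH⟩ := σ.toEx.exists_sub Q.subtype.toIntLinearMap hinj R' hR'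
  obtain ⟨eK, -, heK⟩ := σ.toEx.exists_quot (QuotientAddGroup.mk' Q).toIntLinearMap hsurj
      (QuotientAddGroup.map Q Q σ.R.toAddMonoidHom hQ.hR).toIntLinearMap (fun x => rfl)
  have hex : ∀ g, (QuotientAddGroup.mk' Q).toIntLinearMap g = 0 ↔ ∃ h, Q.subtype.toIntLinearMap h = g := by
    intro g
    show (QuotientAddGroup.mk g : G ⧸ Q) = 0 ↔ ∃ h : Q, (h : G) = g
    rw [QuotientAddGroup.eq_zero_iff]
    exact ⟨fun h => ⟨⟨g, h⟩, rfl⟩, fun ⟨h, e⟩ => e ▸ h.2⟩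
  have hker : LinearMap.ker (QuotientAddGroup.mk' Q).toIntLinearMap = LinearMap.range Q.subtype.toIntLinearMap := by
    ext g
    rw [LinearMap.mem_ker, hex, LinearMap.mem_range]
  have hrank := rank_exact _ hinj _ hsurj hker
  have hr1 : 0 < Module.finrank ℤ Q := by
    rw [Module.finrank_pos_iff]
    exact (AddSubgroup.nontrivial_iff_ne_bot Q).2 hQ.ne_bot
  have hr2 : 0 < Module.finrank ℤ (G ⧸ Q) := by
    rw [Module.finrank_pos_iff]
    obtain ⟨g, hg⟩ : ∃ g, g ∉ Q := by
      by_contra! h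
      exact hQ.ne_top ((AddSubgroup.eq_top_iff' Q).2 h)
    exact ⟨⟨QuotientAddGroup.mk g, 0, fun h => hg ((QuotientAddGroup.eq_zero_iff g).1 h)⟩⟩
  obtain ⟨Y, _, _, σK, σH, hK, hH', hfin⟩ := σ.factor hH Q.subtype.toIntLinearMap hinj
    (QuotientAddGroup.mk' Q).toIntLinearMap hsurj hex eH heH eK heK (by
      intro x r
      obtain ⟨x', h1, h2, h3⟩ := hQ.shift x r r.2
      exact ⟨x', h1, ⟨⟨_, h2⟩, rfl⟩, h3⟩)
  exact hfin (ih _ (by omega) _ _ _ σK hK rfl) (ih _ (by omega) _ _ _ σH hH' rfl)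

end Sys
end HT

namespace HT
open Topology

section MatNorm
attribute [local instance] Matrix.linftyOpNormedRing Matrix.linftyOpNormedAlgebra

lemma pow_tendsto_of_spec {d : ℕ} (A : Matrix (Fin d) (Fin d) ℂ)
    (h : ∀ z ∈ spectrum ℂ A, ‖z‖ < 1) (i j : Fin d) :
    Tendsto (fun n : ℕ => (A ^ n) i j) atTop (𝓝 0) := by
  have hne : Nonempty (Fin d) := ⟨i⟩
  have hcs : CompleteSpace (Matrix (Fin d) (Fin d) ℂ) := FiniteDimensional.complete ℂ _
  have h1 : spectralRadius ℂ A < ((1 : NNReal) : ENNReal) :=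
    spectrum.spectralRadius_lt_of_forall_lt A (fun z hz => by
      have := h z hz
      exact_mod_cast this)
  have h2 := spectrum.pow_nnnorm_pow_one_div_tendsto_nhds_spectralRadius A
  obtain ⟨r, hr1, hr2⟩ := ENNReal.lt_iff_exists_nnreal_btwn.1 h1
  have h3 : ∀ᶠ n : ℕ in atTop, ‖A ^ n‖ ≤ (r : ℝ) ^ n := by
    filter_upwards [h2.eventually (gt_mem_nhds hr1), eventually_gt_atTop 0] with n hn hn0
    have h4 : ((‖A ^ n‖₊ : ENNReal) ^ (1 / n : ℝ)) ^ (n : ℝ) ≤ (r : ENNReal) ^ (n : ℝ) :=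
      ENNReal.rpow_le_rpow hn.le (by positivity)
    rw [← ENNReal.rpow_mul, one_div_mul_cancel (by positivity), ENNReal.rpow_one,
      ENNReal.rpow_natCast] at h4
    exact_mod_cast h4
  have hr3 : (r : ℝ) < 1 := by exact_mod_cast hr2
  have h5 : Tendsto (fun n : ℕ => (r : ℝ) ^ n) atTop (𝓝 0) :=
    tendsto_pow_atTop_nhds_zero_of_lt_one r.2 hr3
  have h6 : Tendsto (fun n : ℕ => A ^ n) atTop (𝓝 0) := squeeze_zero_norm' h3 h5
  have h7 : Continuous fun M : Matrix (Fin d) (Fin d) ℂ => M i j :=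
    (LinearMap.continuous_of_finiteDimensional (Matrix.entryLinearMap ℂ ℂ i j))
  exact (h7.tendsto 0).comp h6

end MatNorm

lemma expanding_inv {d : ℕ} (R : Matrix (Fin d) (Fin d) ℤ) (hR : IsExpanding R) :
    IsUnit (intMatCast R).det ∧
    ∀ i j, Tendsto (fun n : ℕ => ((intMatCast R)⁻¹ ^ n) i j) atTop (𝓝 0) := by
  set Ac : Matrix (Fin d) (Fin d) ℂ := R.map (Int.cast : ℤ → ℂ) with hAc
  have hAc' : Ac = (intMatCast R).map (Complex.ofRealHom) := by
    ext i j; simp [hAc, intMatCast]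
  have hu : IsUnit Ac := by
    by_contra hu
    have := hR 0 (spectrum.zero_mem_iff ℂ |>.2 hu)
    norm_num at this
  have hdet : (intMatCast R).det ≠ 0 := by
    have h1 := (Matrix.isUnit_iff_isUnit_det _).1 hu
    rw [hAc'] at h1
    have h2 : (((intMatCast R).map Complex.ofRealHom).det) = Complex.ofRealHom (intMatCast R).det := by
      rw [RingHom.map_det]; rfl
    rw [h2] at h1
    intro h0
    rw [h0] at h1; simp at h1
  have hdu : IsUnit (intMatCast R).det := isUnit_iff_ne_zero.2 hdet
  refine ⟨hdu, fun i j => ?_⟩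
  have hprod : Ac * ((intMatCast R)⁻¹).map Complex.ofRealHom = 1 := by
    rw [hAc', ← Matrix.map_mul, Matrix.mul_nonsing_inv _ hdu]
    simp [Matrix.map_one]
  have hprod2 : ((intMatCast R)⁻¹).map Complex.ofRealHom * Ac = 1 := by
    rw [hAc', ← Matrix.map_mul, Matrix.nonsing_inv_mul _ hdu]
    simp [Matrix.map_one]
  let u : (Matrix (Fin d) (Fin d) ℂ)ˣ := ⟨Ac, _, hprod, hprod2⟩
  have hs := spectrum.map_inv (𝕜 := ℂ) u
  have ht := pow_tendsto_of_spec (((intMatCast R)⁻¹).map Complex.ofRealHom) (fun z hz => by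
    have hz2 : z ∈ spectrum ℂ ((u⁻¹ : (Matrix (Fin d) (Fin d) ℂ)ˣ) : Matrix (Fin d) (Fin d) ℂ) := hz
    rw [← hs, Set.mem_inv] at hz2
    have := hR _ hz2
    rw [norm_inv] at this
    exact (one_lt_inv_iff₀.1 this).2) i j
  have hre : ∀ n : ℕ, ((((intMatCast R)⁻¹).map Complex.ofRealHom) ^ n) i j =
      ((((intMatCast R)⁻¹ ^ n) i j : ℝ) : ℂ) := by
    intro n
    have : (((intMatCast R)⁻¹).map Complex.ofRealHom) ^ n = ((intMatCast R)⁻¹ ^ n).map Complex.ofRealHom :=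
      (Matrix.map_pow _ _ _).symm
    rw [this]; rfl
  simp_rw [hre] at ht
  have := (Complex.continuous_re.tendsto 0).comp ht
  simpa [Function.comp_def] using this

/-! ### functionals and vectors -/
section Vec
variable {d : ℕ}

/-- the vector of a functional -/
def fvec (ξ : Fr (Fin d → ℤ)) : Fin d → ℝ := fun i => ξ (Pi.single i 1)

/-- the functional of a vector -/
def vfun (v : Fin d → ℝ) : Fr (Fin d → ℤ) where
  toFun g := v ⬝ᵥ intVecCast g
  map_add' a b := by
    simp [dotProduct, intVecCast, mul_add, Finset.sum_add_distrib]
  map_smul' c a := by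
    simp only [dotProduct, intVecCast, Finset.mul_sum, Pi.smul_apply, smul_eq_mul, Int.cast_mul,
      eq_intCast, zsmul_eq_mul]
    exact Finset.sum_congr rfl fun i _ => by simp; ring

lemma fvec_vfun (v : Fin d → ℝ) : fvec (vfun v) = v := by
  funext i
  simp [fvec, vfun, dotProduct, intVecCast, Pi.single_apply]

lemma vfun_fvec (ξ : Fr (Fin d → ℤ)) : vfun (fvec ξ) = ξ := by
  apply LinearMap.ext
  intro g
  have hg : g = ∑ i, g i • (Pi.single i (1:ℤ) : Fin d → ℤ) := by
    funext j
    simp [Finset.sum_apply, Pi.single_apply]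
  conv_rhs => rw [hg]
  rw [map_sum]
  simp only [map_smul]
  simp only [vfun, dotProduct, intVecCast, fvec, zsmul_eq_mul, LinearMap.coe_mk, AddHom.coe_mk]
  exact Finset.sum_congr rfl fun i _ => mul_comm _ _

lemma vfun_apply (v : Fin d → ℝ) (g : Fin d → ℤ) : vfun v g = v ⬝ᵥ intVecCast g := rfl

lemma apply_eq (ξ : Fr (Fin d → ℤ)) (g : Fin d → ℤ) : ξ g = fvec ξ ⬝ᵥ intVecCast g := by
  rw [← vfun_apply, vfun_fvec]

/-- equivalence -/
def vequiv : Fr (Fin d → ℤ) ≃ₗ[ℝ] (Fin d → ℝ) where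
  toFun := fvec
  invFun := vfun
  left_inv := vfun_fvec
  right_inv := fvec_vfun
  map_add' a b := by funext i; simp [fvec]
  map_smul' a b := by funext i; simp [fvec]

/-- the inverse dual action -/
def Sv (M : Matrix (Fin d) (Fin d) ℝ) : Fr (Fin d → ℤ) →ₗ[ℝ] Fr (Fin d → ℤ) :=
  vequiv.symm.toLinearMap ∘ₗ (Matrix.mulVecLin Mᵀ) ∘ₗ vequiv.toLinearMap

lemma fvec_Sv (M : Matrix (Fin d) (Fin d) ℝ) (ξ) : fvec (Sv M ξ) = Mᵀ *ᵥ fvec ξ := by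
  change vequiv (vequiv.symm _) = _
  rw [LinearEquiv.apply_symm_apply]; rfl

lemma dot_Sv (M : Matrix (Fin d) (Fin d) ℝ) (ξ) (y : Fin d → ℝ) :
    fvec (Sv M ξ) ⬝ᵥ y = fvec ξ ⬝ᵥ (M *ᵥ y) := by
  rw [fvec_Sv, Matrix.mulVec_transpose, Matrix.dotProduct_mulVec]

lemma dot_Sv_pow (M : Matrix (Fin d) (Fin d) ℝ) (n : ℕ) : ∀ (ξ) (y : Fin d → ℝ),
    fvec ((Sv M ^ n) ξ) ⬝ᵥ y = fvec ξ ⬝ᵥ ((M ^ n) *ᵥ y) := by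
  induction n with
  | zero => intro ξ y; simp
  | succ n ih =>
    intro ξ y
    rw [pow_succ, Module.End.mul_apply, ih, dot_Sv, Matrix.mulVec_mulVec, ← pow_succ']

lemma castVec_mulVec (R : Matrix (Fin d) (Fin d) ℤ) (g : Fin d → ℤ) :
    intVecCast (R *ᵥ g) = intMatCast R *ᵥ intVecCast g := by
  funext i
  simp [intVecCast, intMatCast, Matrix.mulVec, dotProduct]

/-- the expanding system of a matrix -/
def matEx (R : Matrix (Fin d) (Fin d) ℤ) (hR : IsExpanding R) : Ex (Fin d → ℤ) where
  R := Matrix.mulVecLin R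
  S := Sv (intMatCast R)⁻¹
  hSR ξ g := by
    rw [apply_eq, dot_Sv, Matrix.mulVecLin_apply, castVec_mulVec, Matrix.mulVec_mulVec,
      Matrix.nonsing_inv_mul _ (expanding_inv R hR).1, Matrix.one_mulVec, ← apply_eq]
  hS ξ := by
    apply LinearMap.ext
    intro g
    have key : ∀ y : Fin d → ℝ, fvec (ξ ∘ₗ Matrix.mulVecLin R) ⬝ᵥ y = fvec ξ ⬝ᵥ (intMatCast R *ᵥ y) := by
      intro y
      have : fvec (ξ ∘ₗ Matrix.mulVecLin R) = fvec ξ ᵥ* intMatCast R := by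
        funext i
        have h1 : fvec (ξ ∘ₗ Matrix.mulVecLin R) i = ξ (R *ᵥ Pi.single i 1) := rfl
        rw [h1, apply_eq, castVec_mulVec]
        simp [dotProduct, Matrix.vecMul, Matrix.mulVec, intVecCast, Pi.single_apply]
      rw [this, Matrix.dotProduct_mulVec]
    rw [apply_eq, dot_Sv, key, Matrix.mulVec_mulVec,
      Matrix.mul_nonsing_inv _ (expanding_inv R hR).1, Matrix.one_mulVec, ← apply_eq]
  lim ξ g := by
    simp_rw [apply_eq, dot_Sv_pow]
    have h := (expanding_inv R hR).2
    have : Tendsto (fun n : ℕ => ∑ i, fvec ξ i * ∑ j, ((intMatCast R)⁻¹ ^ n) i j * intVecCast g j) atTop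
        (𝓝 (∑ i, fvec ξ i * ∑ j, 0 * intVecCast g j)) :=
      tendsto_finsetSum _ fun i _ => (tendsto_finsetSum _ fun j _ => (h i j).mul_const _).const_mul _
    simpa [dotProduct, Matrix.mulVec] using this

end Vec
end HT

namespace HT
open Topology

section Fin
variable {d : ℕ}

/-- the system of a digit set -/
def matSys (R : Matrix (Fin d) (Fin d) ℤ) (B : Finset (Fin d → ℤ)) (hR : IsExpanding R) (hB : 0 < B.card) :
    Sys (Fin d → ℤ) B Unit where
  toEx := matEx R hR
  π := fun _ => ()
  β := fun b => b.1
  N := B.card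
  hN := hB
  fib := fun c => by simp

lemma matSys_ms (R : Matrix (Fin d) (Fin d) ℤ) (B : Finset (Fin d → ℤ)) (hR : IsExpanding R) (hB : 0 < B.card)
    (c : Unit) (ξ : Fr (Fin d → ℤ)) : (matSys R B hR hB).ms c ξ = ∑ b : B, eC (ξ b.1) := by
  unfold Sys.ms
  refine Finset.sum_congr ?_ fun _ _ => rfl
  ext; simp

lemma expv_eq (x y : Fin d → ℝ) : expv x y = eC (x ⬝ᵥ y) := rfl

lemma matSys_had (R : Matrix (Fin d) (Fin d) ℤ) (B L : Finset (Fin d → ℤ)) (hR : IsExpanding R) (hB : 0 < B.card)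
    (hH : IsHadamardTriple R B L) : (matSys R B hR hB).Had := by
  have hN : (B.card : ℂ) ≠ 0 := by exact_mod_cast hB.ne'
  refine Sys.had_of_family _ (fun l : L => vfun (intVecCast l.1)) ?_ ?_ ?_
  · intro l g
    refine ⟨∑ i, l.1 i * g i, ?_⟩
    simp [vfun_apply, dotProduct, intVecCast]
  · intro l l' hne c
    rw [matSys_ms]
    have hco := col_orth (I := B) (J := L) (by simpa using hH.1)
      (fun b l => expv ((intMatCast R)⁻¹.mulVec (intVecCast b.1)) (intVecCast l.1)) B.card hN (fun b b' => by
        have h := hH.2 b.1 b.2 b'.1 b'.2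
        rw [← Finset.sum_coe_sort L] at h
        by_cases hb : b = b'
        · rw [if_pos (congrArg Subtype.val hb), inv_mul_eq_one₀ hN] at h
          rw [if_pos hb]; exact h.symm
        · rw [if_neg (fun h => hb (Subtype.ext h)), mul_eq_zero] at h
          rw [if_neg hb]
          exact h.resolve_left (inv_ne_zero hN)) l' l
    rw [if_neg (Ne.symm hne)] at hco
    rw [← hco]
    refine Finset.sum_congr rfl fun b _ => ?_
    rw [mul_comm, expv_eq, expv_eq, ← eC_sub]
    congr 1
    change Sv (intMatCast R)⁻¹ _ _ = _
    rw [apply_eq, dot_Sv]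
    have : fvec (vfun (intVecCast l.1) - vfun (intVecCast l'.1)) = intVecCast l.1 - intVecCast l'.1 := by
      change vequiv (vequiv.symm (intVecCast l.1) - vequiv.symm (intVecCast l'.1)) = _
      rw [map_sub, LinearEquiv.apply_symm_apply, LinearEquiv.apply_symm_apply]
    rw [this, sub_dotProduct, dotProduct_comm, dotProduct_comm (intVecCast l'.1)]
  · rw [Fintype.card_coe]; exact hH.1.symm

lemma card_pos_of (R : Matrix (Fin d) (Fin d) ℤ) (B : Finset (Fin d → ℤ)) (μ : Measure (Fin d → ℝ))
    (hμ : IsSelfAffineMeasure R B μ) : 0 < B.card := by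
  rw [Finset.card_pos, Finset.nonempty_iff_ne_empty]
  rintro rfl
  have := hμ.1
  have h := hμ.2.2 Set.univ MeasurableSet.univ
  simp at h

/-! ### the Fourier transform recursion -/

/-- Fourier transform -/
def phi (μ : Measure (Fin d → ℝ)) (v : Fin d → ℝ) : ℂ := ∫ y, eC (v ⬝ᵥ y) ∂μ

lemma continuous_dot (v : Fin d → ℝ) : Continuous fun y : Fin d → ℝ => v ⬝ᵥ y := by
  unfold dotProduct; fun_prop

lemma aesm_eC (ν : Measure (Fin d → ℝ)) (v : Fin d → ℝ) :
    AEStronglyMeasurable (fun y => eC (v ⬝ᵥ y)) ν :=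
  (continuous_eC.comp (continuous_dot v)).aestronglyMeasurable

lemma integral_of_map {Ω : Type} [MeasurableSpace Ω] {P : Measure Ω} {μ : Measure (Fin d → ℝ)}
    {F : Ω → (Fin d → ℝ)} (hF : Measurable F) (h : P.map F = μ) {k : (Fin d → ℝ) → ℂ}
    (hk : AEStronglyMeasurable k μ) : ∫ y, k y ∂μ = ∫ ω, k (F ω) ∂P := by
  subst h
  exact integral_map hF.aemeasurable hk

lemma integrable_eC (μ : Measure (Fin d → ℝ)) [IsProbabilityMeasure μ] (v : Fin d → ℝ) :
    Integrable (fun y => eC (v ⬝ᵥ y)) μ :=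
  Integrable.of_bound (continuous_eC.comp (continuous_dot v)).aestronglyMeasurable 1
    (Eventually.of_forall fun _ => (norm_eC _).le)

lemma phi_rec (R : Matrix (Fin d) (Fin d) ℤ) (B : Finset (Fin d → ℤ)) (hR : IsExpanding R) (hB : 0 < B.card)
    (μ : Measure (Fin d → ℝ)) (hμ : IsSelfAffineMeasure R B μ) (ξ : Fr (Fin d → ℤ)) :
    phi μ (fvec ξ) = (B.card : ℂ)⁻¹ * (matSys R B hR hB).ms () ((matSys R B hR hB).S ξ) *
      phi μ (fvec ((matSys R B hR hB).S ξ)) := by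
  have hp := hμ.1
  set τ : (Fin d → ℤ) → (Fin d → ℝ) → (Fin d → ℝ) := fun b x =>
    (intMatCast R)⁻¹.mulVec (x + intVecCast b) with hτ
  have hτc : ∀ b, Continuous (τ b) := fun b => by
    simp only [hτ]
    exact Continuous.matrix_mulVec continuous_const (by fun_prop)
  have hμe : μ = (B.card : ENNReal)⁻¹ • ∑ b ∈ B, μ.map (τ b) := by
    refine Measure.ext fun E hE => ?_
    rw [hμ.2.2 E hE, Measure.smul_apply, Measure.finsetSum_apply, smul_eq_mul]
    congr 1
    refine Finset.sum_congr rfl fun b _ => ?_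
    rw [Measure.map_apply (hτc b).measurable hE]
  have hmp : ∀ b, IsProbabilityMeasure (μ.map (τ b)) := fun b =>
    Measure.isProbabilityMeasure_map (hτc b).measurable.aemeasurable
  unfold phi
  conv_lhs => rw [hμe]
  rw [integral_smul_measure, integral_finsetSum_measure (fun b _ => by
    have := hmp b
    exact integrable_eC _ _), matSys_ms, Finset.sum_coe_sort B (fun b => eC (((matSys R B hR hB).S ξ) b))]
  rw [mul_assoc, Finset.sum_mul, ENNReal.toReal_inv, ENNReal.toReal_natCast, Complex.real_smul]
  push_cast
  congr 1
  refine Finset.sum_congr rfl fun b _ => ?_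
  rw [integral_map (hτc b).measurable.aemeasurable (aesm_eC _ _), ← integral_const_mul]
  congr 1
  funext x
  rw [← eC_add]
  congr 1
  change _ = (Sv (intMatCast R)⁻¹ ξ) b + fvec (Sv (intMatCast R)⁻¹ ξ) ⬝ᵥ x
  rw [apply_eq, ← dotProduct_add, dot_Sv, add_comm]

lemma phi_iter (R : Matrix (Fin d) (Fin d) ℤ) (B : Finset (Fin d → ℤ)) (hR : IsExpanding R) (hB : 0 < B.card)
    (μ : Measure (Fin d → ℝ)) (hμ : IsSelfAffineMeasure R B μ) (ξ : Fr (Fin d → ℤ)) (n : ℕ) :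
    phi μ (fvec ξ) = ((B.card : ℂ) ^ n)⁻¹ *
      (∏ i : Fin n, (matSys R B hR hB).ms () (((matSys R B hR hB).S ^ (i.1 + 1)) ξ)) *
      phi μ (fvec (((matSys R B hR hB).S ^ n) ξ)) := by
  induction n with
  | zero => simp
  | succ n ih =>
    rw [ih, phi_rec R B hR hB μ hμ, Fin.prod_univ_castSucc]
    simp only [Fin.val_castSucc, Fin.val_last]
    rw [← Module.End.mul_apply, ← pow_succ', pow_succ (B.card : ℂ), mul_inv]
    ring

lemma phi_lim (R : Matrix (Fin d) (Fin d) ℤ) (B : Finset (Fin d → ℤ)) (hR : IsExpanding R) (hB : 0 < B.card)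
    (μ : Measure (Fin d → ℝ)) [IsProbabilityMeasure μ] (ξ : Fr (Fin d → ℤ)) :
    Tendsto (fun n => phi μ (fvec (((matSys R B hR hB).S ^ n) ξ))) atTop (𝓝 1) := by
  have h1 : (1 : ℂ) = ∫ _y, (1 : ℂ) ∂μ := by simp
  rw [h1]
  refine tendsto_integral_of_dominated_convergence (fun _ => (1 : ℝ))
    (fun n => (continuous_eC.comp (continuous_dot _)).aestronglyMeasurable) (integrable_const _)
    (fun n => Eventually.of_forall fun y => (norm_eC _).le) (Eventually.of_forall fun y => ?_)
  have h2 : Tendsto (fun n => fvec (((matSys R B hR hB).S ^ n) ξ) ⬝ᵥ y) atTop (𝓝 0) := by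
    have : Tendsto (fun n => fvec (((matSys R B hR hB).S ^ n) ξ) ⬝ᵥ y) atTop (𝓝 (∑ i, 0 * y i)) :=
      tendsto_finsetSum _ fun i _ => ((matSys R B hR hB).lim ξ (Pi.single i 1)).mul_const _
    simpa using this
  have := (continuous_eC.tendsto 0).comp h2
  rwa [eC_zero] at this

lemma phi_eq_einf (R : Matrix (Fin d) (Fin d) ℤ) (B : Finset (Fin d → ℤ)) (hR : IsExpanding R) (hB : 0 < B.card)
    (μ : Measure (Fin d → ℝ)) (hμ : IsSelfAffineMeasure R B μ) {Ω : Type} [MeasurableSpace Ω] (P : Measure Ω)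
    [IsProbabilityMeasure P] (x : ℕ → Ω → B) (hx : Rz P x) (ξ : Fr (Fin d → ℤ)) :
    ∫ ω, (matSys R B hR hB).einf ξ (fun i => x i ω) ∂P = phi μ (fvec ξ) := by
  have hp := hμ.1
  set σ := matSys R B hR hB with hσ
  have h1 : Tendsto (fun n => ∫ ω, σ.ew n ξ (fun i => x i ω) ∂P) atTop
      (𝓝 (∫ ω, σ.einf ξ (fun i => x i ω) ∂P)) :=
    tendsto_integral_of_dominated_convergence (fun _ => (1 : ℝ))
      (fun n => (hx.measurable n (σ.ew n ξ)).aestronglyMeasurable) (integrable_const _)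
      (fun n => Eventually.of_forall fun y => (σ.norm_ew _ _ _).le)
      (Eventually.of_forall fun ω => σ.einf_tendsto ξ (fun i => x i ω))
  have h2 : ∀ n, ∫ ω, σ.ew n ξ (fun i => x i ω) ∂P =
      ((B.card : ℂ) ^ n)⁻¹ * ∏ i : Fin n, σ.ms () ((σ.S ^ (i.1 + 1)) ξ) := by
    intro n
    rw [hx.integralC n, Fintype.card_coe]
    congr 1
    rw [← σ.sum_ew (fun _ => ()) ξ]
    refine Finset.sum_congr ?_ fun _ _ => rfl
    ext w
    simp [Sys.mem_cw]
  have h3 := h1.mul (phi_lim R B hR hB μ ξ)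
  rw [mul_one] at h3
  refine tendsto_nhds_unique h3 ?_
  simp_rw [h2]
  have h4 := phi_iter R B hR hB μ hμ ξ
  exact tendsto_const_nhds.congr h4

/-! ### the coding map -/

/-- coordinates of the coding map -/
def cterm (R : Matrix (Fin d) (Fin d) ℤ) (B : Finset (Fin d → ℤ)) (hR : IsExpanding R) (hB : 0 < B.card)
    (j : Fin d) (i : ℕ) (b : B) : ℝ :=
  (((matSys R B hR hB).S ^ (i + 1)) (vfun (Pi.single j 1))) b.1

/-- the coding map -/
def code (R : Matrix (Fin d) (Fin d) ℤ) (B : Finset (Fin d → ℤ)) (hR : IsExpanding R) (hB : 0 < B.card)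
    (w : ℕ → B) : Fin d → ℝ := fun j => ∑' i, cterm R B hR hB j i (w i)

/-- partial sums -/
def pcode (R : Matrix (Fin d) (Fin d) ℤ) (B : Finset (Fin d → ℤ)) (hR : IsExpanding R) (hB : 0 < B.card)
    (n : ℕ) (w : Fin n → B) : Fin d → ℝ := fun j => ∑ i : Fin n, cterm R B hR hB j i (w i)

variable (R : Matrix (Fin d) (Fin d) ℤ) (B : Finset (Fin d → ℤ)) (hR : IsExpanding R) (hB : 0 < B.card)

lemma summable_cterm (j : Fin d) (w : ℕ → B) : Summable fun i => cterm R B hR hB j i (w i) :=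
  (matSys R B hR hB).summable_einf (vfun (Pi.single j 1)) w

lemma pcode_tendsto (w : ℕ → B) :
    Tendsto (fun n => pcode R B hR hB n (fun i => w i)) atTop (𝓝 (code R B hR hB w)) := by
  rw [tendsto_pi_nhds]
  intro j
  have := (summable_cterm R B hR hB j w).hasSum.tendsto_sum_nat
  refine this.congr fun n => ?_
  exact (Fin.sum_univ_eq_sum_range (fun i => cterm R B hR hB j i (w i)) n).symm

lemma einf_code (ξ : Fr (Fin d → ℤ)) (w : ℕ → B) :
    (matSys R B hR hB).einf ξ w = eC (fvec ξ ⬝ᵥ code R B hR hB w) := by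
  unfold Sys.einf
  congr 1
  have hξ : ξ = ∑ j, fvec ξ j • vfun (Pi.single j 1) := by
    apply vequiv.injective
    rw [map_sum]
    simp only [map_smul]
    change fvec ξ = ∑ j, fvec ξ j • fvec (vfun (Pi.single j 1))
    simp only [fvec_vfun]
    funext i
    simp [Finset.sum_apply, Pi.single_apply]
  have h1 : ∀ i, (((matSys R B hR hB).S ^ (i + 1)) ξ) ((matSys R B hR hB).β (w i)) =
      ∑ j, fvec ξ j * cterm R B hR hB j i (w i) := by
    intro i
    conv_lhs => rw [hξ]
    rw [map_sum, LinearMap.sum_apply]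
    refine Finset.sum_congr rfl fun j _ => ?_
    rw [map_smul, LinearMap.smul_apply, smul_eq_mul]
    rfl
  simp_rw [h1]
  rw [Summable.tsum_finsetSum (fun j _ => (summable_cterm R B hR hB j w).mul_left _)]
  refine Finset.sum_congr rfl fun j _ => ?_
  rw [tsum_mul_left]
  rfl

lemma pcode_meas {Ω : Type} [MeasurableSpace Ω] {P : Measure Ω} {x : ℕ → Ω → B} (hx : Rz P x) (n : ℕ) :
    Measurable fun ω => pcode R B hR hB n (fun i => x i ω) := by
  rw [measurable_pi_iff]
  intro j
  exact Complex.measurable_re.comp (hx.measurable n (fun w => ((pcode R B hR hB n w j : ℝ) : ℂ)))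

lemma code_meas {Ω : Type} [MeasurableSpace Ω] {P : Measure Ω} {x : ℕ → Ω → B} (hx : Rz P x) :
    Measurable fun ω => code R B hR hB (fun i => x i ω) :=
  measurable_of_tendsto_metrizable (f := fun n ω => pcode R B hR hB n (fun i => x i ω))
    (fun n => pcode_meas R B hR hB hx n)
    (tendsto_pi_nhds.2 fun ω => pcode_tendsto R B hR hB (fun i => x i ω))

lemma map_code (μ : Measure (Fin d → ℝ)) (hμ : IsSelfAffineMeasure R B μ) {Ω : Type} [MeasurableSpace Ω]
    (P : Measure Ω) [IsProbabilityMeasure P] (x : ℕ → Ω → B) (hx : Rz P x) :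
    P.map (fun ω => code R B hR hB (fun i => x i ω)) = μ := by
  have hp := hμ.1
  have hm := code_meas R B hR hB hx
  have hp2 : IsProbabilityMeasure (P.map (fun ω => code R B hR hB (fun i => x i ω))) :=
    Measure.isProbabilityMeasure_map hm.aemeasurable
  refine Measure.ext_of_charFunDual ?_
  funext L
  have hL : ∀ y : Fin d → ℝ, Complex.exp (L y * Complex.I) =
      eC ((fun j => L (Pi.single j 1) / (2 * Real.pi)) ⬝ᵥ y) := by
    intro y
    have hy : L y = ∑ j, L (Pi.single j 1) * y j := by
      have : y = ∑ j, y j • (Pi.single j (1:ℝ) : Fin d → ℝ) := by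
        funext i; simp [Finset.sum_apply, Pi.single_apply]
      conv_lhs => rw [this]
      rw [map_sum]
      refine Finset.sum_congr rfl fun j _ => ?_
      rw [map_smul, smul_eq_mul, mul_comm]
    have h2 : (fun j => L (Pi.single j 1) / (2 * Real.pi)) ⬝ᵥ y = L y / (2 * Real.pi) := by
      rw [hy, Finset.sum_div]
      exact Finset.sum_congr rfl fun j _ => by ring
    rw [h2]
    unfold eC
    congr 1
    push_cast
    have : (Real.pi : ℂ) ≠ 0 := by exact_mod_cast Real.pi_ne_zero
    field_simp
  rw [charFunDual_apply, charFunDual_apply]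
  simp_rw [hL]
  set v : Fin d → ℝ := fun j => L (Pi.single j 1) / (2 * Real.pi)
  rw [integral_map hm.aemeasurable (aesm_eC _ _)]
  have h3 := phi_eq_einf R B hR hB μ hμ P x hx (vfun v)
  simp_rw [einf_code, fvec_vfun] at h3
  exact h3

/-! ### existence of a realization -/

lemma exists_rz (X : Type) [Fintype X] [Nonempty X] : ∃ (Ω : Type) (_ : MeasurableSpace Ω) (P : Measure Ω)
    (_ : IsProbabilityMeasure P) (x : ℕ → Ω → X), Rz P x := by
  let mX : MeasurableSpace X := ⊤
  have hdm : DiscreteMeasurableSpace X := ⟨fun _ => trivial⟩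
  let ν : Measure X := (PMF.uniformOfFintype X).toMeasure
  have hν : IsProbabilityMeasure ν := PMF.toMeasure.isProbabilityMeasure _
  refine ⟨ℕ → X, inferInstance, Measure.infinitePi (fun _ : ℕ => ν), inferInstance, fun n ω => ω n, ?_, ?_⟩
  · intro n a
    have hm : Measurable fun ω : ℕ → X => ω n := measurable_pi_apply n
    have ha : MeasurableSet ({a} : Set X) := measurableSet_singleton a
    exact hm ha
  · intro n w
    have h0 : {ω : ℕ → X | ∀ i : Fin n, ω i = w i} = Set.pi (Finset.range n : Finset ℕ)
        (fun i => if h : i < n then {w ⟨i, h⟩} else Set.univ) := by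
      ext ω
      simp only [Set.mem_ofPred_eq, Set.mem_pi, Finset.coe_range, Set.mem_Iio]
      constructor
      · intro h i hi
        rw [dif_pos hi]
        exact h ⟨i, hi⟩
      · intro h i
        have := h i.1 i.2
        rw [dif_pos i.2] at this
        exact this
    rw [Measure.real, h0, Measure.infinitePi_pi _ (fun i _ => MeasurableSet.of_discrete)]
    have h1 : ∀ i ∈ Finset.range n, ν (if h : i < n then {w ⟨i, h⟩} else Set.univ) = (Fintype.card X : ENNReal)⁻¹ := by
      intro i hi
      rw [dif_pos (Finset.mem_range.1 hi)]
      change (PMF.uniformOfFintype X).toMeasure _ = _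
      rw [PMF.toMeasure_apply_singleton _ _ (measurableSet_singleton _), PMF.uniformOfFintype_apply]
    rw [Finset.prod_congr rfl h1, Finset.prod_const, Finset.card_range, ENNReal.toReal_pow, ENNReal.toReal_inv,
      ENNReal.toReal_natCast, inv_pow]

lemma final (μ : Measure (Fin d → ℝ)) (hμ : IsSelfAffineMeasure R B μ) (Λ0 : Set (Fr (Fin d → ℤ)))
    (h0 : (matSys R B hR hB).SpecSet Λ0) : IsSpectrum μ (fvec '' Λ0) := by
  have hp := hμ.1
  obtain ⟨hc, ho, ht⟩ := h0
  set σ := matSys R B hR hB with hσ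
  refine ⟨hc.image _, ?_, ?_⟩
  · rintro _ ⟨l, hl, rfl⟩ _ ⟨l', hl', rfl⟩
    by_cases hll : l = l'
    · subst hll
      rw [if_pos rfl]
      have : ∀ x : Fin d → ℝ, expv (fvec l) x * (starRingEnd ℂ) (expv (fvec l) x) = 1 := fun x => by
        rw [expv_eq, eC_mul_conj]
      simp_rw [this]
      simp
    · have hne : fvec l ≠ fvec l' := fun h => hll (vequiv.injective h)
      rw [if_neg hne]
      have h1 : ∀ x : Fin d → ℝ, expv (fvec l) x * (starRingEnd ℂ) (expv (fvec l') x) =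
          eC (fvec (l - l') ⬝ᵥ x) := fun x => by
        rw [expv_eq, expv_eq, ← eC_sub, ← sub_dotProduct]
        congr 2
      simp_rw [h1]
      obtain ⟨i, hi⟩ := ho l hl l' hl' hll
      have h2 := phi_iter R B hR hB μ hμ (l - l') (i + 1)
      rw [Finset.prod_eq_zero (Finset.mem_univ (⟨i, Nat.lt_succ_self i⟩ : Fin (i+1))) (hi ())] at h2
      rw [mul_zero, zero_mul] at h2
      exact h2
  · intro f hf
    have hBn : Nonempty B := by
      obtain ⟨b, hb⟩ := Finset.card_pos.1 hB
      exact ⟨⟨b, hb⟩⟩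
    obtain ⟨Ω, mΩ, P, hP, x, hx⟩ := exists_rz B
    set F : Ω → (Fin d → ℝ) := fun ω => code R B hR hB (fun i => x i ω) with hF
    have hFm : Measurable F := code_meas R B hR hB hx
    have hmap : P.map F = μ := map_code R B hR hB μ hμ P x hx
    have hmp : MeasurePreserving F P μ := ⟨hFm, hmap⟩
    have hf2 : MemLp f 2 μ := Lp.memLp f
    have hh2 : MemLp (f ∘ F) 2 P := hf2.comp_measurePreserving hmp
    have hhi : Integrable (f ∘ F) P := hh2.integrable (by norm_num)
    have hfi : Integrable f μ := hf2.integrable (by norm_num)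
    have hcyl := ht Ω P x hx (f ∘ F) hh2 (by
      intro l hl n g
      have h1 := hf (fvec l) ⟨l, hl, rfl⟩
      have hcont : Continuous fun y : Fin d → ℝ => (starRingEnd ℂ) (expv (fvec l) y) :=
        Complex.continuous_conj.comp (continuous_eC.comp (continuous_dot _))
      have hae : AEStronglyMeasurable (fun y => (starRingEnd ℂ) (expv (fvec l) y) * f y) μ :=
        hcont.aestronglyMeasurable.mul hf2.1
      rw [integral_of_map hFm hmap hae] at h1
      have h2 : ∀ ω, (f ∘ F) ω * (starRingEnd ℂ) (σ.einf l fun i => x i ω) * g (fun i => σ.π (x i ω)) =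
          ((starRingEnd ℂ) (expv (fvec l) (F ω)) * f (F ω)) * g (fun _ => ()) := by
        intro ω
        rw [hσ, einf_code]
        simp only [Function.comp_apply, expv_eq, hF]
        rw [mul_comm (f _)]
      simp_rw [h2]
      rw [integral_mul_const]
      rw [h1, zero_mul])
    have hz : ∀ᵐ y ∂μ, f y = 0 := by
      refine ae_eq_zero_of_integral_contDiff_smul_eq_zero hfi.locallyIntegrable ?_
      intro g hg hgs
      have hgc := hg.continuous
      obtain ⟨C, hC⟩ := hgs.exists_bound_of_continuous hgc
      rw [integral_of_map hFm hmap (k := fun y => g y • f y) (hgc.aestronglyMeasurable.smul hf2.1)]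
      have hlim : Tendsto (fun n => ∫ ω, g (pcode R B hR hB n (fun i => x i ω)) • f (F ω) ∂P) atTop
          (𝓝 (∫ ω, g (F ω) • f (F ω) ∂P)) := by
        refine tendsto_integral_of_dominated_convergence (fun ω => C * ‖f (F ω)‖) ?_ ?_ ?_ ?_
        · intro n
          exact (hgc.measurable.comp (pcode_meas R B hR hB hx n)).aestronglyMeasurable.smul hhi.1
        · exact hhi.norm.const_mul C
        · intro n
          refine Eventually.of_forall fun ω => ?_
          rw [norm_smul]
          exact mul_le_mul_of_nonneg_right (hC _) (norm_nonneg _)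
        · refine Eventually.of_forall fun ω => ?_
          exact ((hgc.tendsto _).comp (pcode_tendsto R B hR hB (fun i => x i ω))).smul_const _
      have hzero : ∀ n, ∫ ω, g (pcode R B hR hB n (fun i => x i ω)) • f (F ω) ∂P = 0 := by
        intro n
        have := hcyl n (fun w => ((g (pcode R B hR hB n w) : ℝ) : ℂ))
        rw [← this]
        congr 1
        funext ω
        rw [Complex.real_smul, mul_comm]
        rfl
      simp_rw [hzero] at hlim
      exact tendsto_nhds_unique hlim tendsto_const_nhds
    exact (Lp.eq_zero_iff_ae_eq_zero).2 hz

end Fin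
end HT


/-- Every Hadamard triple generates a spectral self-affine measure. -/
theorem hadamard_triple_spectral {d : ℕ} (hd : 1 ≤ d)
    (R : Matrix (Fin d) (Fin d) ℤ) (B L : Finset (Fin d → ℤ)) (N : ℕ)
    (hBN : B.card = N) (hLN : L.card = N)
    (hR : IsExpanding R) (hH : IsHadamardTriple R B L)
    (μ : Measure (Fin d → ℝ)) (hμ : IsSelfAffineMeasure R B μ) :
    ∃ Λ : Set (Fin d → ℝ), IsSpectrum μ Λ := by
  have hB := HT.card_pos_of R B μ hμ
  obtain ⟨Λ0, h0⟩ := HT.Sys.main _ _ _ _ (HT.matSys R B hR hB) (HT.matSys_had R B L hR hB hH) rfl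
  exact ⟨_, HT.final R B hR hB μ hμ Λ0 h0⟩

end
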